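/- arXiv:2309.12874 — 2 statements merged into one kernel-verified Lean document; each statement's English description precedes it below -/
import Mathlib

section
/- Let m ≥ 1 and ν ≥ 1 be integers and let N ⊆ ℝ^ν be a nonempty compact set admitting a C^1 retraction Π as in the context. There exist constants A, B, δ ∈ (0,∞), depending only on m, ν, N, ρ_N and Π, with the following property. Let u : S^m → ℝ^ν be Borel measurable with u(x) ∈ N for H^m-almost every x ∈ S^m and with finite Gagliardo energy E := ∬_{S^m×S^m} |u(x)−u(y)|^{m+1}/|x−y|^{2m} dH^m(x) dH^m(y) < ∞, and set G := ∬_{{(x,y)∈S^m×S^m : |u(x)−u(y)| ≥ δ}} |x−y|^{−2m} dH^m(x) dH^m(y). Then there exist a finite set S ⊆ B^{m+1}_1 with card S ≤ A·e^{B·G}·E and a map U : B^{m+1}_1 → ℝ^ν such that: (i) U(x) ∈ N for every x; (ii) U is continuous on B^{m+1}_1 \ S; (iii) U is differentiable at Lebesgue-almost every point of B^{m+1}_1; (iv) for every t ∈ (0,∞), the hyperbolic weak-type estimate holds: ∫_{{x ∈ B^{m+1}_1 : U is differentiable at x and ((1−|x|²)/2)·‖DU(x)‖ ≥ t}} (2/(1−|x|²))^{m+1}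 dx ≤ (A/t^{m+1})·e^{B·G}·E; (v) u is the trace of U in the sense that lim_{ε→0⁺} (1/ε)·∫_{{x : 1−ε < |x| < 1}} |U(x) − u(x/|x|)| dx = 0. -/
open MeasureTheory Metric Set Filter
open scoped ENNReal Topology

noncomputable section

abbrev Euc (m : ℕ) : Type := EuclideanSpace ℝ (Fin m)

/-- The gap potential `∬_{{(x,y) ∈ S^m × S^m : |u(x) - u(y)| ≥ δ}} |x - y|^{-2m}`
of a map `u` on the unit sphere `S^m ⊆ ℝ^{m+1}`, with respect to the
`m`-dimensional Hausdorff measure. -/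
def gapPotentialSphere (m ν : ℕ) (δ : ℝ) (u : Euc (m + 1) → Euc ν) : ℝ≥0∞ :=
  ∫⁻ x in sphere (0 : Euc (m + 1)) 1, ∫⁻ y in sphere (0 : Euc (m + 1)) 1,
    (if δ ≤ dist (u x) (u y) then (ENNReal.ofReal (dist x y ^ (2 * m)))⁻¹ else 0)
      ∂ μH[(m : ℝ)] ∂ μH[(m : ℝ)]

/-- The Gagliardo energy `∬_{S^m × S^m} |u(x) - u(y)|^{m+1} / |x - y|^{2m}` of a
map `u` on the unit sphere, with respect to the `m`-dimensional Hausdorff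
measure. -/
def gagliardoEnergySphere (m ν : ℕ) (u : Euc (m + 1) → Euc ν) : ℝ≥0∞ :=
  ∫⁻ x in sphere (0 : Euc (m + 1)) 1, ∫⁻ y in sphere (0 : Euc (m + 1)) 1,
    ENNReal.ofReal (dist (u x) (u y) ^ (m + 1)) /
      ENNReal.ofReal (dist x y ^ (2 * m)) ∂ μH[(m : ℝ)] ∂ μH[(m : ℝ)]

/-- The right-hand side `A · e^{B·G} · E` of the weak-type estimates. -/
def gapBoundSphere (m ν : ℕ) (A B δ : ℝ) (u : Euc (m + 1) → Euc ν) : ℝ≥0∞ :=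
  ENNReal.ofReal (A * Real.exp (B * (gapPotentialSphere m ν δ u).toReal)) *
    gagliardoEnergySphere m ν u

section HyperbolicDistance

variable {V : Type*} [NormedAddCommGroup V]

/-- Half of the hyperbolic distance in the Poincaré ball model. -/
def hypDist (x y : V) : ℝ := Real.arsinh (‖x - y‖ / √((1 - ‖x‖ ^ 2) * (1 - ‖y‖ ^ 2)))

lemma one_sub_norm_sq_pos {x : V} (hx : ‖x‖ < 1) : 0 < 1 - ‖x‖ ^ 2 := by
  nlinarith [norm_nonneg x]

lemma hypDist_comm (x y : V) : hypDist x y = hypDist y x := by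
  unfold hypDist
  rw [norm_sub_rev, mul_comm]

lemma hypDist_self (x : V) : hypDist x x = 0 := by
  simp [hypDist]

lemma hypDist_le_iff {x y : V} {R : ℝ} :
    hypDist x y ≤ R ↔ ‖x - y‖ / √((1 - ‖x‖ ^ 2) * (1 - ‖y‖ ^ 2)) ≤ Real.sinh R := by
  unfold hypDist
  rw [← Real.sinh_le_sinh, Real.sinh_arsinh]

lemma sinh_hypDist_zero (x : V) : Real.sinh (hypDist x 0) = ‖x‖ / √(1 - ‖x‖ ^ 2) := by
  simp [hypDist]

lemma cosh_hypDist_zero {x : V} (hx : ‖x‖ < 1) :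
    Real.cosh (hypDist x 0) = 1 / √(1 - ‖x‖ ^ 2) := by
  have h := one_sub_norm_sq_pos hx
  rw [hypDist, Real.cosh_arsinh, one_div, ← Real.sqrt_inv]
  congr 1
  rw [div_pow, Real.sq_sqrt (by simpa using h.le)]
  have h' := h.ne'
  simp only [sub_zero, norm_zero]
  rw [zero_pow two_ne_zero, sub_zero, mul_one, inv_eq_one_div, eq_div_iff h', add_mul,
    div_mul_cancel₀ _ h']
  ring

lemma hypDist_triangle_zero {x z : V} (hx : ‖x‖ < 1) (hz : ‖z‖ < 1) :
    hypDist x z ≤ hypDist x 0 + hypDist 0 z := by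
  have h1 := one_sub_norm_sq_pos hx
  have h2 := one_sub_norm_sq_pos hz
  rw [hypDist_le_iff, hypDist_comm 0 z, Real.sinh_add, sinh_hypDist_zero, sinh_hypDist_zero,
    cosh_hypDist_zero hx, cosh_hypDist_zero hz, Real.sqrt_mul h1.le]
  have h3 := norm_sub_le x z
  have h4 := Real.sqrt_pos.2 h1
  have h5 := Real.sqrt_pos.2 h2
  calc ‖x - z‖ / (√(1 - ‖x‖ ^ 2) * √(1 - ‖z‖ ^ 2))
      ≤ (‖x‖ + ‖z‖) / (√(1 - ‖x‖ ^ 2) * √(1 - ‖z‖ ^ 2)) := by gcongr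
    _ = _ := by field_simp

lemma hypDist_lt_one_of_whitney {x y : V} (hx : ‖x‖ < 1) (hy : ‖y‖ < 1)
    (h : ‖x - y‖ ≤ ((1 - ‖x‖) + (1 - ‖y‖)) / 8) : hypDist x y < 1 := by
  have h1 := norm_nonneg x
  have h2 := norm_nonneg y
  have h3 : |‖x‖ - ‖y‖| ≤ ‖x - y‖ := abs_norm_sub_norm_le x y
  rw [abs_le] at h3
  have hm : 0 < (1 - ‖x‖ ^ 2) * (1 - ‖y‖ ^ 2) :=
    mul_pos (one_sub_norm_sq_pos hx) (one_sub_norm_sq_pos hy)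
  rw [hypDist, ← Real.sinh_lt_sinh, Real.sinh_arsinh]
  refine lt_of_lt_of_le ?_ (Real.self_le_sinh_iff.2 zero_le_one)
  rw [div_lt_one (Real.sqrt_pos.2 hm)]
  refine Real.lt_sqrt_of_sq_lt ?_
  have h4 : (1 - ‖x‖) * (1 - ‖y‖) ≤ (1 - ‖x‖ ^ 2) * (1 - ‖y‖ ^ 2) := by
    have : 0 < (1 - ‖x‖) := by linarith
    have : 0 < (1 - ‖y‖) := by linarith
    apply mul_le_mul <;> nlinarith
  refine lt_of_lt_of_le ?_ h4
  have h5 : ‖x - y‖ ^ 2 ≤ (((1 - ‖x‖) + (1 - ‖y‖)) / 8) ^ 2 := by gcongr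
  refine lt_of_le_of_lt h5 ?_
  nlinarith

variable [InnerProductSpace ℝ V]

lemma norm_inversion_sq {c x : V} {R : ℝ} (hR : R ^ 2 = ‖c‖ ^ 2 - 1) (hx : x ≠ c) :
    1 - ‖EuclideanGeometry.inversion c R x‖ ^ 2 = R ^ 2 * (1 - ‖x‖ ^ 2) / ‖x - c‖ ^ 2 := by
  have h0 : ‖x - c‖ ^ 2 ≠ 0 := by
    simpa [sub_eq_zero] using hx
  have h1 : EuclideanGeometry.inversion c R x = (R ^ 2 / ‖x - c‖ ^ 2) • (x - c) + c := by
    simp [EuclideanGeometry.inversion, dist_eq_norm, div_pow]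
  rw [h1, norm_add_sq_real, norm_smul, mul_pow, real_inner_smul_left, inner_sub_left,
    real_inner_self_eq_norm_sq, Real.norm_eq_abs, sq_abs]
  have h2 := norm_sub_sq_real x c
  have h3 : ‖x - c‖ ≠ 0 := by simpa [sub_eq_zero] using hx
  rw [hR]
  field_simp
  linear_combination (1 - ‖c‖ ^ 2) * h2

/-- The hyperbolic inversions act transitively on the ball. -/
lemma exists_hypDist_isometry (a : V) (ha : ‖a‖ < 1) :
    ∃ T : V → V, T a = 0 ∧ (∀ x, ‖x‖ < 1 → ‖T x‖ < 1) ∧ (∀ x, ‖x‖ < 1 → T (T x) = x) ∧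
      ∀ x y, ‖x‖ < 1 → ‖y‖ < 1 → hypDist (T x) (T y) = hypDist x y := by
  by_cases ha0 : a = 0
  · exact ⟨id, by simpa using ha0, by simp, by simp, by simp⟩
  have hpos : 0 < ‖a‖ := norm_pos_iff.2 ha0
  set c : V := (‖a‖ ^ 2)⁻¹ • a with hc
  have hcn : ‖c‖ = ‖a‖⁻¹ := by
    rw [hc, norm_smul, norm_inv, norm_pow, norm_norm]
    field_simp
  have hc1 : 1 < ‖c‖ := by
    rw [hcn]
    exact (one_lt_inv₀ hpos).2 ha
  have hRpos : 0 < ‖c‖ ^ 2 - 1 := by nlinarith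
  set R : ℝ := √(‖c‖ ^ 2 - 1) with hRdef
  have hR : R ^ 2 = ‖c‖ ^ 2 - 1 := Real.sq_sqrt hRpos.le
  have hR0 : 0 < R := Real.sqrt_pos.2 hRpos
  have hne : ∀ x : V, ‖x‖ < 1 → x ≠ c := by
    rintro x hx rfl
    linarith
  have hform : ∀ x : V, ‖x‖ < 1 → 1 - ‖EuclideanGeometry.inversion c R x‖ ^ 2 =
      R ^ 2 * (1 - ‖x‖ ^ 2) / ‖x - c‖ ^ 2 := fun x hx => norm_inversion_sq hR (hne x hx)
  refine ⟨EuclideanGeometry.inversion c R, ?_, ?_, ?_, ?_⟩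
  · have h1 : a - c = (1 - (‖a‖ ^ 2)⁻¹) • a := by rw [hc, sub_smul, one_smul]
    have h2 : ‖a - c‖ ^ 2 = (1 - (‖a‖ ^ 2)⁻¹) ^ 2 * ‖a‖ ^ 2 := by
      rw [h1, norm_smul, mul_pow, Real.norm_eq_abs, sq_abs]
    have h3 : (1 - (‖a‖ ^ 2)⁻¹) ≠ 0 := by
      have : 1 < (‖a‖ ^ 2)⁻¹ := (one_lt_inv₀ (by positivity)).2 (by nlinarith)
      linarith
    have h4 : EuclideanGeometry.inversion c R a = (R ^ 2 / ‖a - c‖ ^ 2) • (a - c) + c := by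
      simp [EuclideanGeometry.inversion, dist_eq_norm, div_pow]
    rw [h4, h2, h1, hR, hcn, smul_smul, hc, ← add_smul]
    convert zero_smul ℝ a
    have h5 : ‖a‖ ^ 2 - 1 ≠ 0 := by nlinarith
    field_simp
    ring
  · intro x hx
    have h := hform x hx
    have h2 : 0 < R ^ 2 * (1 - ‖x‖ ^ 2) / ‖x - c‖ ^ 2 := by
      have := one_sub_norm_sq_pos hx
      have := norm_pos_iff.2 (sub_ne_zero.2 (hne x hx))
      positivity
    nlinarith [norm_nonneg (EuclideanGeometry.inversion c R x)]
  · intro x _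
    exact EuclideanGeometry.inversion_inversion c hR0.ne' x
  · intro x y hx hy
    have hx' := norm_pos_iff.2 (sub_ne_zero.2 (hne x hx))
    have hy' := norm_pos_iff.2 (sub_ne_zero.2 (hne y hy))
    unfold hypDist
    rw [hform x hx, hform y hy]
    have h := EuclideanGeometry.dist_inversion_inversion (hne x hx) (hne y hy) R
    rw [dist_eq_norm, dist_eq_norm, dist_eq_norm, dist_eq_norm] at h
    rw [h]
    have h5 : R ^ 2 * (1 - ‖x‖ ^ 2) / ‖x - c‖ ^ 2 * (R ^ 2 * (1 - ‖y‖ ^ 2) / ‖y - c‖ ^ 2) =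
        (R ^ 2 / (‖x - c‖ * ‖y - c‖)) ^ 2 * ((1 - ‖x‖ ^ 2) * (1 - ‖y‖ ^ 2)) := by
      field_simp
    rw [h5, Real.sqrt_mul (by positivity), Real.sqrt_sq (by positivity),
      mul_div_mul_left _ _ (by positivity)]

lemma hypDist_triangle {x y z : V} (hx : ‖x‖ < 1) (hy : ‖y‖ < 1) (hz : ‖z‖ < 1) :
    hypDist x z ≤ hypDist x y + hypDist y z := by
  obtain ⟨T, hT0, hTb, -, hTd⟩ := exists_hypDist_isometry y hy
  rw [← hTd x z hx hz, ← hTd x y hx hy, ← hTd y z hy hz, hT0]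
  exact hypDist_triangle_zero (hTb x hx) (hTb z hz)

lemma exists_hypDist_between_zero {b : V} (hb : ‖b‖ < 1) {R S : ℝ} (hR : 0 ≤ R) (hS : 0 ≤ S)
    (h : hypDist 0 b ≤ R + S) :
    ∃ c : V, ‖c‖ < 1 ∧ hypDist 0 c ≤ S ∧ hypDist c b ≤ R := by
  by_cases hbS : hypDist 0 b ≤ S
  · exact ⟨b, hb, hbS, by rwa [hypDist_self]⟩
  push Not at hbS
  have hb0 : 0 < ‖b‖ := by
    refine norm_pos_iff.2 ?_
    rintro rfl
    rw [hypDist_self] at hbS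
    linarith
  have hC := Real.cosh_pos S
  have hSn := Real.sinh_nonneg_iff.2 hS
  have hCS := Real.cosh_sq S
  set γ : ℝ := Real.sinh S / Real.cosh S with hγ
  have hγ0 : 0 ≤ γ := by positivity
  have hγ1 : γ < 1 := (div_lt_one hC).2 (Real.sinh_lt_cosh S)
  have hγs : 1 - γ ^ 2 = (1 / Real.cosh S) ^ 2 := by
    rw [hγ]
    field_simp
    linarith
  set c : V := (γ / ‖b‖) • b with hc
  have hcn : ‖c‖ = γ := by
    rw [hc, norm_smul, Real.norm_eq_abs, abs_of_nonneg (by positivity)]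
    field_simp
  have hc1 : ‖c‖ < 1 := by rw [hcn]; exact hγ1
  have hsq : √(1 - γ ^ 2) = 1 / Real.cosh S := by
    rw [hγs, Real.sqrt_sq (by positivity)]
  have hsc : hypDist 0 c = S := by
    rw [hypDist_comm, ← Real.sinh_inj, sinh_hypDist_zero, hcn, hsq, hγ]
    field_simp
  have hgb : γ ≤ ‖b‖ := by
    have h1 := one_sub_norm_sq_pos hb
    have h2 : Real.sinh S ≤ Real.sinh (hypDist 0 b) := Real.sinh_le_sinh.2 hbS.le
    by_contra! hlt
    have h3 : hypDist 0 b ≤ hypDist 0 c := by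
      rw [← Real.sinh_le_sinh, hypDist_comm 0 b, hypDist_comm 0 c, sinh_hypDist_zero,
        sinh_hypDist_zero, hcn]
      have : 0 < 1 - γ ^ 2 := by nlinarith
      have := Real.sqrt_pos.2 this
      gcongr
    linarith
  refine ⟨c, hc1, hsc.le, ?_⟩
  have hcb : ‖c - b‖ = ‖b‖ - γ := by
    have : c - b = (γ / ‖b‖ - 1) • b := by rw [hc, sub_smul, one_smul]
    rw [this, norm_smul, Real.norm_eq_abs, abs_of_nonpos (by
      rw [sub_nonpos, div_le_one hb0]; exact hgb)]
    field_simp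
    ring
  have key : hypDist c b = hypDist 0 b - S := by
    rw [hypDist_comm 0 b, ← Real.sinh_inj, Real.sinh_sub, sinh_hypDist_zero,
      cosh_hypDist_zero hb, hypDist, Real.sinh_arsinh, hcb, hcn,
      Real.sqrt_mul (by rw [hγs]; positivity), hsq]
    have h5 := Real.sqrt_pos.2 (one_sub_norm_sq_pos hb)
    rw [hγ]
    field_simp
  linarith

lemma exists_hypDist_between {a b : V} (ha : ‖a‖ < 1) (hb : ‖b‖ < 1) {R S : ℝ} (hR : 0 ≤ R)
    (hS : 0 ≤ S) (h : hypDist a b ≤ R + S) :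
    ∃ c : V, ‖c‖ < 1 ∧ hypDist a c ≤ S ∧ hypDist c b ≤ R := by
  obtain ⟨T, hT0, hTb, hTT, hTd⟩ := exists_hypDist_isometry a ha
  rw [← hTd a b ha hb, hT0] at h
  obtain ⟨c, hc, h1, h2⟩ := exists_hypDist_between_zero (hTb b hb) hR hS h
  refine ⟨T c, hTb c hc, ?_, ?_⟩
  · rw [← hTd a _ ha (hTb c hc), hTT c hc, hT0]
    exact h1
  · rw [← hTd _ b (hTb c hc) hb, hTT c hc]
    exact h2

/-- Hyperbolic balls are Euclidean balls, whose distance to the boundary sphere is controlled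
exponentially by the hyperbolic radius. -/
lemma exists_ball_eq_hypDist_ball {a : V} (ha : ‖a‖ < 1) {R : ℝ} (hR : 0 < R) :
    ∃ (c : V) (r : ℝ), 0 < r ∧ r < 1 - ‖c‖ ∧
      (1 - ‖c‖) ≤ Real.exp (4 * R) * (1 - ‖c‖ - r) ∧
      (∀ x, ‖x‖ < 1 → (hypDist x a ≤ R ↔ x ∈ closedBall c r)) ∧
      (∀ x, ‖x‖ < 1 → (hypDist x a < R ↔ x ∈ ball c r)) := by
  have hs : 0 < Real.sinh R := Real.sinh_pos_iff.2 hR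
  have hch := Real.cosh_pos R
  have hcs := Real.cosh_sq R
  set s := Real.sinh R with hsdef
  set C := Real.cosh R with hCdef
  have hsC : s < C := Real.sinh_lt_cosh R
  have hexp : C - s = Real.exp (-R) := Real.cosh_sub_sinh R
  have hexp2 : C + s = Real.exp R := Real.cosh_add_sinh R
  have hα := norm_nonneg a
  set α := ‖a‖ with hαdef
  have hκ : 0 < 1 - α ^ 2 := one_sub_norm_sq_pos ha
  set w := 1 + s ^ 2 * (1 - α ^ 2) with hw
  have hw0 : 0 < w := by positivity
  have hcn : ‖w⁻¹ • a‖ = α / w := by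
    rw [norm_smul, norm_inv, Real.norm_eq_abs, abs_of_pos hw0]
    exact inv_mul_eq_div _ _
  have hgap : (1 - α) * Real.exp (-R) ^ 2 / w ≤ 1 - ‖w⁻¹ • a‖ - (1 - α ^ 2) * s * C / w := by
    rw [hcn, ← hexp]
    have : 1 - α / w - (1 - α ^ 2) * s * C / w = (w - α - (1 - α ^ 2) * s * C) / w := by
      field_simp
    rw [this]
    gcongr
    rw [hw]
    have hfac : 1 + s ^ 2 * (1 - α ^ 2) - α - (1 - α ^ 2) * s * C - (1 - α) * (C - s) ^ 2
        = (1 - α) * (1 - (1 + α) * s * (C - s) - (C - s) ^ 2) := by ring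
    have h1 : 0 ≤ 1 - (1 + α) * s * (C - s) - (C - s) ^ 2 := by
      have : 0 ≤ s * (C - s) := mul_nonneg hs.le (by linarith)
      nlinarith
    nlinarith [mul_nonneg (sub_nonneg.2 ha.le) h1]
  have hgap0 : 0 < (1 - α) * Real.exp (-R) ^ 2 / w := by
    have : 0 < 1 - α := by linarith
    positivity
  have hsqid : ∀ x : V, ‖x - w⁻¹ • a‖ ^ 2 - ((1 - α ^ 2) * s * C / w) ^ 2 =
      w⁻¹ * (‖x - a‖ ^ 2 - s ^ 2 * ((1 - ‖x‖ ^ 2) * (1 - α ^ 2))) := by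
    intro x
    rw [norm_sub_sq_real, norm_sub_sq_real, hcn, real_inner_smul_right, ← hαdef]
    simp only [div_pow, mul_pow, hcs]
    field_simp
    rw [hw]
    ring
  have hr0 : 0 ≤ (1 - α ^ 2) * s * C / w := by positivity
  refine ⟨w⁻¹ • a, (1 - α ^ 2) * s * C / w, by positivity, by linarith, ?_, ?_, ?_⟩
  · refine le_trans ?_ (mul_le_mul_of_nonneg_left hgap (Real.exp_pos _).le)
    have h1 : Real.exp (4 * R) * ((1 - α) * Real.exp (-R) ^ 2 / w) =
        (1 - α) * (C + s) ^ 2 / w := by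
      have : Real.exp (4 * R) = Real.exp R ^ 4 := by rw [← Real.exp_nat_mul]; norm_num
      rw [this, Real.exp_neg, hexp2]
      have := (Real.exp_pos R).ne'
      field_simp
    rw [h1, hcn]
    have : 1 - α / w = (w - α) / w := by field_simp
    rw [this]
    gcongr
    rw [hw]
    have h3 : (1 - α) * (C + s) ^ 2 - (1 + s ^ 2 * (1 - α ^ 2) - α) =
      (1 - α) * ((C + s) ^ 2 - 1 - s ^ 2 * (1 + α)) := by ring
    have h4 : 0 ≤ (C + s) ^ 2 - 1 - s ^ 2 * (1 + α) := by nlinarith [sq_nonneg s]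
    nlinarith [mul_nonneg (sub_nonneg.2 ha.le) h4]
  · intro x hx
    have hx1 := one_sub_norm_sq_pos hx
    have hm : 0 < √((1 - ‖x‖ ^ 2) * (1 - α ^ 2)) := Real.sqrt_pos.2 (by positivity)
    have hm2 : √((1 - ‖x‖ ^ 2) * (1 - α ^ 2)) ^ 2 = (1 - ‖x‖ ^ 2) * (1 - α ^ 2) :=
      Real.sq_sqrt (by positivity)
    rw [hypDist_le_iff, div_le_iff₀ hm, mem_closedBall, dist_eq_norm,
      ← sq_le_sq₀ (norm_nonneg _) (by positivity), mul_pow, hm2,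
      ← sq_le_sq₀ (norm_nonneg _) hr0, ← sub_nonpos, ← sub_nonpos (b := (_ / w) ^ 2), hsqid]
    constructor
    · intro h
      exact mul_nonpos_of_nonneg_of_nonpos (by positivity) h
    · intro h
      by_contra! h'
      have : 0 < w⁻¹ * (‖x - a‖ ^ 2 - s ^ 2 * ((1 - ‖x‖ ^ 2) * (1 - α ^ 2))) := by positivity
      linarith
  · intro x hx
    have hx1 := one_sub_norm_sq_pos hx
    have hm : 0 < √((1 - ‖x‖ ^ 2) * (1 - α ^ 2)) := Real.sqrt_pos.2 (by positivity)
    have hm2 : √((1 - ‖x‖ ^ 2) * (1 - α ^ 2)) ^ 2 = (1 - ‖x‖ ^ 2) * (1 - α ^ 2) :=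
      Real.sq_sqrt (by positivity)
    rw [← Real.sinh_lt_sinh, hypDist, Real.sinh_arsinh, div_lt_iff₀ hm, mem_ball, dist_eq_norm,
      ← sq_lt_sq₀ (norm_nonneg _) (by positivity), mul_pow, hm2,
      ← sq_lt_sq₀ (norm_nonneg _) hr0, ← sub_neg, ← sub_neg (b := (_ / w) ^ 2), hsqid]
    constructor
    · intro h
      exact mul_neg_of_pos_of_neg (by positivity) h
    · intro h
      by_contra! h'
      have : 0 ≤ w⁻¹ * (‖x - a‖ ^ 2 - s ^ 2 * ((1 - ‖x‖ ^ 2) * (1 - α ^ 2))) := by positivity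
      linarith

/-- Balls of radius `R₀` around finitely many points of the hyperbolic space can be merged into
disjoint balls without increasing the sum of the radii. -/
lemma exists_disjoint_hypDist_balls (F : Finset V) (hF : ∀ x ∈ F, ‖x‖ < 1) {R₀ : ℝ}
    (hR₀ : 0 < R₀) :
    ∃ T : Finset (V × ℝ), T.card ≤ F.card ∧
      (∀ p ∈ T, ‖p.1‖ < 1 ∧ 0 < p.2 ∧ p.2 ≤ F.card * R₀) ∧
      (∀ p ∈ T, ∀ q ∈ T, p ≠ q → p.2 + q.2 < hypDist p.1 q.1) ∧
      ∀ x ∈ F, ∃ p ∈ T, hypDist x p.1 + R₀ ≤ p.2 := by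
  classical
  let P : ℕ → Prop := fun k => ∃ T : Finset (V × ℝ), T.card = k ∧ T.card ≤ F.card ∧
    (∀ p ∈ T, ‖p.1‖ < 1 ∧ 0 < p.2) ∧ (∑ p ∈ T, p.2 ≤ F.card * R₀) ∧
    ∀ x ∈ F, ∃ p ∈ T, hypDist x p.1 + R₀ ≤ p.2
  have hP : ∃ k, P k := by
    refine ⟨_, F.image fun x => (x, R₀), rfl, Finset.card_image_le, ?_, ?_, ?_⟩
    · intro p hp
      obtain ⟨x, hx, rfl⟩ := Finset.mem_image.1 hp
      exact ⟨hF x hx, hR₀⟩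
    · rw [Finset.sum_image (by intro x _ y _ h; exact (Prod.ext_iff.1 h).1)]
      simp
    · intro x hx
      exact ⟨(x, R₀), Finset.mem_image_of_mem _ hx, by simp [hypDist_self]⟩
  obtain ⟨T, hTc, hTF, hT1, hT2, hT3⟩ := Nat.find_spec hP
  refine ⟨T, hTF, ?_, ?_, hT3⟩
  · intro p hp
    refine ⟨(hT1 p hp).1, (hT1 p hp).2, le_trans ?_ hT2⟩
    exact Finset.single_le_sum (f := fun p : V × ℝ => p.2) (fun q hq => (hT1 q hq).2.le) hp
  intro p hp q hq hpq
  by_contra! hle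
  obtain ⟨c, hc, hpc, hcq⟩ := exists_hypDist_between (hT1 p hp).1 (hT1 q hq).1
    (hT1 p hp).2.le (hT1 q hq).2.le hle
  have hq' : q ∈ T.erase p := Finset.mem_erase.2 ⟨hpq.symm, hq⟩
  set T₀ := (T.erase p).erase q with hT₀
  have hsub : ∀ r ∈ T₀, r ∈ T := fun r hr => Finset.mem_of_mem_erase (Finset.mem_of_mem_erase hr)
  have hcard : T₀.card + 2 = T.card := by
    have h1 := Finset.card_erase_add_one hp
    have h2 := Finset.card_erase_add_one hq'
    change ((T.erase p).erase q).card + 2 = _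
    omega
  have hsum : ∑ r ∈ T₀, r.2 + q.2 + p.2 = ∑ r ∈ T, r.2 := by
    rw [Finset.sum_erase_add _ _ hq', Finset.sum_erase_add _ _ hp]
  set n : V × ℝ := (c, p.2 + q.2) with hn
  have hcard' : (insert n T₀).card < T.card := by
    have := Finset.card_insert_le n T₀
    omega
  refine Nat.find_min hP (hTc ▸ hcard') ⟨insert n T₀, rfl, hcard'.le.trans hTF, ?_, ?_, ?_⟩
  · intro r hr
    rcases Finset.mem_insert.1 hr with rfl | hr
    · exact ⟨hc, add_pos (hT1 p hp).2 (hT1 q hq).2⟩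
    · exact hT1 r (hsub r hr)
  · have : ∑ r ∈ insert n T₀, r.2 ≤ n.2 + ∑ r ∈ T₀, r.2 := by
      by_cases hnT : n ∈ T₀
      · rw [Finset.insert_eq_of_mem hnT]
        have := add_pos (hT1 p hp).2 (hT1 q hq).2
        simp only [hn]
        linarith
      · rw [Finset.sum_insert hnT]
    simp only [hn] at this ⊢
    linarith
  · intro x hx
    obtain ⟨r, hr, hxr⟩ := hT3 x hx
    by_cases hrp : r = p
    · subst hrp
      refine ⟨n, Finset.mem_insert_self _ _, ?_⟩
      have := hypDist_triangle (hF x hx) (hT1 r hr).1 hc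
      simp only [hn]
      linarith
    by_cases hrq : r = q
    · subst hrq
      refine ⟨n, Finset.mem_insert_self _ _, ?_⟩
      have := hypDist_triangle (hF x hx) (hT1 r hr).1 hc
      rw [hypDist_comm r.1 c] at this
      simp only [hn]
      linarith
    · exact ⟨r, Finset.mem_insert_of_mem (Finset.mem_erase.2 ⟨hrq, Finset.mem_erase.2 ⟨hrp, hr⟩⟩),
        hxr⟩

end HyperbolicDistance

section SphereMeasure

/-- The surface measure of the unit sphere, as a measure on the ambient space. -/
def sphMeasure (m : ℕ) : Measure (Euc (m + 1)) :=
  ((volume : Measure (Euc (m + 1))).toSphere).map Subtype.val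

instance (m : ℕ) : IsFiniteMeasure (sphMeasure m) := by
  unfold sphMeasure
  infer_instance

lemma ae_sphMeasure_norm (m : ℕ) : ∀ᵐ y ∂(sphMeasure m), ‖y‖ = 1 := by
  have h : MeasurableSet {y : Euc (m + 1) | ‖y‖ = 1} :=
    (isClosed_eq continuous_norm continuous_const).measurableSet
  rw [sphMeasure, ae_map_iff measurable_subtype_coe.aemeasurable h]
  exact Eventually.of_forall fun y => by simp

lemma exists_shell_lintegral (m : ℕ) {a : ℝ} (ha : a ≤ 1) :
    ∃ c : ℝ≥0∞, c ≤ ENNReal.ofReal a ∧ (a ≤ 1 / 2 → ENNReal.ofReal (a / 2 ^ m) ≤ c) ∧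
      ∀ g : Euc (m + 1) → ℝ≥0∞, Measurable g →
        ∫⁻ x in {x : Euc (m + 1) | 1 - a < ‖x‖ ∧ ‖x‖ < 1}, g (‖x‖⁻¹ • x) =
          c * ∫⁻ y, g y ∂(sphMeasure m) := by
  set I : Set (Ioi (0 : ℝ)) := Subtype.val ⁻¹' Ioo (1 - a) 1 with hI
  have hIm : MeasurableSet I := measurable_subtype_coe measurableSet_Ioo
  have hIv : (Measure.comap Subtype.val volume : Measure (Ioi (0 : ℝ))) I = ENNReal.ofReal a := by
    have h : Ioi (0 : ℝ) ∩ Ioo (1 - a) 1 = Ioo (1 - a) 1 :=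
      inter_eq_right.2 fun r hr => lt_of_le_of_lt (sub_nonneg.2 ha) hr.1
    rw [hI, comap_subtype_coe_apply measurableSet_Ioi, Subtype.image_preimage_coe, h,
      Real.volume_Ioo]
    congr 1
    ring
  refine ⟨Measure.volumeIoiPow m I, ?_, ?_, ?_⟩
  · rw [Measure.volumeIoiPow, withDensity_apply _ hIm, ← hIv, ← setLIntegral_one]
    refine setLIntegral_mono measurable_const fun r hr => ?_
    exact ENNReal.ofReal_le_one.2 (pow_le_one₀ r.2.out.le hr.2.le)
  · intro ha2
    rw [Measure.volumeIoiPow, withDensity_apply _ hIm]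
    calc ENNReal.ofReal (a / 2 ^ m) = ∫⁻ _ in I, ENNReal.ofReal ((2 ^ m)⁻¹)
          ∂(Measure.comap Subtype.val volume) := by
          rw [setLIntegral_const, hIv, ← ENNReal.ofReal_mul (by positivity)]
          congr 1
          ring
      _ ≤ _ := by
          refine setLIntegral_mono (by fun_prop) fun r hr => ?_
          refine ENNReal.ofReal_le_ofReal ?_
          rw [← inv_pow]
          have : (2 : ℝ)⁻¹ ≤ r.1 := by
            have := hr.1
            norm_num at this ⊢
            linarith
          gcongr
  · intro g hg
    set A : Set (Euc (m + 1)) := {x | 1 - a < ‖x‖ ∧ ‖x‖ < 1} with hA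
    have hAm : MeasurableSet A :=
      (measurableSet_lt measurable_const measurable_norm).inter
        (measurableSet_lt measurable_norm measurable_const)
    have hmp := (volume : Measure (Euc (m + 1))).measurePreserving_homeomorphUnitSphereProd
    have hdim : Module.finrank ℝ (Euc (m + 1)) - 1 = m := by simp
    rw [hdim] at hmp
    rw [← lintegral_indicator hAm]
    have h0 : ∫⁻ x, A.indicator (fun x => g (‖x‖⁻¹ • x)) x =
        ∫⁻ x in ({0}ᶜ : Set (Euc (m + 1))), A.indicator (fun x => g (‖x‖⁻¹ • x)) x := by
      rw [restrict_compl_singleton]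
    rw [h0, ← lintegral_subtype_comap (measurableSet_singleton _).compl, sphMeasure, lintegral_map hg measurable_subtype_coe]
    have h1 : ∀ x : ({0}ᶜ : Set (Euc (m + 1))), A.indicator (fun x => g (‖x‖⁻¹ • x)) x.1 =
        (fun p : sphere (0 : Euc (m + 1)) 1 × Ioi (0 : ℝ) => g p.1.1 * I.indicator 1 p.2)
          (homeomorphUnitSphereProd (Euc (m + 1)) x) := by
      intro x
      simp only [homeomorphUnitSphereProd_apply_fst_coe]
      by_cases hx : x.1 ∈ A
      · rw [indicator_of_mem hx, indicator_of_mem]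
        · simp
        · simpa [hI, hA] using hx
      · rw [indicator_of_notMem hx, indicator_of_notMem]
        · simp
        · simpa [hI, hA] using hx
    rw [lintegral_congr h1, hmp.lintegral_comp_emb (Homeomorph.measurableEmbedding _)
      fun p => g p.1.1 * I.indicator 1 p.2, lintegral_prod_mul
        (f := fun y : sphere (0 : Euc (m + 1)) 1 => g y.1) (g := I.indicator 1) (by fun_prop)
        (measurable_one.indicator hIm).aemeasurable, mul_comm]
    congr 1
    rw [lintegral_indicator_one hIm]

lemma exists_shell_lintegral_le (m : ℕ) {a : ℝ} (ha : a ≤ 1)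
    {g : Euc (m + 1) → ℝ≥0∞} (hg : Measurable g) :
    ∫⁻ x in {x : Euc (m + 1) | 1 - a < ‖x‖ ∧ ‖x‖ < 1}, g (‖x‖⁻¹ • x) ≤
      ENNReal.ofReal a * ∫⁻ y, g y ∂(sphMeasure m) := by
  obtain ⟨c, hc, -, h⟩ := exists_shell_lintegral m ha
  rw [h g hg]
  gcongr

lemma norm_normalize_sub {m : ℕ} {x : Euc (m + 1)} (hx : x ≠ 0) (hx1 : ‖x‖ ≤ 1) :
    ‖‖x‖⁻¹ • x - x‖ = 1 - ‖x‖ := by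
  have h0 := norm_pos_iff.2 hx
  have : ‖x‖⁻¹ • x - x = (‖x‖⁻¹ - 1) • x := by rw [sub_smul, one_smul]
  rw [this, norm_smul, Real.norm_eq_abs, abs_of_nonneg (sub_nonneg.2 ((one_le_inv₀ h0).2 hx1))]
  field_simp

lemma exists_sphMeasure_closedBall_le (m : ℕ) : ∃ C : ℝ, 0 < C ∧
    ∀ y : Euc (m + 1), ‖y‖ = 1 → ∀ r : ℝ, 0 < r → r ≤ 1 / 2 →
      sphMeasure m (closedBall y r) ≤ ENNReal.ofReal (C * r ^ m) := by
  set ω := (volume : Measure (Euc (m + 1))).real (ball 0 1) with hω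
  have hω0 : 0 < ω := by
    rw [hω]
    exact ENNReal.toReal_pos (measure_ball_pos _ _ one_pos).ne' measure_ball_lt_top.ne
  refine ⟨2 ^ (m + 1) * 2 ^ m * ω, by positivity, fun y hy r hr hr2 => ?_⟩
  obtain ⟨c, -, hc, h⟩ := exists_shell_lintegral m (by linarith : r ≤ 1)
  have h1 := h ((closedBall y r).indicator 1) (measurable_one.indicator measurableSet_closedBall)
  rw [lintegral_indicator_one measurableSet_closedBall] at h1
  have hAm : MeasurableSet {x : Euc (m + 1) | 1 - r < ‖x‖ ∧ ‖x‖ < 1} :=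
      (measurableSet_lt measurable_const measurable_norm).inter
        (measurableSet_lt measurable_norm measurable_const)
  have h2 : ∫⁻ x in {x : Euc (m + 1) | 1 - r < ‖x‖ ∧ ‖x‖ < 1},
      (closedBall y r).indicator (1 : Euc (m + 1) → ℝ≥0∞) (‖x‖⁻¹ • x) ≤
        volume (closedBall y (2 * r)) := by
    rw [← lintegral_indicator hAm, ← lintegral_indicator_one measurableSet_closedBall]
    refine lintegral_mono fun x => ?_
    by_cases hx : x ∈ {x : Euc (m + 1) | 1 - r < ‖x‖ ∧ ‖x‖ < 1}
    · rw [indicator_of_mem hx]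
      by_cases hxy : ‖x‖⁻¹ • x ∈ closedBall y r
      · rw [indicator_of_mem hxy, indicator_of_mem]
        · rfl
        have hx0 : x ≠ 0 := by
          rintro rfl
          have := hx.1
          simp at this
          linarith
        rw [mem_closedBall, dist_eq_norm] at hxy ⊢
        have h3 := norm_normalize_sub hx0 hx.2.le
        have h4 : x - y = (‖x‖⁻¹ • x - y) - (‖x‖⁻¹ • x - x) := by abel
        have h5 := norm_sub_le (‖x‖⁻¹ • x - y) (‖x‖⁻¹ • x - x)
        rw [← h4] at h5
        linarith [hx.1]
      · rw [indicator_of_notMem hxy]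
        exact zero_le
    · rw [indicator_of_notMem hx]
      exact zero_le
  rw [h1, Measure.addHaar_closedBall volume y (by positivity : 0 ≤ 2 * r), finrank_euclideanSpace, Fintype.card_fin,
    ← ENNReal.ofReal_toReal (measure_ball_lt_top (x := (0 : Euc (m + 1))) (r := 1)).ne,
    ← ENNReal.ofReal_mul (by positivity)] at h2
  have h6 : ENNReal.ofReal (r / 2 ^ m) * sphMeasure m (closedBall y r) ≤
      ENNReal.ofReal (r / 2 ^ m) * ENNReal.ofReal (2 ^ (m + 1) * 2 ^ m * ω * r ^ m) := by
    refine (mul_le_mul_left (hc hr2) _).trans (h2.trans ?_)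
    rw [← ENNReal.ofReal_mul (by positivity)]
    refine ENNReal.ofReal_le_ofReal (le_of_eq ?_)
    rw [← Measure.real, ← hω]
    field_simp
    ring
  exact (ENNReal.mul_le_mul_iff_right (by simpa using by positivity) ENNReal.ofReal_ne_top).1 h6

lemma exists_le_sphMeasure_closedBall (m : ℕ) : ∃ C : ℝ, 0 < C ∧
    ∀ y : Euc (m + 1), ‖y‖ = 1 → ∀ r : ℝ, 0 < r → r ≤ 1 / 2 →
      ENNReal.ofReal (C * r ^ m) ≤ sphMeasure m (closedBall y r) := by
  set ω := (volume : Measure (Euc (m + 1))).real (ball 0 1) with hω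
  have hω0 : 0 < ω := by
    rw [hω]
    exact ENNReal.toReal_pos (measure_ball_pos _ _ one_pos).ne' measure_ball_lt_top.ne
  refine ⟨(4 ^ (m + 1))⁻¹ * ω, by positivity, fun y hy r hr hr2 => ?_⟩
  have h1 := exists_shell_lintegral_le m (by linarith : r ≤ 1)
    (g := (closedBall y r).indicator 1) (measurable_one.indicator measurableSet_closedBall)
  rw [lintegral_indicator_one measurableSet_closedBall] at h1
  have hAm : MeasurableSet {x : Euc (m + 1) | 1 - r < ‖x‖ ∧ ‖x‖ < 1} :=
      (measurableSet_lt measurable_const measurable_norm).inter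
        (measurableSet_lt measurable_norm measurable_const)
  have h2 : volume (ball ((1 - r / 4) • y) (r / 4)) ≤
      ∫⁻ x in {x : Euc (m + 1) | 1 - r < ‖x‖ ∧ ‖x‖ < 1},
      (closedBall y r).indicator (1 : Euc (m + 1) → ℝ≥0∞) (‖x‖⁻¹ • x) := by
    rw [← lintegral_indicator hAm, ← lintegral_indicator_one measurableSet_ball]
    refine lintegral_mono fun x => ?_
    by_cases hx : x ∈ ball ((1 - r / 4) • y) (r / 4)
    · rw [indicator_of_mem hx]
      rw [mem_ball, dist_eq_norm] at hx
      have hyn : ‖(1 - r / 4) • y‖ = 1 - r / 4 := by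
        rw [norm_smul, hy, mul_one, Real.norm_eq_abs, abs_of_nonneg (by linarith)]
      have h3 := abs_norm_sub_norm_le x ((1 - r / 4) • y)
      rw [hyn, abs_le] at h3
      have hx0 : x ≠ 0 := by
        rintro rfl
        simp only [norm_zero] at h3
        linarith
      have h4 := norm_normalize_sub hx0 (by linarith)
      have h5 : ‖(1 - r / 4) • y - y‖ = r / 4 := by
        have : (1 - r / 4) • y - y = (-(r / 4)) • y := by
          rw [sub_smul, one_smul, neg_smul]
          abel
        rw [this, norm_smul, hy, norm_neg, mul_one, Real.norm_eq_abs, abs_of_pos (by linarith)]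
      have h6 : ‖x‖⁻¹ • x - y = (‖x‖⁻¹ • x - x) + (x - (1 - r / 4) • y) +
        ((1 - r / 4) • y - y) := by abel
      rw [indicator_of_mem, indicator_of_mem]
      · rfl
      · rw [mem_closedBall, dist_eq_norm, h6]
        refine (norm_add₃_le).trans ?_
        linarith
      · exact ⟨by linarith, by linarith⟩
    · rw [indicator_of_notMem hx]
      exact zero_le
  have h3 := h2.trans h1
  rw [Measure.addHaar_ball volume _ (by positivity : 0 ≤ r / 4), finrank_euclideanSpace, Fintype.card_fin,
    ← ENNReal.ofReal_toReal (measure_ball_lt_top (x := (0 : Euc (m + 1))) (r := 1)).ne,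
    ← ENNReal.ofReal_mul (by positivity)] at h3
  refine (ENNReal.mul_le_mul_iff_right (a := ENNReal.ofReal r) (by simpa using hr)
    ENNReal.ofReal_ne_top).1 (le_trans ?_ h3)
  rw [← ENNReal.ofReal_mul hr.le]
  refine ENNReal.ofReal_le_ofReal (le_of_eq ?_)
  rw [← Measure.real, ← hω, div_pow]
  field_simp
  ring

lemma exists_sphMeasure_le_hausdorffMeasure (m : ℕ) (hm : 1 ≤ m) : ∃ C : ℝ, 0 < C ∧
    sphMeasure m ≤ ENNReal.ofReal C • (μH[(m : ℝ)].restrict (sphere (0 : Euc (m + 1)) 1)) := by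
  obtain ⟨C, hC, h⟩ := exists_sphMeasure_closedBall_le m
  have h0 : ∀ y : Euc (m + 1), ‖y‖ = 1 → sphMeasure m {y} = 0 := by
    intro y hy
    have h1 : Tendsto (fun r : ℝ => ENNReal.ofReal (C * r ^ m)) (𝓝[>] 0) (𝓝 0) := by
      have : Continuous fun r : ℝ => ENNReal.ofReal (C * r ^ m) :=
        ENNReal.continuous_ofReal.comp (by fun_prop)
      have := (this.tendsto 0).mono_left (nhdsWithin_le_nhds (s := Ioi 0))
      simpa [zero_pow (by omega : m ≠ 0)] using this
    refine le_antisymm (ge_of_tendsto h1 ?_) zero_le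
    have h2 : Ioc (0 : ℝ) (1 / 2) ∈ 𝓝[>] (0 : ℝ) := Ioc_mem_nhdsGT (by norm_num)
    filter_upwards [h2] with r hr
    exact (measure_mono (singleton_subset_iff.2 (mem_closedBall_self hr.1.le))).trans
      (h y hy r hr.1 hr.2)
  have key : ENNReal.ofReal C⁻¹ • sphMeasure m ≤ μH[(m : ℝ)] := by
    refine Measure.le_hausdorffMeasure _ _ (ENNReal.ofReal (1 / 2)) (by simp) fun s hs => ?_
    rw [Measure.smul_apply, smul_eq_mul]
    by_cases hsS : ∃ y ∈ s, ‖y‖ = 1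
    · obtain ⟨y, hys, hy⟩ := hsS
      have hfin : ediam s ≠ ⊤ := ne_top_of_le_ne_top ENNReal.ofReal_ne_top hs
      set d := (ediam s).toReal with hd
      have hds : ENNReal.ofReal d = ediam s := ENNReal.ofReal_toReal hfin
      have hd0 : 0 ≤ d := ENNReal.toReal_nonneg
      have hsub : s ⊆ closedBall y d := by
        intro z hz
        rw [mem_closedBall, dist_edist]
        exact ENNReal.toReal_mono hfin (edist_le_ediam_of_mem hz hys)
      rcases hd0.eq_or_lt with hd1 | hd1
      · rw [← hd1, closedBall_zero] at hsub
        rw [measure_mono_null hsub (h0 y hy), mul_zero]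
        exact zero_le
      · have hd2 : d ≤ 1 / 2 := by
          rw [← hds] at hs
          exact (ENNReal.ofReal_le_ofReal_iff (by norm_num)).1 hs
        calc ENNReal.ofReal C⁻¹ * sphMeasure m s
            ≤ ENNReal.ofReal C⁻¹ * ENNReal.ofReal (C * d ^ m) := by
              gcongr
              exact (measure_mono hsub).trans (h y hy d hd1 hd2)
          _ = ediam s ^ (m : ℝ) := by
              rw [← ENNReal.ofReal_mul (by positivity), ← hds, ENNReal.rpow_natCast,
                ← ENNReal.ofReal_pow hd0]
              congr 1
              field_simp
    · have : sphMeasure m s = 0 := by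
        refine measure_mono_null ?_ (ae_iff.1 (ae_sphMeasure_norm m))
        intro y hy hy1
        exact hsS ⟨y, hy, hy1⟩
      rw [this, mul_zero]
      exact zero_le
  refine ⟨C, hC, ?_⟩
  have h1 : sphMeasure m = (sphMeasure m).restrict (sphere (0 : Euc (m + 1)) 1) := by
    refine (Measure.restrict_eq_self_of_ae_mem ?_).symm
    filter_upwards [ae_sphMeasure_norm m] with y hy
    simpa using hy
  have h2 : sphMeasure m = ENNReal.ofReal C • (ENNReal.ofReal C⁻¹ • sphMeasure m) := by
    rw [smul_smul, ← ENNReal.ofReal_mul hC.le, mul_inv_cancel₀ hC.ne', ENNReal.ofReal_one,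
      one_smul]
  rw [h1, h2, Measure.restrict_smul]
  refine Measure.le_iff.2 fun s hs => ?_
  have h3 := Measure.restrict_mono (subset_refl (sphere (0 : Euc (m + 1)) 1)) key s
  simp only [Measure.smul_apply, smul_eq_mul] at h3 ⊢
  gcongr

end SphereMeasure

section Kernel

/-- The kernel averaging the boundary datum. -/
def bdKernel (m : ℕ) (x y : Euc (m + 1)) : ℝ := (‖x - y‖ ^ (4 * m))⁻¹

/-- The total mass of the averaging kernel. -/
def bdMass (m : ℕ) (x : Euc (m + 1)) : ℝ := ∫ y, bdKernel m x y ∂(sphMeasure m)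

/-- A kernel comparable to the normalized averaging kernel. -/
def bdPoisson (m : ℕ) (x y : Euc (m + 1)) : ℝ := (1 - ‖x‖) ^ (3 * m) * bdKernel m x y

variable {m : ℕ} {x x' y z : Euc (m + 1)}

lemma bdKernel_nonneg (x y : Euc (m + 1)) : 0 ≤ bdKernel m x y := by
  unfold bdKernel; positivity

lemma one_sub_norm_le_norm_sub (hy : ‖y‖ = 1) : 1 - ‖x‖ ≤ ‖x - y‖ := by
  rw [← hy, norm_sub_rev]
  exact norm_sub_norm_le y x

lemma norm_sub_pos_of_norm_lt_one (hx : ‖x‖ < 1) (hy : ‖y‖ = 1) : 0 < ‖x - y‖ :=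
  lt_of_lt_of_le (sub_pos.2 hx) (one_sub_norm_le_norm_sub hy)

lemma bdKernel_le (hx : ‖x‖ < 1) (hy : ‖y‖ = 1) :
    bdKernel m x y ≤ ((1 - ‖x‖) ^ (4 * m))⁻¹ := by
  have := sub_pos.2 hx
  unfold bdKernel
  gcongr
  exact one_sub_norm_le_norm_sub hy

@[fun_prop]
lemma measurable_bdKernel : Measurable fun p : Euc (m + 1) × Euc (m + 1) => bdKernel m p.1 p.2 := by
  unfold bdKernel; fun_prop

lemma measurable_bdKernel_right (x : Euc (m + 1)) : Measurable (bdKernel m x) := by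
  unfold bdKernel; fun_prop

lemma norm_lt_one_of_near (hx : ‖x‖ < 1) (h : ‖x' - x‖ ≤ (1 - ‖x‖) / 4) : ‖x'‖ < 1 := by
  have := norm_sub_norm_le x' x
  linarith

lemma bdKernel_near_le (hx : ‖x‖ < 1) (hy : ‖y‖ = 1) (h : ‖x' - x‖ ≤ (1 - ‖x‖) / 4) :
    bdKernel m x' y ≤ 2 ^ (4 * m) * bdKernel m x y ∧
      bdKernel m x y ≤ 2 ^ (4 * m) * bdKernel m x' y := by
  have h0 := norm_sub_pos_of_norm_lt_one hx hy
  have h1 := norm_sub_pos_of_norm_lt_one (norm_lt_one_of_near hx h) hy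
  have h2 := one_sub_norm_le_norm_sub (x := x) hy
  have h3 := abs_norm_sub_norm_le (x' - y) (x - y)
  rw [sub_sub_sub_cancel_right, abs_le] at h3
  unfold bdKernel
  constructor
  · rw [← div_eq_mul_inv, inv_le_comm₀ (by positivity) (by positivity), inv_div, ← div_pow]
    gcongr
    linarith
  · rw [← div_eq_mul_inv, inv_le_comm₀ (by positivity) (by positivity), inv_div, ← div_pow]
    gcongr
    linarith

lemma abs_bdKernel_sub_le (hx : ‖x‖ < 1) (hy : ‖y‖ = 1) (h : ‖x' - x‖ ≤ (1 - ‖x‖) / 4) :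
    |bdKernel m x' y - bdKernel m x y| ≤
      4 * m * 2 ^ (4 * m) * 2 * (‖x' - x‖ / (1 - ‖x‖)) * bdKernel m x y := by
  have hl := sub_pos.2 hx
  have h0 := norm_sub_pos_of_norm_lt_one hx hy
  have h1 := norm_sub_pos_of_norm_lt_one (norm_lt_one_of_near hx h) hy
  have h2 := one_sub_norm_le_norm_sub (x := x) hy
  have h3 := abs_norm_sub_norm_le (x' - y) (x - y)
  rw [sub_sub_sub_cancel_right] at h3
  have h3' := abs_le.1 h3
  set b := ‖x' - y‖ with hb
  set a := ‖x - y‖ with ha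
  have hq : a / b ≤ 2 := by rw [div_le_iff₀ h1]; linarith
  have hd : |a / b - 1| ≤ 2 * (‖x' - x‖ / (1 - ‖x‖)) := by
    rw [div_sub_one h1.ne', abs_div, abs_of_pos h1, div_le_iff₀ h1, abs_sub_comm]
    have hb' : (1 - ‖x‖) / 2 ≤ b := by linarith
    calc |b - a| ≤ ‖x' - x‖ := h3
      _ = 2 * (‖x' - x‖ / (1 - ‖x‖)) * ((1 - ‖x‖) / 2) := by field_simp
      _ ≤ _ := by gcongr
  have key : |(a / b) ^ (4 * m) - 1| ≤ 4 * m * 2 ^ (4 * m) * 2 * (‖x' - x‖ / (1 - ‖x‖)) := by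
    have h4 := abs_pow_sub_pow_le (a / b) 1 (4 * m)
    rw [one_pow] at h4
    have h5 : max |a / b| |1| ≤ 2 := by
      rw [abs_of_pos (by positivity), abs_one]
      exact max_le hq one_le_two
    calc |(a / b) ^ (4 * m) - 1|
        ≤ |a / b - 1| * ((4 * m : ℕ) : ℝ) * max |a / b| |1| ^ (4 * m - 1) := h4
      _ ≤ (2 * (‖x' - x‖ / (1 - ‖x‖))) * ((4 * m : ℕ) : ℝ) * 2 ^ (4 * m) := by
          gcongr
          calc max |a / b| |1| ^ (4 * m - 1) ≤ 2 ^ (4 * m - 1) := by gcongr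
            _ ≤ 2 ^ (4 * m) := pow_le_pow_right₀ one_le_two (by omega)
      _ = _ := by push_cast; ring
  unfold bdKernel
  rw [← ha, ← hb]
  have h6 : (b ^ (4 * m))⁻¹ - (a ^ (4 * m))⁻¹ = ((a / b) ^ (4 * m) - 1) * (a ^ (4 * m))⁻¹ := by
    rw [div_pow]
    field_simp
  rw [h6, abs_mul, abs_of_pos (a := (a ^ (4 * m))⁻¹) (by positivity)]
  gcongr

lemma integrable_bdKernel (hx : ‖x‖ < 1) : Integrable (bdKernel m x) (sphMeasure m) := by
  refine Integrable.of_bound (measurable_bdKernel_right x).aestronglyMeasurable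
    ((1 - ‖x‖) ^ (4 * m))⁻¹ ?_
  filter_upwards [ae_sphMeasure_norm m] with y hy
  rw [Real.norm_eq_abs, abs_of_nonneg (bdKernel_nonneg x y)]
  exact bdKernel_le hx hy

lemma exists_le_bdMass (m : ℕ) : ∃ c : ℝ, 0 < c ∧ ∀ x : Euc (m + 1), ‖x‖ < 1 →
    c * ((1 - ‖x‖) ^ (3 * m))⁻¹ ≤ bdMass m x := by
  obtain ⟨C, hC, h⟩ := exists_le_sphMeasure_closedBall m
  refine ⟨(2 ^ (4 * m))⁻¹ * C * (2 ^ m)⁻¹, by positivity, fun x hx => ?_⟩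
  have hl := sub_pos.2 hx
  obtain ⟨e, he, hex⟩ : ∃ e : Euc (m + 1), ‖e‖ = 1 ∧ ‖x - e‖ = 1 - ‖x‖ := by
    by_cases hx0 : x = 0
    · obtain ⟨e, he⟩ := exists_norm_eq (Euc (m + 1)) zero_le_one
      exact ⟨e, he, by simp [hx0, he]⟩
    · refine ⟨‖x‖⁻¹ • x, norm_smul_inv_norm hx0, ?_⟩
      rw [norm_sub_rev]
      exact norm_normalize_sub hx0 hx.le
  have h1 := h e he ((1 - ‖x‖) / 2) (by linarith) (by linarith [norm_nonneg x])
  rw [ENNReal.ofReal_le_iff_le_toReal (measure_ne_top _ _)] at h1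
  have h2 : ∀ᵐ y ∂(sphMeasure m), (closedBall e ((1 - ‖x‖) / 2)).indicator
      (fun _ => ((2 * (1 - ‖x‖)) ^ (4 * m))⁻¹) y ≤ bdKernel m x y := by
    filter_upwards [ae_sphMeasure_norm m] with y hy
    by_cases hye : y ∈ closedBall e ((1 - ‖x‖) / 2)
    · rw [indicator_of_mem hye]
      have h0 := norm_sub_pos_of_norm_lt_one hx hy
      rw [mem_closedBall, dist_comm, dist_eq_norm] at hye
      have h3 : ‖x - y‖ ≤ 2 * (1 - ‖x‖) := by
        have := norm_sub_le_norm_sub_add_norm_sub x e y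
        linarith
      unfold bdKernel
      gcongr
    · rw [indicator_of_notMem hye]
      exact bdKernel_nonneg x y
  have h3 := integral_mono_ae ((integrable_const _).indicator measurableSet_closedBall)
    (integrable_bdKernel hx) h2
  rw [integral_indicator_const _ measurableSet_closedBall, smul_eq_mul] at h3
  refine le_trans ?_ h3
  calc _ = C * ((1 - ‖x‖) / 2) ^ m * ((2 * (1 - ‖x‖)) ^ (4 * m))⁻¹ := by
        have : (1 - ‖x‖) ^ (4 * m) = (1 - ‖x‖) ^ (3 * m) * (1 - ‖x‖) ^ m := by
          rw [← pow_add]; congr 1; ring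
        rw [mul_pow, div_pow, this]
        field_simp
    _ ≤ _ := by gcongr; exact h1

lemma bdMass_pos (hx : ‖x‖ < 1) : 0 < bdMass m x := by
  obtain ⟨c, hc, h⟩ := exists_le_bdMass m
  have := sub_pos.2 hx
  exact lt_of_lt_of_le (by positivity) (h x hx)

lemma bdMass_le (hx : ‖x‖ < 1) (h : ‖x' - x‖ ≤ (1 - ‖x‖) / 4) :
    bdMass m x ≤ 2 ^ (4 * m) * bdMass m x' := by
  have hx' := norm_lt_one_of_near hx h
  rw [bdMass, bdMass, ← integral_const_mul]
  refine integral_mono_ae (integrable_bdKernel hx) ((integrable_bdKernel hx').const_mul _) ?_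
  filter_upwards [ae_sphMeasure_norm m] with y hy
  exact (bdKernel_near_le hx hy h).2

lemma bdPoisson_nonneg (hx : ‖x‖ < 1) (y : Euc (m + 1)) : 0 ≤ bdPoisson m x y :=
  mul_nonneg (pow_nonneg (sub_pos.2 hx).le _) (bdKernel_nonneg x y)

@[fun_prop]
lemma measurable_bdPoisson :
    Measurable fun p : Euc (m + 1) × Euc (m + 1) => bdPoisson m p.1 p.2 := by
  unfold bdPoisson; fun_prop

lemma bdPoisson_near_le (hx : ‖x‖ < 1) (hy : ‖y‖ = 1) (h : ‖x' - x‖ ≤ (1 - ‖x‖) / 4) :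
    bdPoisson m x y ≤ 2 ^ (7 * m) * bdPoisson m x' y := by
  have h1 := (bdKernel_near_le (m := m) hx hy h).2
  have h2 := norm_sub_norm_le x' x
  have hl := sub_pos.2 hx
  have h3 : 1 - ‖x‖ ≤ 2 * (1 - ‖x'‖) := by linarith
  unfold bdPoisson
  calc (1 - ‖x‖) ^ (3 * m) * bdKernel m x y
      ≤ (2 * (1 - ‖x'‖)) ^ (3 * m) * (2 ^ (4 * m) * bdKernel m x' y) := by
        have := hl.trans_le h3
        gcongr
        exact bdKernel_nonneg x y
    _ = _ := by
        rw [mul_pow, show 7 * m = 3 * m + 4 * m by ring, pow_add]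
        ring

lemma exists_bdKernel_div_le (m : ℕ) : ∃ C : ℝ, 0 < C ∧ ∀ x y : Euc (m + 1), ‖x‖ < 1 →
    bdKernel m x y / bdMass m x ≤ C * bdPoisson m x y := by
  obtain ⟨c, hc, h⟩ := exists_le_bdMass m
  refine ⟨c⁻¹, by positivity, fun x y hx => ?_⟩
  have hl := sub_pos.2 hx
  have h1 := h x hx
  rw [div_le_iff₀ (bdMass_pos hx), bdPoisson]
  calc bdKernel m x y = c⁻¹ * ((1 - ‖x‖) ^ (3 * m) * bdKernel m x y) *
        (c * ((1 - ‖x‖) ^ (3 * m))⁻¹) := by field_simp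
    _ ≤ _ := by
        have := bdKernel_nonneg x y
        gcongr

lemma bdPoisson_mul_le (hm : 1 ≤ m) (hx : ‖x‖ < 1) (hy : ‖y‖ = 1) (hz : ‖z‖ = 1) :
    ((1 - ‖x‖) ^ (m + 1))⁻¹ * (bdPoisson m x y * bdPoisson m x z) ≤
      3 ^ (3 * m + 1) * ((‖y - z‖ + ‖x - y‖) ^ (3 * m + 1))⁻¹ := by
  have hl := sub_pos.2 hx
  have hy0 := norm_sub_pos_of_norm_lt_one hx hy
  have hz0 := norm_sub_pos_of_norm_lt_one hx hz
  have hy1 := one_sub_norm_le_norm_sub (x := x) hy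
  have hz1 := one_sub_norm_le_norm_sub (x := x) hz
  have hyz : ‖y - z‖ ≤ ‖x - y‖ + ‖x - z‖ := by
    have := norm_sub_le_norm_sub_add_norm_sub y x z
    rwa [norm_sub_rev y x] at this
  obtain ⟨k, rfl⟩ : ∃ k, m = k + 1 := ⟨m - 1, by omega⟩
  have aux : ∀ a b l : ℝ, 0 < l → l ≤ a → a ≤ b →
      (l ^ (k + 1 + 1))⁻¹ * ((l ^ (3 * (k + 1)) * (a ^ (4 * (k + 1)))⁻¹) *
        (l ^ (3 * (k + 1)) * (b ^ (4 * (k + 1)))⁻¹)) ≤ (b ^ (3 * (k + 1) + 1))⁻¹ := by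
    intro a b l hl hla hab
    have ha : 0 < a := hl.trans_le hla
    have hb : 0 < b := ha.trans_le hab
    have e1 : (l ^ (k + 1 + 1))⁻¹ * ((l ^ (3 * (k + 1)) * (a ^ (4 * (k + 1)))⁻¹) *
        (l ^ (3 * (k + 1)) * (b ^ (4 * (k + 1)))⁻¹)) =
        l ^ (4 * (k + 1)) * l ^ k * ((a ^ (4 * (k + 1)))⁻¹ * (b ^ (4 * (k + 1)))⁻¹) := by
      have : l ^ (3 * (k + 1)) * l ^ (3 * (k + 1)) =
          l ^ (4 * (k + 1)) * l ^ k * l ^ (k + 1 + 1) := by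
        rw [← pow_add, ← pow_add, ← pow_add]; congr 1; ring
      field_simp
      rw [pow_two, this]
      ring
    rw [e1]
    calc l ^ (4 * (k + 1)) * l ^ k * ((a ^ (4 * (k + 1)))⁻¹ * (b ^ (4 * (k + 1)))⁻¹)
        ≤ a ^ (4 * (k + 1)) * b ^ k * ((a ^ (4 * (k + 1)))⁻¹ * (b ^ (4 * (k + 1)))⁻¹) := by
          gcongr
          linarith
      _ = _ := by
          have : b ^ (4 * (k + 1)) = b ^ (3 * (k + 1) + 1) * b ^ k := by
            rw [← pow_add]; congr 1; ring
          rw [this]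
          field_simp
  have aux2 : ∀ b : ℝ, 0 < b → ‖y - z‖ + ‖x - y‖ ≤ 3 * b →
      (b ^ (3 * (k + 1) + 1))⁻¹ ≤
        3 ^ (3 * (k + 1) + 1) * ((‖y - z‖ + ‖x - y‖) ^ (3 * (k + 1) + 1))⁻¹ := by
    intro b hb h
    have : 0 < ‖y - z‖ + ‖x - y‖ := by positivity
    rw [← div_eq_mul_inv, inv_le_comm₀ (by positivity) (by positivity), inv_div, ← div_pow]
    gcongr
    linarith
  unfold bdPoisson bdKernel
  rcases le_total ‖x - y‖ ‖x - z‖ with hle | hle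
  · exact (aux _ _ _ hl hy1 hle).trans (aux2 _ hz0 (by linarith))
  · rw [mul_comm ((1 - ‖x‖) ^ (3 * (k + 1)) * _)]
    exact (aux _ _ _ hl hz1 hle).trans (aux2 _ hy0 (by linarith))

lemma exists_lintegral_inv_add_norm_le (hm : 1 ≤ m) : ∃ C : ℝ, 0 < C ∧
    ∀ (y : Euc (m + 1)) (L : ℝ), 0 < L →
      ∫⁻ x : Euc (m + 1), ENNReal.ofReal (((L + ‖x - y‖) ^ (3 * m + 1))⁻¹) ≤
        ENNReal.ofReal (C * (L ^ (2 * m))⁻¹) := by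
  have hInt : Integrable (fun x : Euc (m + 1) => ((1 + ‖x‖) ^ (3 * m + 1))⁻¹) := by
    have := integrable_one_add_norm (E := Euc (m + 1)) (μ := volume) (r := (3 * m + 1 : ℕ))
      (by rw [finrank_euclideanSpace, Fintype.card_fin]; exact_mod_cast (by omega))
    refine this.congr (Eventually.of_forall fun x => ?_)
    simp only
    rw [Real.rpow_neg (by positivity), Real.rpow_natCast]
  refine ⟨(∫ x : Euc (m + 1), ((1 + ‖x‖) ^ (3 * m + 1))⁻¹) + 1, ?_, fun y L hL => ?_⟩
  · have : 0 ≤ ∫ x : Euc (m + 1), ((1 + ‖x‖) ^ (3 * m + 1))⁻¹ :=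
      integral_nonneg fun x => by positivity
    linarith
  rw [lintegral_sub_right_eq_self (fun x => ENNReal.ofReal (((L + ‖x‖) ^ (3 * m + 1))⁻¹)) y]
  have e : (fun x : Euc (m + 1) => ((L + ‖x‖) ^ (3 * m + 1))⁻¹) =
      fun x => (L ^ (3 * m + 1))⁻¹ * ((1 + ‖L⁻¹ • x‖) ^ (3 * m + 1))⁻¹ := by
    ext x
    rw [← mul_inv, ← mul_pow, norm_smul, norm_inv, Real.norm_eq_abs, abs_of_pos hL]
    congr 2
    field_simp
  have hint2 : Integrable (fun x : Euc (m + 1) => ((L + ‖x‖) ^ (3 * m + 1))⁻¹) := by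
    rw [e]
    exact (hInt.comp_smul (inv_ne_zero hL.ne')).const_mul _
  rw [← ofReal_integral_eq_lintegral_ofReal hint2 (Eventually.of_forall fun x => by positivity), e,
    integral_const_mul, Measure.integral_comp_smul volume
      (fun x : Euc (m + 1) => ((1 + ‖x‖) ^ (3 * m + 1))⁻¹)]
  refine ENNReal.ofReal_le_ofReal ?_
  rw [finrank_euclideanSpace, Fintype.card_fin, smul_eq_mul, inv_pow, inv_inv,
    abs_of_pos (by positivity), ← mul_assoc]
  have e2 : (L ^ (3 * m + 1))⁻¹ * L ^ (m + 1) = (L ^ (2 * m))⁻¹ := by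
    rw [show 3 * m + 1 = 2 * m + (m + 1) by ring, pow_add]
    field_simp
  rw [e2, mul_comm]
  gcongr
  linarith

/-- The average of `f` against the product of two Poisson type kernels. -/
def doubleAverage (m : ℕ) (f : Euc (m + 1) × Euc (m + 1) → ℝ≥0∞) (x : Euc (m + 1)) : ℝ≥0∞ :=
  ∫⁻ y, ∫⁻ z, f (y, z) * ENNReal.ofReal (bdPoisson m x y * bdPoisson m x z)
    ∂(sphMeasure m) ∂(sphMeasure m)

lemma measurable_doubleAverage {f : Euc (m + 1) × Euc (m + 1) → ℝ≥0∞} (hf : Measurable f) :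
    Measurable (doubleAverage m f) := by
  unfold doubleAverage
  have h1 : Measurable fun p : (Euc (m + 1) × Euc (m + 1)) × Euc (m + 1) =>
      f (p.1.2, p.2) * ENNReal.ofReal (bdPoisson m p.1.1 p.1.2 * bdPoisson m p.1.1 p.2) := by
    unfold bdPoisson bdKernel
    fun_prop
  exact h1.lintegral_prod_right'.lintegral_prod_right'

lemma exists_lintegral_doubleAverage_le (hm : 1 ≤ m) : ∃ C : ℝ, 0 < C ∧
    ∀ f : Euc (m + 1) × Euc (m + 1) → ℝ≥0∞, Measurable f → (∀ y, f (y, y) = 0) →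
      ∫⁻ x in ball (0 : Euc (m + 1)) 1,
          ENNReal.ofReal ((1 - ‖x‖) ^ (m + 1))⁻¹ * doubleAverage m f x ≤
        ENNReal.ofReal C * ∫⁻ y, ∫⁻ z, f (y, z) / ENNReal.ofReal (dist y z ^ (2 * m))
          ∂(sphMeasure m) ∂(sphMeasure m) := by
  obtain ⟨C, hC, h⟩ := exists_lintegral_inv_add_norm_le hm
  refine ⟨3 ^ (3 * m + 1) * C, by positivity, fun f hf hf0 => ?_⟩
  have hmeas : Measurable fun p : (Euc (m + 1) × Euc (m + 1)) × Euc (m + 1) =>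
      ENNReal.ofReal ((1 - ‖p.1.1‖) ^ (m + 1))⁻¹ * (f (p.1.2, p.2) *
        ENNReal.ofReal (bdPoisson m p.1.1 p.1.2 * bdPoisson m p.1.1 p.2)) := by
    unfold bdPoisson bdKernel
    fun_prop
  have key : ∀ y z : Euc (m + 1), ‖y‖ = 1 → ‖z‖ = 1 →
      ∫⁻ x in ball (0 : Euc (m + 1)) 1, ENNReal.ofReal ((1 - ‖x‖) ^ (m + 1))⁻¹ * (f (y, z) *
        ENNReal.ofReal (bdPoisson m x y * bdPoisson m x z)) ≤
      ENNReal.ofReal (3 ^ (3 * m + 1) * C) * (f (y, z) / ENNReal.ofReal (dist y z ^ (2 * m))) := by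
    intro y z hy hz
    by_cases hyz : y = z
    · simp [hyz, hf0]
    have hL : 0 < ‖y - z‖ := norm_pos_iff.2 (sub_ne_zero.2 hyz)
    calc ∫⁻ x in ball (0 : Euc (m + 1)) 1, ENNReal.ofReal ((1 - ‖x‖) ^ (m + 1))⁻¹ * (f (y, z) *
          ENNReal.ofReal (bdPoisson m x y * bdPoisson m x z))
        ≤ ∫⁻ x in ball (0 : Euc (m + 1)) 1, f (y, z) * (ENNReal.ofReal (3 ^ (3 * m + 1)) *
          ENNReal.ofReal (((‖y - z‖ + ‖x - y‖) ^ (3 * m + 1))⁻¹)) := by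
          refine setLIntegral_mono (by fun_prop) fun x hx => ?_
          rw [mem_ball_zero_iff] at hx
          have := sub_pos.2 hx
          rw [mul_left_comm, ← ENNReal.ofReal_mul (by positivity),
            ← ENNReal.ofReal_mul (by positivity)]
          refine mul_le_mul_right (ENNReal.ofReal_le_ofReal ?_) _
          exact bdPoisson_mul_le hm hx hy hz
      _ ≤ ∫⁻ x, f (y, z) * (ENNReal.ofReal (3 ^ (3 * m + 1)) *
          ENNReal.ofReal (((‖y - z‖ + ‖x - y‖) ^ (3 * m + 1))⁻¹)) := setLIntegral_le_lintegral _ _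
      _ = f (y, z) * (ENNReal.ofReal (3 ^ (3 * m + 1)) *
          ∫⁻ x, ENNReal.ofReal (((‖y - z‖ + ‖x - y‖) ^ (3 * m + 1))⁻¹)) := by
          rw [lintegral_const_mul _ (by fun_prop), lintegral_const_mul _ (by fun_prop)]
      _ ≤ f (y, z) * (ENNReal.ofReal (3 ^ (3 * m + 1)) *
          ENNReal.ofReal (C * (‖y - z‖ ^ (2 * m))⁻¹)) := by
          gcongr
          exact h y _ hL
      _ = _ := by
          rw [div_eq_mul_inv, ← ENNReal.ofReal_inv_of_pos (by rw [dist_eq_norm]; positivity),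
            ENNReal.ofReal_mul hC.le, ENNReal.ofReal_mul (by positivity), dist_eq_norm]
          ring
  calc ∫⁻ x in ball (0 : Euc (m + 1)) 1,
          ENNReal.ofReal ((1 - ‖x‖) ^ (m + 1))⁻¹ * doubleAverage m f x
      = ∫⁻ x in ball (0 : Euc (m + 1)) 1, ∫⁻ y, ∫⁻ z, ENNReal.ofReal ((1 - ‖x‖) ^ (m + 1))⁻¹ *
        (f (y, z) * ENNReal.ofReal (bdPoisson m x y * bdPoisson m x z))
          ∂(sphMeasure m) ∂(sphMeasure m) := by
        refine lintegral_congr fun x => ?_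
        unfold doubleAverage
        have h1 : Measurable fun p : Euc (m + 1) × Euc (m + 1) => f (p.1, p.2) *
            ENNReal.ofReal (bdPoisson m x p.1 * bdPoisson m x p.2) := by
          unfold bdPoisson bdKernel
          fun_prop
        rw [← lintegral_const_mul _ h1.lintegral_prod_right']
        refine lintegral_congr fun y => ?_
        exact (lintegral_const_mul _ (h1.comp measurable_prodMk_left)).symm
    _ = ∫⁻ y, ∫⁻ z, (∫⁻ x in ball (0 : Euc (m + 1)) 1, ENNReal.ofReal ((1 - ‖x‖) ^ (m + 1))⁻¹ *
        (f (y, z) * ENNReal.ofReal (bdPoisson m x y * bdPoisson m x z)))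
          ∂(sphMeasure m) ∂(sphMeasure m) := by
        rw [lintegral_lintegral_swap hmeas.lintegral_prod_right'.aemeasurable]
        refine lintegral_congr fun y => ?_
        rw [lintegral_lintegral_swap]
        exact (hmeas.comp (by fun_prop : Measurable fun q : Euc (m + 1) × Euc (m + 1) =>
          ((q.1, y), q.2))).aemeasurable
    _ ≤ ∫⁻ y, ∫⁻ z, ENNReal.ofReal (3 ^ (3 * m + 1) * C) *
        (f (y, z) / ENNReal.ofReal (dist y z ^ (2 * m))) ∂(sphMeasure m) ∂(sphMeasure m) := by
        refine lintegral_mono_ae ?_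
        filter_upwards [ae_sphMeasure_norm m] with y hy
        refine lintegral_mono_ae ?_
        filter_upwards [ae_sphMeasure_norm m] with z hz
        exact key y z hy hz
    _ = _ := by
        have h1 : Measurable fun p : Euc (m + 1) × Euc (m + 1) =>
            f (p.1, p.2) / ENNReal.ofReal (dist p.1 p.2 ^ (2 * m)) := by fun_prop
        rw [← lintegral_const_mul _ h1.lintegral_prod_right']
        refine lintegral_congr fun y => ?_
        have h2 : Measurable fun z : Euc (m + 1) =>
            f (y, z) / ENNReal.ofReal (dist y z ^ (2 * m)) := by fun_prop
        rw [← lintegral_const_mul _ h2]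

end Kernel

section Average

/-- The probability measure on the sphere with density proportional to the averaging kernel. -/
def bdProb (m : ℕ) (x : Euc (m + 1)) : Measure (Euc (m + 1)) :=
  (sphMeasure m).withDensity fun y => ENNReal.ofReal (bdKernel m x y / bdMass m x)

/-- The extension of a boundary datum by averaging. -/
def bdExt {m ν : ℕ} (u : Euc (m + 1) → Euc ν) (x : Euc (m + 1)) : Euc ν := ∫ y, u y ∂(bdProb m x)

/-- The mean oscillation of a boundary datum around its average. -/
def bdOsc {m ν : ℕ} (u : Euc (m + 1) → Euc ν) (x : Euc (m + 1)) : ℝ :=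
  ∫ y, ‖u y - bdExt u x‖ ∂(bdProb m x)

variable {m ν : ℕ} {x x' y z : Euc (m + 1)} {u : Euc (m + 1) → Euc ν} {D : ℝ}

lemma isProbabilityMeasure_bdProb (hx : ‖x‖ < 1) : IsProbabilityMeasure (bdProb m x) := by
  refine ⟨?_⟩
  have hK := bdMass_pos (m := m) hx
  rw [bdProb, withDensity_apply _ MeasurableSet.univ, setLIntegral_univ,
    ← ofReal_integral_eq_lintegral_ofReal ((integrable_bdKernel hx).div_const _)
      (Eventually.of_forall fun y => div_nonneg (bdKernel_nonneg x y) hK.le), integral_div,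
    ← bdMass, div_self hK.ne', ENNReal.ofReal_one]

lemma integral_bdProb {F : Type*} [NormedAddCommGroup F] [NormedSpace ℝ F] (hx : ‖x‖ < 1)
    (f : Euc (m + 1) → F) :
    ∫ y, f y ∂(bdProb m x) = (bdMass m x)⁻¹ • ∫ y, bdKernel m x y • f y ∂(sphMeasure m) := by
  have hm : Measurable fun y => ENNReal.ofReal (bdKernel m x y / bdMass m x) :=
    ((measurable_bdKernel_right x).div_const _).ennreal_ofReal
  rw [bdProb, integral_withDensity_eq_integral_toReal_smul hm
    (Eventually.of_forall fun _ => ENNReal.ofReal_lt_top), ← integral_smul]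
  refine integral_congr_ae (Eventually.of_forall fun y => ?_)
  simp only
  rw [ENNReal.toReal_ofReal (div_nonneg (bdKernel_nonneg x y) (bdMass_pos hx).le), smul_smul,
    div_eq_inv_mul]

lemma exists_lintegral_bdProb_le (m : ℕ) : ∃ C : ℝ, 0 < C ∧ ∀ x : Euc (m + 1), ‖x‖ < 1 →
    ∀ g : Euc (m + 1) → ℝ≥0∞, Measurable g → ∫⁻ y, g y ∂(bdProb m x) ≤
      ∫⁻ y, g y * ENNReal.ofReal (C * bdPoisson m x y) ∂(sphMeasure m) := by
  obtain ⟨C, hC, h⟩ := exists_bdKernel_div_le m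
  refine ⟨C, hC, fun x hx g hg => ?_⟩
  have hm : Measurable fun y => ENNReal.ofReal (bdKernel m x y / bdMass m x) :=
    ((measurable_bdKernel_right x).div_const _).ennreal_ofReal
  rw [bdProb, lintegral_withDensity_eq_lintegral_mul _ hm hg]
  refine lintegral_mono fun y => ?_
  rw [Pi.mul_apply, mul_comm]
  gcongr
  exact h x y hx

lemma exists_lintegral_lintegral_bdProb_le (m : ℕ) : ∃ C : ℝ, 0 < C ∧
    ∀ x : Euc (m + 1), ‖x‖ < 1 → ∀ f : Euc (m + 1) × Euc (m + 1) → ℝ≥0∞, Measurable f →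
      ∫⁻ y, ∫⁻ z, f (y, z) ∂(bdProb m x) ∂(bdProb m x) ≤
        ENNReal.ofReal C * doubleAverage m f x := by
  obtain ⟨C, hC, h⟩ := exists_lintegral_bdProb_le m
  refine ⟨C * C, by positivity, fun x hx f hf => ?_⟩
  have := isProbabilityMeasure_bdProb (m := m) hx
  have h1 : Measurable fun p : Euc (m + 1) × Euc (m + 1) => f (p.1, p.2) *
      ENNReal.ofReal (bdPoisson m x p.1 * bdPoisson m x p.2) := by
    unfold bdPoisson bdKernel
    fun_prop
  refine (h x hx _ (hf.lintegral_prod_right' (ν := bdProb m x))).trans ?_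
  rw [doubleAverage, ← lintegral_const_mul _ h1.lintegral_prod_right']
  refine lintegral_mono fun y => ?_
  have h2 : Measurable fun z => f (y, z) *
      ENNReal.ofReal (bdPoisson m x y * bdPoisson m x z) := by
    unfold bdPoisson bdKernel
    fun_prop
  have h3 : Measurable fun z => f (y, z) * ENNReal.ofReal (C * bdPoisson m x z) := by
    unfold bdPoisson bdKernel
    fun_prop
  rw [← lintegral_const_mul _ h2]
  refine (mul_le_mul_left (h x hx _ (hf.comp measurable_prodMk_left)) _).trans ?_
  simp only [Function.comp]
  rw [← lintegral_mul_const _ h3]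
  refine lintegral_mono fun z => le_of_eq ?_
  have := bdPoisson_nonneg (m := m) hx y
  have := bdPoisson_nonneg (m := m) hx z
  rw [mul_assoc, ← ENNReal.ofReal_mul (by positivity), mul_left_comm (ENNReal.ofReal (C * C)),
    ← ENNReal.ofReal_mul (by positivity)]
  congr 2
  ring

lemma integrable_of_osc {μ : Measure (Euc (m + 1))} [IsFiniteMeasure μ] (hu : Measurable u)
    (hD : ∀ y z, ‖u y - u z‖ ≤ D) : Integrable u μ := by
  refine Integrable.of_bound hu.aestronglyMeasurable (‖u 0‖ + D) (Eventually.of_forall fun y => ?_)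
  have := norm_sub_norm_le (u y) (u 0)
  linarith [hD y 0]

lemma norm_bdExt_sub_le (hu : Measurable u) (hD : ∀ y z, ‖u y - u z‖ ≤ D) (hx : ‖x‖ < 1)
    (v : Euc ν) : ‖bdExt u x - v‖ ≤ ∫ y, ‖u y - v‖ ∂(bdProb m x) := by
  have := isProbabilityMeasure_bdProb (m := m) hx
  have h : bdExt u x - v = ∫ y, (u y - v) ∂(bdProb m x) := by
    rw [integral_sub (integrable_of_osc hu hD) (integrable_const _), integral_const, bdExt]
    simp
  rw [h]
  exact norm_integral_le_integral_norm _

lemma norm_sub_bdExt_le (hu : Measurable u) (hD : ∀ y z, ‖u y - u z‖ ≤ D) (hx : ‖x‖ < 1)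
    (y : Euc (m + 1)) : ‖u y - bdExt u x‖ ≤ D := by
  have := isProbabilityMeasure_bdProb (m := m) hx
  rw [norm_sub_rev]
  refine (norm_bdExt_sub_le hu hD hx _).trans ?_
  calc ∫ z, ‖u z - u y‖ ∂(bdProb m x) ≤ ∫ _, D ∂(bdProb m x) :=
        integral_mono ((integrable_of_osc hu hD).sub (integrable_const _)).norm
          (integrable_const _) fun z => hD z y
    _ = D := by simp

lemma bdOsc_nonneg (x : Euc (m + 1)) : 0 ≤ bdOsc u x := integral_nonneg fun _ => norm_nonneg _

lemma bdOsc_le (hu : Measurable u) (hD : ∀ y z, ‖u y - u z‖ ≤ D) (hx : ‖x‖ < 1) :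
    bdOsc u x ≤ D := by
  have := isProbabilityMeasure_bdProb (m := m) hx
  calc bdOsc u x ≤ ∫ _, D ∂(bdProb m x) :=
        integral_mono ((integrable_of_osc hu hD).sub (integrable_const _)).norm
          (integrable_const _) fun z => norm_sub_bdExt_le hu hD hx z
    _ = D := by simp

lemma norm_bdExt_sub_bdExt_le (hu : Measurable u) (hD : ∀ y z, ‖u y - u z‖ ≤ D) (hx : ‖x‖ < 1)
    (h : ‖x' - x‖ ≤ (1 - ‖x‖) / 4) : ‖bdExt u x' - bdExt u x‖ ≤
      4 * m * 2 ^ (8 * m) * 2 * (‖x' - x‖ / (1 - ‖x‖)) * bdOsc u x := by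
  have hx' := norm_lt_one_of_near hx h
  have hP := isProbabilityMeasure_bdProb (m := m) hx
  have hP' := isProbabilityMeasure_bdProb (m := m) hx'
  have hl := sub_pos.2 hx
  have hK := bdMass_pos (m := m) hx
  have hK' := bdMass_pos (m := m) hx'
  set v := bdExt u x with hv
  have hInt : ∀ w : Euc (m + 1), ‖w‖ < 1 →
      Integrable (fun y => bdKernel m w y • (u y - v)) (sphMeasure m) := by
    intro w hw
    refine (integrable_bdKernel hw).smul_bdd D (by fun_prop) (Eventually.of_forall fun y => ?_)
    exact norm_sub_bdExt_le hu hD hx y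
  have h1 : ∀ w : Euc (m + 1), ‖w‖ < 1 → bdExt u w - v =
      (bdMass m w)⁻¹ • ∫ y, bdKernel m w y • (u y - v) ∂(sphMeasure m) := by
    intro w hw
    have := isProbabilityMeasure_bdProb (m := m) hw
    rw [← integral_bdProb hw, integral_sub (integrable_of_osc hu hD) (integrable_const _),
      integral_const, bdExt]
    simp
  have h2 : ∫ y, bdKernel m x y • (u y - v) ∂(sphMeasure m) = 0 := by
    have := h1 x hx
    rw [← hv, sub_self, eq_comm, smul_eq_zero] at this
    exact this.resolve_left (inv_ne_zero hK.ne')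
  have h3 : bdExt u x' - v = (bdMass m x')⁻¹ •
      ∫ y, (bdKernel m x' y - bdKernel m x y) • (u y - v) ∂(sphMeasure m) := by
    rw [h1 x' hx']
    simp_rw [sub_smul]
    rw [integral_sub (hInt x' hx') (hInt x hx), h2, sub_zero]
  set c := 4 * m * 2 ^ (4 * m) * 2 * (‖x' - x‖ / (1 - ‖x‖)) with hc
  have h4 : ‖∫ y, (bdKernel m x' y - bdKernel m x y) • (u y - v) ∂(sphMeasure m)‖ ≤
      c * (bdMass m x * bdOsc u x) := by
    rw [bdOsc, integral_bdProb hx, smul_eq_mul, mul_inv_cancel_left₀ hK.ne', ← integral_const_mul]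
    refine norm_integral_le_of_norm_le ((hInt x hx).norm.const_mul c |>.congr
      (Eventually.of_forall fun y => ?_)) ?_
    · simp only
      rw [norm_smul, Real.norm_eq_abs, abs_of_nonneg (bdKernel_nonneg x y), smul_eq_mul]
    · filter_upwards [ae_sphMeasure_norm m] with y hy
      rw [norm_smul, Real.norm_eq_abs, smul_eq_mul, ← mul_assoc]
      gcongr
      exact abs_bdKernel_sub_le hx hy h
  have h5 := bdMass_le (m := m) hx h
  have h6 := bdOsc_nonneg (u := u) x
  have hc0 : 0 ≤ c := by positivity
  rw [h3, norm_smul, norm_inv, Real.norm_eq_abs, abs_of_pos hK', inv_mul_le_iff₀ hK']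
  calc _ ≤ c * (bdMass m x * bdOsc u x) := h4
    _ ≤ c * ((2 ^ (4 * m) * bdMass m x') * bdOsc u x) := by gcongr
    _ = _ := by
      rw [hc, show 8 * m = 4 * m + 4 * m by ring, pow_add]
      ring

lemma differentiableAt_integral_bdKernel {F : Type*} [NormedAddCommGroup F] [NormedSpace ℝ F]
    {f : Euc (m + 1) → F} (hf : Integrable f (sphMeasure m)) (hx : ‖x‖ < 1) :
    DifferentiableAt ℝ (fun w => ∫ y, bdKernel m w y • f y ∂(sphMeasure m)) x := by
  have hl := sub_pos.2 hx
  set φ : Euc (m + 1) → ℝ := fun w => (‖w‖ ^ (4 * m))⁻¹ with hφ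
  have hφd : ∀ w : Euc (m + 1), w ≠ 0 → DifferentiableAt ℝ φ w := by
    intro w hw
    have h1 : φ = fun w => ((‖w‖ ^ 2) ^ (2 * m))⁻¹ := by
      ext w
      rw [← pow_mul, show 2 * (2 * m) = 4 * m by ring]
    rw [h1]
    refine DifferentiableAt.inv (((differentiableAt_id.norm_sq ℝ)).pow _) ?_
    have := norm_pos_iff.2 hw
    positivity
  set F' : Euc (m + 1) → Euc (m + 1) →L[ℝ] F := fun y => (fderiv ℝ φ (x - y)).smulRight (f y)
  have hs : closedBall x ((1 - ‖x‖) / 4) ∈ 𝓝 x := closedBall_mem_nhds x (by linarith)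
  have hi : ∀ w : Euc (m + 1), ‖w‖ < 1 →
      Integrable (fun y => bdKernel m w y • f y) (sphMeasure m) := by
    intro w hw
    refine hf.bdd_smul ((1 - ‖w‖) ^ (4 * m))⁻¹
      (measurable_bdKernel_right w).aestronglyMeasurable ?_
    filter_upwards [ae_sphMeasure_norm m] with y hy
    rw [Real.norm_eq_abs, abs_of_nonneg (bdKernel_nonneg w y)]
    exact bdKernel_le hw hy
  refine (hasFDerivAt_integral_of_dominated_loc_of_lip' (F' := F') hs
    (bound := fun y => (4 * m * 2 ^ (4 * m) * 2 * (1 - ‖x‖)⁻¹) * ‖bdKernel m x y • f y‖)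
    ?_ (hi x hx) ?_ ?_ ((hi x hx).norm.const_mul _) ?_).2.differentiableAt
  · intro w hw
    rw [mem_closedBall, dist_eq_norm] at hw
    exact (hi w (norm_lt_one_of_near hx hw)).aestronglyMeasurable
  · have h1 : AEStronglyMeasurable (fun y => fderiv ℝ φ (x - y)) (sphMeasure m) :=
      ((measurable_fderiv ℝ φ).comp (by fun_prop)).aestronglyMeasurable
    exact (ContinuousLinearMap.smulRightL ℝ (Euc (m + 1)) F).aestronglyMeasurable_comp₂ h1
      hf.aestronglyMeasurable
  · filter_upwards [ae_sphMeasure_norm m] with y hy w hw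
    rw [mem_closedBall, dist_eq_norm] at hw
    rw [← sub_smul, norm_smul, norm_smul, Real.norm_eq_abs, Real.norm_eq_abs,
      abs_of_nonneg (bdKernel_nonneg x y)]
    calc _ ≤ (4 * m * 2 ^ (4 * m) * 2 * (‖w - x‖ / (1 - ‖x‖)) * bdKernel m x y) * ‖f y‖ := by
          gcongr
          exact abs_bdKernel_sub_le hx hy hw
      _ = _ := by ring
  · filter_upwards [ae_sphMeasure_norm m] with y hy
    have h1 : x - y ≠ 0 := norm_pos_iff.1 (norm_sub_pos_of_norm_lt_one hx hy)
    have h2 : HasFDerivAt (fun w => φ (w - y)) (fderiv ℝ φ (x - y)) x := by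
      have := (hφd _ h1).hasFDerivAt.comp x ((hasFDerivAt_id x).sub_const y)
      exact this
    exact h2.smul_const (f y)

lemma differentiableAt_bdExt (hu : Measurable u) (hD : ∀ y z, ‖u y - u z‖ ≤ D) (hx : ‖x‖ < 1) :
    DifferentiableAt ℝ (bdExt u) x := by
  have h1 := differentiableAt_integral_bdKernel (m := m)
    (integrable_of_osc (μ := sphMeasure m) hu hD) hx
  have h2 := differentiableAt_integral_bdKernel (m := m) (f := fun _ => (1 : ℝ))
    (integrable_const _) hx
  simp only [smul_eq_mul, mul_one] at h2
  have h3 : DifferentiableAt ℝ (fun w => (bdMass m w)⁻¹ •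
      ∫ y, bdKernel m w y • u y ∂(sphMeasure m)) x :=
    (h2.inv (bdMass_pos hx).ne').smul h1
  refine h3.congr_of_eventuallyEq ?_
  have : ball (0 : Euc (m + 1)) 1 ∈ 𝓝 x := isOpen_ball.mem_nhds (by simpa using hx)
  filter_upwards [this] with w hw
  exact integral_bdProb (by simpa using hw) u

lemma norm_fderiv_bdExt_le (hu : Measurable u) (hD : ∀ y z, ‖u y - u z‖ ≤ D) (hx : ‖x‖ < 1) :
    ‖fderiv ℝ (bdExt u) x‖ ≤ 4 * m * 2 ^ (8 * m) * 2 * bdOsc u x / (1 - ‖x‖) := by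
  have hl := sub_pos.2 hx
  have h6 := bdOsc_nonneg (u := u) x
  refine (differentiableAt_bdExt hu hD hx).hasFDerivAt.le_of_lip' (by positivity) ?_
  have hs : closedBall x ((1 - ‖x‖) / 4) ∈ 𝓝 x := closedBall_mem_nhds x (by linarith)
  filter_upwards [hs] with w hw
  rw [mem_closedBall, dist_eq_norm] at hw
  refine (norm_bdExt_sub_bdExt_le hu hD hx hw).trans (le_of_eq ?_)
  ring

lemma exists_bdOsc_pow_le (m ν : ℕ) : ∃ C : ℝ, 0 < C ∧ ∀ (u : Euc (m + 1) → Euc ν) (D : ℝ),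
    Measurable u → (∀ y z, ‖u y - u z‖ ≤ D) → ∀ x : Euc (m + 1), ‖x‖ < 1 →
      ENNReal.ofReal (bdOsc u x ^ (m + 1)) ≤ ENNReal.ofReal C *
        doubleAverage m (fun p => ENNReal.ofReal (dist (u p.1) (u p.2) ^ (m + 1))) x := by
  obtain ⟨C, hC, h⟩ := exists_lintegral_lintegral_bdProb_le m
  refine ⟨C, hC, fun u D hu hD x hx => ?_⟩
  have hP := isProbabilityMeasure_bdProb (m := m) hx
  have hm1 : Measurable fun p : Euc (m + 1) × Euc (m + 1) =>
      ENNReal.ofReal (dist (u p.1) (u p.2) ^ (m + 1)) := by fun_prop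
  refine le_trans ?_ (h x hx _ hm1)
  have hm2 : Measurable fun p : Euc (m + 1) × Euc (m + 1) => ‖u p.1 - u p.2‖ := by fun_prop
  have hi : Integrable (fun p : Euc (m + 1) × Euc (m + 1) => ‖u p.1 - u p.2‖)
      ((bdProb m x).prod (bdProb m x)) :=
    Integrable.of_bound hm2.aestronglyMeasurable D (Eventually.of_forall fun p => by
      rw [norm_norm]; exact hD _ _)
  have hi2 : Integrable (fun p : Euc (m + 1) × Euc (m + 1) => ‖u p.1 - u p.2‖ ^ (m + 1))
      ((bdProb m x).prod (bdProb m x)) :=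
    Integrable.of_bound (hm2.pow_const _).aestronglyMeasurable (D ^ (m + 1))
      (Eventually.of_forall fun p => by
        rw [norm_pow, norm_norm]; gcongr; exact hD _ _)
  have h1 : bdOsc u x ≤ ∫ p, ‖u p.1 - u p.2‖ ∂((bdProb m x).prod (bdProb m x)) := by
    rw [integral_prod _ hi]
    refine integral_mono ((integrable_of_osc hu hD).sub (integrable_const _)).norm
      hi.integral_prod_left fun y => ?_
    rw [norm_sub_rev]
    refine (norm_bdExt_sub_le hu hD hx _).trans (le_of_eq ?_)
    simp only [norm_sub_rev]
  have h2 : (∫ p, ‖u p.1 - u p.2‖ ∂((bdProb m x).prod (bdProb m x))) ^ (m + 1) ≤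
      ∫ p, ‖u p.1 - u p.2‖ ^ (m + 1) ∂((bdProb m x).prod (bdProb m x)) :=
    (convexOn_pow (m + 1)).map_integral_le (continuous_pow _).continuousOn isClosed_Ici
      (Eventually.of_forall fun p => norm_nonneg _) hi hi2
  calc ENNReal.ofReal (bdOsc u x ^ (m + 1)) ≤ ENNReal.ofReal
        (∫ p, ‖u p.1 - u p.2‖ ^ (m + 1) ∂((bdProb m x).prod (bdProb m x))) := by
        refine ENNReal.ofReal_le_ofReal (le_trans ?_ h2)
        have := bdOsc_nonneg (u := u) x
        gcongr
    _ = ∫⁻ p, ENNReal.ofReal (dist (u p.1) (u p.2) ^ (m + 1))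
        ∂((bdProb m x).prod (bdProb m x)) := by
        rw [ofReal_integral_eq_lintegral_ofReal hi2
          (Eventually.of_forall fun p => by positivity)]
        simp only [dist_eq_norm]
    _ = _ := lintegral_prod _ hm1.aemeasurable
    _ ≤ _ := le_rfl

end Average

section BadPoints

/-- The gap potential with respect to the surface measure. -/
def sphGap {m ν : ℕ} (δ : ℝ) (u : Euc (m + 1) → Euc ν) : ℝ≥0∞ :=
  ∫⁻ y, ∫⁻ z, (if δ ≤ dist (u y) (u z) then (1 : ℝ≥0∞) else 0) / ENNReal.ofReal (dist y z ^ (2 * m))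
    ∂(sphMeasure m) ∂(sphMeasure m)

/-- The Gagliardo energy with respect to the surface measure. -/
def sphEnergy {m ν : ℕ} (u : Euc (m + 1) → Euc ν) : ℝ≥0∞ :=
  ∫⁻ y, ∫⁻ z, ENNReal.ofReal (dist (u y) (u z) ^ (m + 1)) / ENNReal.ofReal (dist y z ^ (2 * m))
    ∂(sphMeasure m) ∂(sphMeasure m)

variable {m ν : ℕ}

lemma sphGap_le_sphEnergy {δ : ℝ} (hδ : 0 < δ) {u : Euc (m + 1) → Euc ν} (hu : Measurable u) :
    sphGap δ u ≤ ENNReal.ofReal (δ ^ (m + 1))⁻¹ * sphEnergy u := by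
  unfold sphGap sphEnergy
  have h1 : Measurable fun p : Euc (m + 1) × Euc (m + 1) =>
      ENNReal.ofReal (dist (u p.1) (u p.2) ^ (m + 1)) / ENNReal.ofReal (dist p.1 p.2 ^ (2 * m)) := by
    fun_prop
  rw [← lintegral_const_mul _ h1.lintegral_prod_right']
  refine lintegral_mono fun y => ?_
  have h2 : Measurable fun z : Euc (m + 1) =>
      ENNReal.ofReal (dist (u y) (u z) ^ (m + 1)) / ENNReal.ofReal (dist y z ^ (2 * m)) := by
    fun_prop
  rw [← lintegral_const_mul _ h2]
  refine lintegral_mono fun z => ?_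
  rw [← mul_div_assoc, ← ENNReal.ofReal_mul (by positivity)]
  gcongr
  split_ifs with h
  · rw [← ENNReal.ofReal_one, inv_mul_eq_div]
    refine ENNReal.ofReal_le_ofReal ((one_le_div (by positivity)).2 ?_)
    gcongr
  · exact zero_le

lemma exists_le_doubleAverage_gap (m ν : ℕ) : ∃ C : ℝ, 0 < C ∧
    ∀ (u : Euc (m + 1) → Euc ν) (N : Set (Euc ν)) (D ρ : ℝ), Measurable u →
      (∀ y z, ‖u y - u z‖ ≤ D) → 0 < D → 0 < ρ → (∀ y, u y ∈ N) →
      ∀ x : Euc (m + 1), ‖x‖ < 1 → ρ / 2 ≤ infDist (bdExt u x) N →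
      ENNReal.ofReal (ρ / (4 * D)) ≤ ENNReal.ofReal C *
        doubleAverage m (fun p => if ρ / 4 ≤ dist (u p.1) (u p.2) then 1 else 0) x := by
  obtain ⟨C, hC, h⟩ := exists_lintegral_lintegral_bdProb_le m
  refine ⟨C, hC, fun u N D ρ hu hD hD0 hρ huN x hx hbad => ?_⟩
  have hP := isProbabilityMeasure_bdProb (m := m) hx
  have hs : MeasurableSet {p : Euc (m + 1) × Euc (m + 1) | ρ / 4 ≤ dist (u p.1) (u p.2)} :=
    measurableSet_le measurable_const (by fun_prop)
  refine le_trans ?_ (h x hx _ (Measurable.ite hs measurable_const measurable_const))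
  have key : ∀ y, ENNReal.ofReal (ρ / (4 * D)) ≤
      ∫⁻ z, (if ρ / 4 ≤ dist (u y) (u z) then (1 : ℝ≥0∞) else 0) ∂(bdProb m x) := by
    intro y
    set s : Set (Euc (m + 1)) := {z | ρ / 4 ≤ dist (u y) (u z)} with hs'
    have hsm : MeasurableSet s := measurableSet_le measurable_const (by fun_prop)
    have e1 : ∫⁻ z, (if ρ / 4 ≤ dist (u y) (u z) then (1 : ℝ≥0∞) else 0) ∂(bdProb m x) =
        bdProb m x s := by
      rw [← lintegral_indicator_one hsm]
      refine lintegral_congr fun z => ?_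
      simp [indicator, hs']
    rw [e1, ENNReal.ofReal_le_iff_le_toReal (measure_ne_top _ _), ← Measure.real]
    have h1 : ρ / 2 ≤ ‖bdExt u x - u y‖ := by
      rw [← dist_eq_norm]
      exact hbad.trans (infDist_le_dist_of_mem (huN y))
    have h2 : ∫ z, ‖u z - u y‖ ∂(bdProb m x) ≤
        ∫ z, (ρ / 4 + s.indicator (fun _ => D) z) ∂(bdProb m x) := by
      refine integral_mono ((integrable_of_osc hu hD).sub (integrable_const _)).norm
        ((integrable_const _).add ((integrable_const _).indicator hsm)) fun z => ?_
      simp only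
      by_cases hz : z ∈ s
      · rw [indicator_of_mem hz]
        linarith [hD z y]
      · rw [indicator_of_notMem hz, add_zero, norm_sub_rev, ← dist_eq_norm]
        exact (not_le.1 hz).le
    rw [integral_add (integrable_const _) ((integrable_const _).indicator hsm),
      integral_indicator_const _ hsm] at h2
    simp only [integral_const, probReal_univ, smul_eq_mul] at h2
    have h3 := norm_bdExt_sub_le hu hD hx (u y)
    rw [div_le_iff₀ (by positivity)]
    linarith
  calc ENNReal.ofReal (ρ / (4 * D)) = ∫⁻ _, ENNReal.ofReal (ρ / (4 * D)) ∂(bdProb m x) := by simp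
    _ ≤ _ := lintegral_mono key

lemma doubleAverage_near_le {f : Euc (m + 1) × Euc (m + 1) → ℝ≥0∞}
    (hf : Measurable f) {x x' : Euc (m + 1)}
    (hx : ‖x‖ < 1) (h : ‖x' - x‖ ≤ (1 - ‖x‖) / 4) :
    doubleAverage m f x ≤ ENNReal.ofReal (2 ^ (14 * m)) * doubleAverage m f x' := by
  have h1 : Measurable fun p : Euc (m + 1) × Euc (m + 1) => f (p.1, p.2) *
      ENNReal.ofReal (bdPoisson m x' p.1 * bdPoisson m x' p.2) := by
    unfold bdPoisson bdKernel
    fun_prop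
  unfold doubleAverage
  rw [← lintegral_const_mul _ h1.lintegral_prod_right']
  refine lintegral_mono_ae ?_
  filter_upwards [ae_sphMeasure_norm m] with y hy
  have h2 : Measurable fun z => f (y, z) *
      ENNReal.ofReal (bdPoisson m x' y * bdPoisson m x' z) := by
    unfold bdPoisson bdKernel
    fun_prop
  rw [← lintegral_const_mul _ h2]
  refine lintegral_mono_ae ?_
  filter_upwards [ae_sphMeasure_norm m] with z hz
  have hx' := norm_lt_one_of_near hx h
  rw [mul_left_comm, ← ENNReal.ofReal_mul (by positivity)]
  refine mul_le_mul_right (ENNReal.ofReal_le_ofReal ?_) _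
  have := bdPoisson_nonneg (m := m) hx y
  have := bdPoisson_nonneg (m := m) hx z
  have := bdPoisson_nonneg (m := m) hx' y
  calc bdPoisson m x y * bdPoisson m x z
      ≤ (2 ^ (7 * m) * bdPoisson m x' y) * (2 ^ (7 * m) * bdPoisson m x' z) := by
        gcongr
        · exact bdPoisson_near_le hx hy h
        · exact bdPoisson_near_le hx hz h
    _ = _ := by
        rw [show 14 * m = 7 * m + 7 * m by ring, pow_add]
        ring

lemma exists_card_mul_le_lintegral (hm : 1 ≤ m) : ∃ C : ℝ, 0 < C ∧
    ∀ f : Euc (m + 1) × Euc (m + 1) → ℝ≥0∞, Measurable f → (∀ y, f (y, y) = 0) →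
    ∀ (c : ℝ≥0∞) (F : Finset (Euc (m + 1))), (∀ x ∈ F, ‖x‖ < 1) →
      (F : Set (Euc (m + 1))).PairwiseDisjoint (fun x => ball x ((1 - ‖x‖) / 8)) →
      (∀ x ∈ F, c ≤ doubleAverage m f x) →
      (F.card : ℝ≥0∞) * c ≤ ENNReal.ofReal C *
        ∫⁻ y, ∫⁻ z, f (y, z) / ENNReal.ofReal (dist y z ^ (2 * m))
          ∂(sphMeasure m) ∂(sphMeasure m) := by
  obtain ⟨C, hC, h⟩ := exists_lintegral_doubleAverage_le hm
  set ω := (volume : Measure (Euc (m + 1))).real (ball 0 1) with hω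
  have hω0 : 0 < ω := by
    rw [hω]
    exact ENNReal.toReal_pos (measure_ball_pos _ _ one_pos).ne' measure_ball_lt_top.ne
  refine ⟨16 ^ (m + 1) * ω⁻¹ * 2 ^ (14 * m) * C, by positivity, fun f hf hf0 c F hF hdisj hc => ?_⟩
  have key : ∀ x ∈ F, c ≤ ENNReal.ofReal (16 ^ (m + 1) * ω⁻¹ * 2 ^ (14 * m)) *
      ∫⁻ w in ball x ((1 - ‖x‖) / 8),
        ENNReal.ofReal ((1 - ‖w‖) ^ (m + 1))⁻¹ * doubleAverage m f w := by
    intro x hxF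
    have hx := hF x hxF
    have hl := sub_pos.2 hx
    have h1 : ∫⁻ w in ball x ((1 - ‖x‖) / 8), ENNReal.ofReal ((2 * (1 - ‖x‖)) ^ (m + 1))⁻¹ * c ≤
        ∫⁻ w in ball x ((1 - ‖x‖) / 8), ENNReal.ofReal ((1 - ‖w‖) ^ (m + 1))⁻¹ *
          (ENNReal.ofReal (2 ^ (14 * m)) * doubleAverage m f w) := by
      refine setLIntegral_mono ((by fun_prop : Measurable fun w : Euc (m + 1) =>
        ENNReal.ofReal ((1 - ‖w‖) ^ (m + 1))⁻¹).mul
        ((measurable_doubleAverage hf).const_mul _)) fun w hw => ?_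
      rw [mem_ball, dist_eq_norm] at hw
      have hw1 : ‖w‖ < 1 := norm_lt_one_of_near hx (by linarith)
      have hlw := sub_pos.2 hw1
      have h2 := norm_sub_norm_le x w
      rw [norm_sub_rev] at h2
      refine mul_le_mul' (ENNReal.ofReal_le_ofReal ?_)
        ((hc x hxF).trans (doubleAverage_near_le hf hx (by linarith)))
      gcongr
      linarith
    rw [setLIntegral_const, Measure.addHaar_ball volume _ (by positivity : 0 ≤ (1 - ‖x‖) / 8),
      finrank_euclideanSpace, Fintype.card_fin,
      ← ENNReal.ofReal_toReal (measure_ball_lt_top (x := (0 : Euc (m + 1))) (r := 1)).ne,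
      ← Measure.real, ← hω, ← ENNReal.ofReal_mul (by positivity), mul_right_comm,
      ← ENNReal.ofReal_mul (by positivity)] at h1
    have h3 : ((2 * (1 - ‖x‖)) ^ (m + 1))⁻¹ * (((1 - ‖x‖) / 8) ^ (m + 1) * ω) =
        (16 ^ (m + 1))⁻¹ * ω := by
      rw [div_pow, mul_pow, show (16 : ℝ) = 2 * 8 by norm_num, mul_pow]
      field_simp
    rw [h3] at h1
    calc c = ENNReal.ofReal (16 ^ (m + 1) * ω⁻¹) *
          (ENNReal.ofReal ((16 ^ (m + 1))⁻¹ * ω) * c) := by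
          rw [← mul_assoc, ← ENNReal.ofReal_mul (by positivity)]
          have : (16 : ℝ) ^ (m + 1) * ω⁻¹ * ((16 ^ (m + 1))⁻¹ * ω) = 1 := by field_simp
          rw [this, ENNReal.ofReal_one, one_mul]
      _ ≤ ENNReal.ofReal (16 ^ (m + 1) * ω⁻¹) * _ := mul_le_mul_right h1 _
      _ = _ := by
          have hmeas : Measurable fun w : Euc (m + 1) =>
              ENNReal.ofReal ((1 - ‖w‖) ^ (m + 1))⁻¹ * doubleAverage m f w :=
            (by fun_prop : Measurable fun w : Euc (m + 1) =>
              ENNReal.ofReal ((1 - ‖w‖) ^ (m + 1))⁻¹).mul (measurable_doubleAverage hf)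
          simp_rw [mul_left_comm _ (ENNReal.ofReal (2 ^ (14 * m)))]
          rw [lintegral_const_mul _ hmeas, ← mul_assoc, ← ENNReal.ofReal_mul (by positivity)]
  calc (F.card : ℝ≥0∞) * c = ∑ _x ∈ F, c := by rw [Finset.sum_const, nsmul_eq_mul]
    _ ≤ ∑ x ∈ F, ENNReal.ofReal (16 ^ (m + 1) * ω⁻¹ * 2 ^ (14 * m)) *
        ∫⁻ w in ball x ((1 - ‖x‖) / 8),
          ENNReal.ofReal ((1 - ‖w‖) ^ (m + 1))⁻¹ * doubleAverage m f w := Finset.sum_le_sum key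
    _ = ENNReal.ofReal (16 ^ (m + 1) * ω⁻¹ * 2 ^ (14 * m)) *
        ∫⁻ w in ⋃ x ∈ F, ball x ((1 - ‖x‖) / 8),
          ENNReal.ofReal ((1 - ‖w‖) ^ (m + 1))⁻¹ * doubleAverage m f w := by
        rw [← Finset.mul_sum, lintegral_biUnion_finset hdisj fun _ _ => measurableSet_ball]
    _ ≤ ENNReal.ofReal (16 ^ (m + 1) * ω⁻¹ * 2 ^ (14 * m)) *
        ∫⁻ w in ball (0 : Euc (m + 1)) 1,
          ENNReal.ofReal ((1 - ‖w‖) ^ (m + 1))⁻¹ * doubleAverage m f w := by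
        refine mul_le_mul_right (lintegral_mono_set (iUnion₂_subset fun x hx w hw => ?_)) _
        rw [mem_ball, dist_eq_norm] at hw
        have := sub_pos.2 (hF x hx)
        simpa using norm_lt_one_of_near (hF x hx) (by linarith : ‖w - x‖ ≤ _)
    _ ≤ _ := by
        refine (mul_le_mul_right (h f hf hf0) _).trans (le_of_eq ?_)
        rw [← mul_assoc, ← ENNReal.ofReal_mul (by positivity)]

lemma exists_bad_centers (hm : 1 ≤ m) (ν : ℕ) {D ρ : ℝ} (hD0 : 0 < D) (hρ : 0 < ρ) :
    ∃ C : ℝ, 0 < C ∧ ∀ (u : Euc (m + 1) → Euc ν) (N : Set (Euc ν)), Measurable u →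
      (∀ y z, ‖u y - u z‖ ≤ D) → (∀ y, u y ∈ N) → sphGap (ρ / 4) u ≠ ⊤ →
      ∃ F : Finset (Euc (m + 1)), (∀ x ∈ F, ‖x‖ < 1) ∧
        (F.card : ℝ≥0∞) ≤ ENNReal.ofReal C * sphGap (ρ / 4) u ∧
        ∀ x, ‖x‖ < 1 → ρ / 2 ≤ infDist (bdExt u x) N → ∃ p ∈ F, hypDist x p < 1 := by
  classical
  obtain ⟨C₁, hC₁, h₁⟩ := exists_le_doubleAverage_gap m ν
  obtain ⟨C₂, hC₂, h₂⟩ := exists_card_mul_le_lintegral hm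
  set κ := C₁⁻¹ * (ρ / (4 * D)) with hκ
  have hκ0 : 0 < κ := by positivity
  refine ⟨κ⁻¹ * C₂, by positivity, fun u N hu hD huN hG => ?_⟩
  set f : Euc (m + 1) × Euc (m + 1) → ℝ≥0∞ :=
    fun p => if ρ / 4 ≤ dist (u p.1) (u p.2) then 1 else 0 with hf
  have hfm : Measurable f := by
    have hs : MeasurableSet {p : Euc (m + 1) × Euc (m + 1) | ρ / 4 ≤ dist (u p.1) (u p.2)} :=
      measurableSet_le measurable_const (by fun_prop)
    exact Measurable.ite hs measurable_const measurable_const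
  have hf0 : ∀ y, f (y, y) = 0 := by
    intro y
    simp only [hf, dist_self]
    rw [if_neg (by linarith)]
  have hbadf : ∀ x : Euc (m + 1), ‖x‖ < 1 → ρ / 2 ≤ infDist (bdExt u x) N →
      ENNReal.ofReal κ ≤ doubleAverage m f x := by
    intro x hx hb
    have h3 := mul_le_mul_right (h₁ u N D ρ hu hD hD0 hρ huN x hx hb) (ENNReal.ofReal C₁⁻¹)
    rwa [← ENNReal.ofReal_mul (by positivity), ← mul_assoc, ← ENNReal.ofReal_mul (by positivity),
      inv_mul_cancel₀ hC₁.ne', ENNReal.ofReal_one, one_mul] at h3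
  set adm : Finset (Euc (m + 1)) → Prop := fun F =>
    (∀ x ∈ F, ‖x‖ < 1 ∧ ρ / 2 ≤ infDist (bdExt u x) N) ∧
      (F : Set (Euc (m + 1))).PairwiseDisjoint (fun x => ball x ((1 - ‖x‖) / 8)) with hadm
  have hcard : ∀ F, adm F → (F.card : ℝ≥0∞) ≤ ENNReal.ofReal (κ⁻¹ * C₂) * sphGap (ρ / 4) u := by
    intro F hF
    have h3 := h₂ f hfm hf0 (ENNReal.ofReal κ) F (fun x hx => (hF.1 x hx).1) hF.2
      fun x hx => hbadf x (hF.1 x hx).1 (hF.1 x hx).2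
    have h4 := mul_le_mul_right h3 (ENNReal.ofReal κ⁻¹)
    rwa [mul_left_comm, ← ENNReal.ofReal_mul (by positivity), inv_mul_cancel₀ hκ0.ne',
      ENNReal.ofReal_one, mul_one, ← mul_assoc, ← ENNReal.ofReal_mul (by positivity)] at h4
  have hbdd : BddAbove {n : ℕ | ∃ F, adm F ∧ F.card = n} := by
    refine ⟨⌊(ENNReal.ofReal (κ⁻¹ * C₂) * sphGap (ρ / 4) u).toReal⌋₊, ?_⟩
    rintro n ⟨F, hF, rfl⟩
    refine Nat.le_floor ?_
    have := ENNReal.toReal_mono (ENNReal.mul_ne_top ENNReal.ofReal_ne_top hG) (hcard F hF)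
    simpa using this
  obtain ⟨F, hF, hFc⟩ := Nat.sSup_mem (s := {n : ℕ | ∃ F, adm F ∧ F.card = n})
    ⟨0, ∅, ⟨by simp, by simp⟩, rfl⟩ hbdd
  refine ⟨F, fun x hx => (hF.1 x hx).1, hcard F hF, fun x hx hbad => ?_⟩
  by_contra! hno
  have hdis : ∀ p ∈ F, Disjoint (ball x ((1 - ‖x‖) / 8)) (ball p ((1 - ‖p‖) / 8)) := by
    intro p hp
    rw [Set.disjoint_left]
    intro w hwx hwp
    refine absurd (hypDist_lt_one_of_whitney hx (hF.1 p hp).1 ?_) (not_lt.2 (hno p hp))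
    rw [mem_ball] at hwx hwp
    rw [← dist_eq_norm]
    have := dist_triangle_left x p w
    linarith
  have hxF : x ∉ F := by
    intro hxF
    have := Set.disjoint_left.1 (hdis x hxF) (mem_ball_self (by linarith))
    exact this (mem_ball_self (by linarith))
  have hins : adm (insert x F) := by
    refine ⟨fun w hw => ?_, ?_⟩
    · rcases Finset.mem_insert.1 hw with rfl | hw
      · exact ⟨hx, hbad⟩
      · exact hF.1 w hw
    · rw [Finset.coe_insert]
      exact hF.2.insert fun p hp _ => hdis p hp
  have h5 := le_csSup hbdd ⟨insert x F, hins, rfl⟩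
  rw [Finset.card_insert_of_notMem hxF, ← hFc] at h5
  omega

end BadPoints

section Filling

variable {E : Type*} [NormedAddCommGroup E] [InnerProductSpace ℝ E]

/-- The radial retraction of the exterior of the centre `c` onto the sphere of radius `r`. -/
def radialProj (c : E) (r : ℝ) (x : E) : E := c + (r / ‖x - c‖) • (x - c)

theorem norm_radialProj_sub {c x : E} {r : ℝ} (hr : 0 ≤ r) (hx : x ≠ c) :
    ‖radialProj c r x - c‖ = r := by
  have : 0 < ‖x - c‖ := norm_pos_iff.2 (sub_ne_zero.2 hx)
  rw [radialProj, add_sub_cancel_left, norm_smul, Real.norm_of_nonneg (by positivity),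
    div_mul_cancel₀ _ this.ne']

theorem differentiableAt_radialProj {c x : E} (r : ℝ) (hx : x ≠ c) :
    DifferentiableAt ℝ (radialProj c r) x := by
  have h : x - c ≠ 0 := sub_ne_zero.2 hx
  have h1 : DifferentiableAt ℝ (fun y : E => ‖y - c‖) x :=
    (differentiableAt_id.sub_const c).norm ℝ h
  have h2 : DifferentiableAt ℝ (fun y : E => r / ‖y - c‖) x :=
    (h1.inv (norm_ne_zero_iff.2 h)).const_mul r
  exact (h2.smul (differentiableAt_id.sub_const c)).const_add c

theorem norm_radialProj_sub_le {c x y : E} {r : ℝ} (hr : 0 ≤ r) (hx : x ≠ c) (hy : y ≠ c) :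
    ‖radialProj c r y - radialProj c r x‖ ≤ 2 * r / ‖x - c‖ * ‖y - x‖ := by
  have hx0 : 0 < ‖x - c‖ := norm_pos_iff.2 (sub_ne_zero.2 hx)
  have hy0 : 0 < ‖y - c‖ := norm_pos_iff.2 (sub_ne_zero.2 hy)
  have h1 : radialProj c r y - radialProj c r x
      = (r / ‖x - c‖) • ((y - x) + ((‖x - c‖ - ‖y - c‖) / ‖y - c‖) • (y - c)) := by
    have h2 : r / ‖y - c‖ = r / ‖x - c‖ * (1 + (‖x - c‖ - ‖y - c‖) / ‖y - c‖) := by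
      field_simp; ring
    rw [radialProj, radialProj, h2]
    module
  rw [h1, norm_smul, Real.norm_of_nonneg (by positivity)]
  have h3 : ‖((‖x - c‖ - ‖y - c‖) / ‖y - c‖) • (y - c)‖ ≤ ‖y - x‖ := by
    rw [norm_smul, norm_div, norm_norm, div_mul_cancel₀ _ hy0.ne']
    have := abs_norm_sub_norm_le (x - c) (y - c)
    rwa [sub_sub_sub_cancel_right, norm_sub_rev x y] at this
  have h4 := norm_add_le (y - x) (((‖x - c‖ - ‖y - c‖) / ‖y - c‖) • (y - c))
  calc _ ≤ r / ‖x - c‖ * (2 * ‖y - x‖) := by gcongr; linarith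
    _ = _ := by ring

theorem norm_fderiv_radialProj_le {c x : E} {r : ℝ} (hr : 0 ≤ r) (hx : x ≠ c) :
    ‖fderiv ℝ (radialProj c r) x‖ ≤ 2 * r / ‖x - c‖ := by
  refine (differentiableAt_radialProj r hx).hasFDerivAt.le_of_lip' (by positivity) ?_
  filter_upwards [isOpen_ne.mem_nhds hx] with y hy
  exact norm_radialProj_sub_le hr hx hy

open Classical in
/-- The map that pushes the points of the closed balls of the family `Q` radially to their
boundary, and fixes the other points. -/
def pushOut (Q : Finset (E × ℝ)) (x : E) : E :=
  if h : ∃ q ∈ Q, x ∈ closedBall q.1 q.2 then radialProj h.choose.1 h.choose.2 x else x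

/-- A family of closed balls of the open unit ball that are pairwise disjoint. -/
structure DisjointBalls (Q : Finset (E × ℝ)) : Prop where
  pos : ∀ q ∈ Q, 0 < q.2
  lt : ∀ q ∈ Q, q.2 < 1 - ‖q.1‖
  disj : ∀ q ∈ Q, ∀ p ∈ Q, q ≠ p → Disjoint (closedBall q.1 q.2) (closedBall p.1 p.2)

variable {Q : Finset (E × ℝ)}

theorem pushOut_of_forall_notMem {x : E} (hx : ∀ q ∈ Q, x ∉ closedBall q.1 q.2) :
    pushOut Q x = x := by
  rw [pushOut, dif_neg]
  rintro ⟨q, hq, h⟩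
  exact hx q hq h

theorem DisjointBalls.pushOut_of_mem (hQ : DisjointBalls Q) {q : E × ℝ} (hq : q ∈ Q) {x : E}
    (hx : x ∈ closedBall q.1 q.2) : pushOut Q x = radialProj q.1 q.2 x := by
  have h : ∃ q ∈ Q, x ∈ closedBall q.1 q.2 := ⟨q, hq, hx⟩
  rw [pushOut, dif_pos h]
  have : h.choose = q := by
    by_contra hne
    exact Set.disjoint_left.1 (hQ.disj _ h.choose_spec.1 _ hq hne) h.choose_spec.2 hx
  rw [this]

/-- The points of the unit ball outside of the open balls of the family. -/
def outerRegion (Q : Finset (E × ℝ)) : Set E :=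
  {x | ‖x‖ < 1 ∧ ∀ q ∈ Q, x ∉ ball q.1 q.2}

omit [InnerProductSpace ℝ E] in
theorem DisjointBalls.sphere_subset (hQ : DisjointBalls Q) {q : E × ℝ} (hq : q ∈ Q) {x : E}
    (hx : ‖x - q.1‖ = q.2) : x ∈ outerRegion Q := by
  refine ⟨?_, fun p hp hxp => ?_⟩
  · have := norm_add_le (x - q.1) q.1
    rw [sub_add_cancel] at this
    linarith [hQ.lt q hq]
  · have hxq : x ∈ closedBall q.1 q.2 := by rw [mem_closedBall, dist_eq_norm, hx]
    by_cases hne : q = p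
    · subst hne
      rw [mem_ball, dist_eq_norm] at hxp
      linarith
    · exact Set.disjoint_left.1 (hQ.disj q hq p hp hne) hxq (ball_subset_closedBall hxp)

omit [InnerProductSpace ℝ E] in
theorem DisjointBalls.eventually_forall_ne_notMem (hQ : DisjointBalls Q) {q : E × ℝ}
    (hq : q ∈ Q) {x : E} (hx : x ∈ closedBall q.1 q.2) :
    ∀ᶠ y in 𝓝 x, ∀ p ∈ Q, p ≠ q → y ∉ closedBall p.1 p.2 := by
  rw [Filter.eventually_all_finset]
  intro p hp
  by_cases hne : p = q
  · simp [hne]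
  · have : x ∉ closedBall p.1 p.2 := Set.disjoint_left.1 (hQ.disj q hq p hp (Ne.symm hne)) hx
    filter_upwards [isClosed_closedBall.isOpen_compl.mem_nhds this] with y hy _ using hy

theorem eventually_pushOut_eq_self {x : E} (hx : ∀ q ∈ Q, x ∉ closedBall q.1 q.2) :
    pushOut Q =ᶠ[𝓝 x] id := by
  have : ∀ᶠ y in 𝓝 x, ∀ q ∈ Q, y ∉ closedBall q.1 q.2 := by
    rw [Filter.eventually_all_finset]
    intro q hq
    exact isClosed_closedBall.isOpen_compl.mem_nhds (hx q hq)
  filter_upwards [this] with y hy using pushOut_of_forall_notMem hy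

theorem DisjointBalls.eventually_pushOut_eq_radialProj (hQ : DisjointBalls Q) {q : E × ℝ}
    (hq : q ∈ Q) {x : E} (hx : x ∈ ball q.1 q.2) :
    pushOut Q =ᶠ[𝓝 x] radialProj q.1 q.2 := by
  filter_upwards [isOpen_ball.mem_nhds hx] with y hy
  exact hQ.pushOut_of_mem hq (ball_subset_closedBall hy)

theorem DisjointBalls.pushOut_mem_outerRegion (hQ : DisjointBalls Q) {x : E} (hx : ‖x‖ < 1)
    (hc : ∀ q ∈ Q, x ≠ q.1) : pushOut Q x ∈ outerRegion Q := by
  by_cases h : ∃ q ∈ Q, x ∈ closedBall q.1 q.2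
  · obtain ⟨q, hq, hxq⟩ := h
    rw [hQ.pushOut_of_mem hq hxq]
    exact hQ.sphere_subset hq (norm_radialProj_sub (hQ.pos q hq).le (hc q hq))
  · push Not at h
    rw [pushOut_of_forall_notMem h]
    exact ⟨hx, fun q hq hxq => h q hq (ball_subset_closedBall hxq)⟩

theorem DisjointBalls.continuousAt_pushOut (hQ : DisjointBalls Q) {x : E}
    (hc : ∀ q ∈ Q, x ≠ q.1) : ContinuousAt (pushOut Q) x := by
  by_cases h : ∃ q ∈ Q, x ∈ closedBall q.1 q.2
  · obtain ⟨q, hq, hxq⟩ := h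
    have hxc : x - q.1 ≠ 0 := sub_ne_zero.2 (hc q hq)
    have hcont : ContinuousAt (fun y : E => q.1 + max 1 (q.2 / ‖y - q.1‖) • (y - q.1)) x := by
      have h1 : ContinuousAt (fun y : E => q.2 / ‖y - q.1‖) x :=
        ContinuousAt.div (by fun_prop) (by fun_prop) (norm_ne_zero_iff.2 hxc)
      exact continuousAt_const.add ((continuousAt_const.max h1).smul
        (continuousAt_id.sub continuousAt_const))
    refine hcont.congr ?_
    filter_upwards [hQ.eventually_forall_ne_notMem hq hxq, isOpen_ne.mem_nhds (hc q hq)]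
      with y hy hyc
    have hy0 : 0 < ‖y - q.1‖ := norm_pos_iff.2 (sub_ne_zero.2 hyc)
    by_cases hyq : y ∈ closedBall q.1 q.2
    · rw [hQ.pushOut_of_mem hq hyq, radialProj, max_eq_right]
      rw [mem_closedBall, dist_eq_norm] at hyq
      rwa [one_le_div hy0]
    · rw [pushOut_of_forall_notMem, max_eq_left, one_smul, add_sub_cancel]
      · rw [mem_closedBall, dist_eq_norm, not_le] at hyq
        rw [div_le_one hy0]
        exact hyq.le
      · intro p hp
        by_cases hpq : p = q
        · rwa [hpq]
        · exact hy p hp hpq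
  · push Not at h
    exact continuousAt_id.congr (eventually_pushOut_eq_self h).symm

theorem comp_pushOut_eventuallyEq {G : Type*} (W : E → G) {x : E}
    (hx : ∀ q ∈ Q, x ∉ closedBall q.1 q.2) : W ∘ pushOut Q =ᶠ[𝓝 x] W :=
  (eventually_pushOut_eq_self hx).fun_comp W

variable {G : Type*} [NormedAddCommGroup G] [NormedSpace ℝ G] {W : E → G}

theorem DisjointBalls.continuousOn_comp_pushOut (hQ : DisjointBalls Q)
    (hW : ∀ x ∈ outerRegion Q, DifferentiableAt ℝ W x) :
    ContinuousOn (W ∘ pushOut Q) (ball 0 1 \ (Prod.fst '' (Q : Set (E × ℝ)))) := by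
  rintro x ⟨hx, hxS⟩
  have hc : ∀ q ∈ Q, x ≠ q.1 := fun q hq h => hxS ⟨q, hq, h.symm⟩
  rw [mem_ball_zero_iff] at hx
  exact ((hW _ (hQ.pushOut_mem_outerRegion hx hc)).continuousAt.comp
    (hQ.continuousAt_pushOut hc)).continuousWithinAt

theorem DisjointBalls.hasFDerivAt_comp_pushOut (hQ : DisjointBalls Q)
    (hW : ∀ x ∈ outerRegion Q, DifferentiableAt ℝ W x) {q : E × ℝ} (hq : q ∈ Q) {x : E}
    (hx : x ∈ ball q.1 q.2) (hxc : x ≠ q.1) :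
    HasFDerivAt (W ∘ pushOut Q) ((fderiv ℝ W (radialProj q.1 q.2 x)).comp
      (fderiv ℝ (radialProj q.1 q.2) x)) x := by
  have h1 := (hW _ (hQ.sphere_subset hq
    (norm_radialProj_sub (hQ.pos q hq).le hxc))).hasFDerivAt
  exact (h1.comp x (differentiableAt_radialProj q.2 hxc).hasFDerivAt).congr_of_eventuallyEq
    ((hQ.eventually_pushOut_eq_radialProj hq hx).fun_comp W)

theorem DisjointBalls.norm_fderiv_comp_pushOut_le (hQ : DisjointBalls Q)
    (hW : ∀ x ∈ outerRegion Q, DifferentiableAt ℝ W x) {K : ℝ} (hK : 0 ≤ K)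
    (hWK : ∀ x ∈ outerRegion Q, ‖fderiv ℝ W x‖ ≤ K / (1 - ‖x‖)) {q : E × ℝ} (hq : q ∈ Q) {x : E}
    (hx : x ∈ ball q.1 q.2) (hxc : x ≠ q.1) :
    ‖fderiv ℝ (W ∘ pushOut Q) x‖ ≤ K / (1 - ‖q.1‖ - q.2) * (2 * q.2 / ‖x - q.1‖) := by
  rw [(hQ.hasFDerivAt_comp_pushOut hW hq hx hxc).fderiv]
  have hn := norm_radialProj_sub (hQ.pos q hq).le hxc
  have h2 := norm_add_le (radialProj q.1 q.2 x - q.1) q.1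
  rw [sub_add_cancel, hn] at h2
  have h3 := hQ.lt q hq
  refine (ContinuousLinearMap.opNorm_comp_le _ _).trans ?_
  have h4 : K / (1 - ‖radialProj q.1 q.2 x‖) ≤ K / (1 - ‖q.1‖ - q.2) :=
    div_le_div_of_nonneg_left hK (by linarith) (by linarith)
  exact mul_le_mul ((hWK _ (hQ.sphere_subset hq hn)).trans h4)
    (norm_fderiv_radialProj_le (hQ.pos q hq).le hxc) (norm_nonneg _)
    (div_nonneg hK (by linarith))

end Filling

section Covering

variable {E : Type*} [NormedAddCommGroup E] [InnerProductSpace ℝ E]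

theorem exists_disjointBalls (F : Finset E) (hF : ∀ x ∈ F, ‖x‖ < 1) :
    ∃ Q : Finset (E × ℝ), DisjointBalls Q ∧ Q.card ≤ F.card ∧
      (∀ q ∈ Q, 1 - ‖q.1‖ ≤ Real.exp (4 * F.card) * (1 - ‖q.1‖ - q.2)) ∧
      ∀ x : E, ‖x‖ < 1 → (∃ p ∈ F, hypDist x p < 1) → ∃ q ∈ Q, x ∈ ball q.1 q.2 := by
  classical
  obtain ⟨T, hTF, hT, hTd, hTc⟩ := exists_disjoint_hypDist_balls F hF one_pos
  choose! c r hr hrc hexp hcb hb using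
    fun (p : E × ℝ) (hp : p ∈ T) => exists_ball_eq_hypDist_ball (hT p hp).1 (hT p hp).2.1
  have hin : ∀ p ∈ T, ∀ x ∈ closedBall (c p) (r p), ‖x‖ < 1 := by
    intro p hp x hx
    rw [mem_closedBall, dist_eq_norm] at hx
    have := norm_add_le (x - c p) (c p)
    rw [sub_add_cancel] at this
    linarith [hrc p hp]
  refine ⟨T.image fun p => (c p, r p), ⟨?_, ?_, ?_⟩, Finset.card_image_le.trans hTF, ?_, ?_⟩
  · simpa only [Finset.forall_mem_image] using hr
  · simpa only [Finset.forall_mem_image] using hrc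
  · simp only [Finset.forall_mem_image]
    intro p hp q hq hne
    rw [Set.disjoint_left]
    intro x hxp hxq
    have hx := hin p hp x hxp
    have h1 := (hcb p hp x hx).2 hxp
    have h2 := (hcb q hq x hx).2 hxq
    have h3 := hTd p hp q hq (by rintro rfl; exact hne rfl)
    have h4 := hypDist_triangle (hT p hp).1 hx (hT q hq).1
    rw [hypDist_comm p.1 x] at h4
    linarith
  · simp only [Finset.forall_mem_image]
    intro p hp
    refine (hexp p hp).trans ?_
    have h1 := hrc p hp
    have h2 := (hT p hp).2.2
    rw [mul_one] at h2
    gcongr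
  · rintro x hx ⟨p, hp, hxp⟩
    obtain ⟨q, hq, hpq⟩ := hTc p hp
    refine ⟨(c q, r q), Finset.mem_image_of_mem _ hq, (hb q hq x hx).1 ?_⟩
    have := hypDist_triangle hx (hF p hp) (hT q hq).1
    linarith

end Covering

section WeakType

variable {m ν : ℕ} {Q : Finset (Euc (m + 1) × ℝ)} {W : Euc (m + 1) → Euc ν}

theorem DisjointBalls.ae_differentiableAt_comp_pushOut (hQ : DisjointBalls Q)
    (hW : ∀ x ∈ outerRegion Q, DifferentiableAt ℝ W x) :
    ∀ᵐ x ∂(volume.restrict (ball (0 : Euc (m + 1)) 1)), DifferentiableAt ℝ (W ∘ pushOut Q) x := by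
  rw [ae_restrict_iff' measurableSet_ball]
  have h1 : ∀ᵐ x : Euc (m + 1), ∀ q ∈ Q, x ≠ q.1 ∧ x ∉ sphere q.1 q.2 := by
    rw [Filter.eventually_all_finset]
    intro q hq
    refine (Measure.ae_ne volume q.1).and ?_
    exact measure_eq_zero_iff_ae_notMem.1 (Measure.addHaar_sphere _ _ _)
  filter_upwards [h1] with x hx hx1
  by_cases h : ∃ q ∈ Q, x ∈ closedBall q.1 q.2
  · obtain ⟨q, hq, hxq⟩ := h
    have hxb : x ∈ ball q.1 q.2 := by
      rw [← ball_union_sphere] at hxq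
      exact hxq.resolve_right (hx q hq).2
    exact (hQ.hasFDerivAt_comp_pushOut hW hq hxb (hx q hq).1).differentiableAt
  · push Not at h
    refine (hW x ⟨by simpa using hx1, fun q hq hxq =>
      h q hq (ball_subset_closedBall hxq)⟩).congr_of_eventuallyEq (comp_pushOut_eventuallyEq W h)

theorem hyperbolic_density_le {x : Euc (m + 1)} {a : ℝ} (ha : 0 < a) (hx : a ≤ 1 - ‖x‖) :
    (2 / (1 - ‖x‖ ^ 2)) ^ (m + 1) ≤ (2 / a) ^ (m + 1) := by
  have h0 := norm_nonneg x
  have h1 : a ≤ 1 - ‖x‖ ^ 2 := by nlinarith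
  have h2 : 0 ≤ 2 / (1 - ‖x‖ ^ 2) := div_nonneg zero_le_two (ha.le.trans h1)
  gcongr

theorem DisjointBalls.setLIntegral_ball_le (hQ : DisjointBalls Q)
    (hW : ∀ x ∈ outerRegion Q, DifferentiableAt ℝ W x) {K : ℝ} (hK : 0 ≤ K)
    (hWK : ∀ x ∈ outerRegion Q, ‖fderiv ℝ W x‖ ≤ K / (1 - ‖x‖)) {M : ℝ} {q : Euc (m + 1) × ℝ}
    (hq : q ∈ Q) (hM : 1 - ‖q.1‖ ≤ M * (1 - ‖q.1‖ - q.2)) {t : ℝ} (ht : 0 < t) :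
    ∫⁻ x in {x | t ≤ (1 - ‖x‖ ^ 2) / 2 * ‖fderiv ℝ (W ∘ pushOut Q) x‖} ∩ closedBall q.1 q.2,
        ENNReal.ofReal ((2 / (1 - ‖x‖ ^ 2)) ^ (m + 1))
      ≤ ENNReal.ofReal (t ^ (m + 1))⁻¹ *
        (ENNReal.ofReal ((8 * K * M ^ 2) ^ (m + 1)) * volume (ball (0 : Euc (m + 1)) 1)) := by
  have hr := hQ.pos q hq
  have hlt := hQ.lt q hq
  set l := 1 - ‖q.1‖ with hl
  set s := 4 * K * l ^ 2 / ((l - q.2) * t) with hs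
  have hlr : 0 < l - q.2 := by linarith
  have hl0 : 0 < l := hr.trans hlt
  have hs0 : 0 ≤ s := by positivity
  have hnorm : ∀ x ∈ closedBall q.1 q.2, |‖x‖ - ‖q.1‖| ≤ q.2 := by
    intro x hx
    rw [mem_closedBall, dist_eq_norm] at hx
    exact (abs_norm_sub_norm_le _ _).trans hx
  have hsub : {x | t ≤ (1 - ‖x‖ ^ 2) / 2 * ‖fderiv ℝ (W ∘ pushOut Q) x‖} ∩ closedBall q.1 q.2
      ⊆ sphere q.1 q.2 ∪ (closedBall q.1 s ∩ closedBall q.1 q.2) := by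
    rintro x ⟨hxt, hxq⟩
    by_cases hxs : x ∈ sphere q.1 q.2
    · exact Or.inl hxs
    refine Or.inr ⟨?_, hxq⟩
    have hxb : x ∈ ball q.1 q.2 := by
      have := hxq
      rw [← ball_union_sphere] at this
      exact this.resolve_right hxs
    by_cases hxc : x = q.1
    · rw [hxc]; exact mem_closedBall_self hs0
    have hd : 0 < ‖x - q.1‖ := norm_pos_iff.2 (sub_ne_zero.2 hxc)
    have h1 := hQ.norm_fderiv_comp_pushOut_le hW hK hWK hq hxb hxc
    have h2 := abs_le.1 (hnorm x hxq)
    have h0 := norm_nonneg x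
    have h3 : (1 - ‖x‖ ^ 2) / 2 ≤ 2 * l := by nlinarith
    have h4 : t ≤ 2 * l * (K / (l - q.2) * (2 * q.2 / ‖x - q.1‖)) := by
      refine (mem_ofPred.1 hxt).trans (mul_le_mul h3 h1 (norm_nonneg _) (by linarith))
    rw [mem_closedBall, dist_eq_norm, hs, le_div_iff₀ (by positivity)]
    have h5 : 2 * l * (K / (l - q.2) * (2 * q.2 / ‖x - q.1‖))
        = 4 * K * l * q.2 / ((l - q.2) * ‖x - q.1‖) := by
      field_simp; ring
    rw [h5, le_div_iff₀ (by positivity)] at h4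
    calc ‖x - q.1‖ * ((l - q.2) * t) = t * ((l - q.2) * ‖x - q.1‖) := by ring
      _ ≤ 4 * K * l * q.2 := h4
      _ ≤ 4 * K * l * l := by gcongr
      _ = _ := by ring
  refine (lintegral_mono_set hsub).trans ((lintegral_union_le _ _ _).trans ?_)
  rw [setLIntegral_measure_zero _ _ (Measure.addHaar_sphere _ _ _), zero_add]
  calc ∫⁻ x in closedBall q.1 s ∩ closedBall q.1 q.2,
        ENNReal.ofReal ((2 / (1 - ‖x‖ ^ 2)) ^ (m + 1))
      ≤ ∫⁻ x in closedBall q.1 s ∩ closedBall q.1 q.2,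
        ENNReal.ofReal ((2 / (l - q.2)) ^ (m + 1)) := by
        refine setLIntegral_mono measurable_const fun x hx => ?_
        have h2 := abs_le.1 (hnorm x hx.2)
        exact ENNReal.ofReal_le_ofReal (hyperbolic_density_le hlr (by linarith))
    _ ≤ ENNReal.ofReal ((2 / (l - q.2)) ^ (m + 1)) * volume (closedBall q.1 s) := by
        rw [setLIntegral_const]
        gcongr
        exact inter_subset_left
    _ = ENNReal.ofReal ((2 / (l - q.2)) ^ (m + 1) * s ^ (m + 1)) *
          volume (ball (0 : Euc (m + 1)) 1) := by
        rw [Measure.addHaar_closedBall _ _ hs0, finrank_euclideanSpace_fin, ← mul_assoc,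
          ← ENNReal.ofReal_mul (pow_nonneg (div_nonneg zero_le_two hlr.le) _)]
    _ ≤ ENNReal.ofReal ((t ^ (m + 1))⁻¹ * (8 * K * M ^ 2) ^ (m + 1)) *
          volume (ball (0 : Euc (m + 1)) 1) := by
        gcongr ENNReal.ofReal ?_ * _
        rw [← mul_pow, ← inv_pow, ← mul_pow]
        gcongr ?_ ^ (m + 1)
        have h6 : 2 / (l - q.2) * s = t⁻¹ * (8 * K * (l / (l - q.2)) ^ 2) := by
          rw [hs]; field_simp; ring
        rw [h6]
        have h7 : l / (l - q.2) ≤ M := by rwa [div_le_iff₀ hlr]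
        have h8 : 0 ≤ l / (l - q.2) := by positivity
        gcongr
    _ = _ := by rw [ENNReal.ofReal_mul (by positivity), mul_assoc]

theorem DisjointBalls.weakType_le (hQ : DisjointBalls Q)
    (hW : ∀ x ∈ outerRegion Q, DifferentiableAt ℝ W x) {K : ℝ} (hK : 0 ≤ K)
    {k : Euc (m + 1) → ℝ} (hkK : ∀ x, ‖x‖ < 1 → k x ≤ K)
    (hWk : ∀ x ∈ outerRegion Q, ‖fderiv ℝ W x‖ ≤ k x / (1 - ‖x‖)) {h : Euc (m + 1) → ℝ≥0∞}
    (hh : Measurable h) (hkh : ∀ x, ‖x‖ < 1 → ENNReal.ofReal (k x ^ (m + 1)) ≤ h x) {M : ℝ}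
    (hM : ∀ q ∈ Q, 1 - ‖q.1‖ ≤ M * (1 - ‖q.1‖ - q.2)) {t : ℝ} (ht : 0 < t) :
    ∫⁻ x in {x | x ∈ ball (0 : Euc (m + 1)) 1 ∧ DifferentiableAt ℝ (W ∘ pushOut Q) x ∧
        t ≤ (1 - ‖x‖ ^ 2) / 2 * ‖fderiv ℝ (W ∘ pushOut Q) x‖},
        ENNReal.ofReal ((2 / (1 - ‖x‖ ^ 2)) ^ (m + 1))
      ≤ ENNReal.ofReal (t ^ (m + 1))⁻¹ *
        (ENNReal.ofReal (2 ^ (m + 1)) *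
            (∫⁻ x in ball 0 1, ENNReal.ofReal ((1 - ‖x‖) ^ (m + 1))⁻¹ * h x) +
          Q.card * (ENNReal.ofReal ((8 * K * M ^ 2) ^ (m + 1)) *
            volume (ball (0 : Euc (m + 1)) 1))) := by
  set A := {x | t ≤ (1 - ‖x‖ ^ 2) / 2 * ‖fderiv ℝ (W ∘ pushOut Q) x‖} with hA
  set O := ball (0 : Euc (m + 1)) 1 ∩ A ∩ {x | ∀ q ∈ Q, x ∉ closedBall q.1 q.2} with hO
  have hsub : {x | x ∈ ball (0 : Euc (m + 1)) 1 ∧ DifferentiableAt ℝ (W ∘ pushOut Q) x ∧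
      t ≤ (1 - ‖x‖ ^ 2) / 2 * ‖fderiv ℝ (W ∘ pushOut Q) x‖} ⊆
      O ∪ ⋃ q ∈ Q, A ∩ closedBall q.1 q.2 := by
    rintro x ⟨hx, -, hxA⟩
    by_cases h : ∃ q ∈ Q, x ∈ closedBall q.1 q.2
    · obtain ⟨q, hq, hxq⟩ := h
      exact Or.inr (mem_biUnion hq ⟨hxA, hxq⟩)
    · push Not at h
      exact Or.inl ⟨⟨hx, hxA⟩, h⟩
  refine (lintegral_mono_set hsub).trans ((lintegral_union_le _ _ _).trans ?_)
  rw [mul_add]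
  gcongr ?_ + ?_
  · have hg : Measurable fun x : Euc (m + 1) => ENNReal.ofReal ((t ^ (m + 1))⁻¹ * 2 ^ (m + 1)) *
        (ENNReal.ofReal ((1 - ‖x‖) ^ (m + 1))⁻¹ * h x) := by fun_prop
    calc ∫⁻ x in O, ENNReal.ofReal ((2 / (1 - ‖x‖ ^ 2)) ^ (m + 1))
        ≤ ∫⁻ x in O, ENNReal.ofReal ((t ^ (m + 1))⁻¹ * 2 ^ (m + 1)) *
            (ENNReal.ofReal ((1 - ‖x‖) ^ (m + 1))⁻¹ * h x) := by
          refine setLIntegral_mono hg ?_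
          rintro x ⟨⟨hx, hxA⟩, hxQ⟩
          rw [mem_ball_zero_iff] at hx
          have hl : 0 < 1 - ‖x‖ := by linarith
          have hxo : x ∈ outerRegion Q :=
            ⟨hx, fun q hq hxq => hxQ q hq (ball_subset_closedBall hxq)⟩
          have h1 : t ≤ (1 - ‖x‖ ^ 2) / 2 * ‖fderiv ℝ W x‖ := by
            have := hxA
            rwa [hA, mem_ofPred, (comp_pushOut_eventuallyEq W hxQ).fderiv_eq] at this
          have h0 := norm_nonneg x
          have h2 : t ≤ k x := by
            calc t ≤ (1 - ‖x‖ ^ 2) / 2 * ‖fderiv ℝ W x‖ := h1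
              _ ≤ (1 - ‖x‖) * (k x / (1 - ‖x‖)) :=
                mul_le_mul (by nlinarith) (hWk x hxo) (norm_nonneg _) hl.le
              _ = k x := by field_simp
          refine le_trans ?_ (mul_le_mul_right (mul_le_mul_right (hkh x hx) _) _)
          rw [← ENNReal.ofReal_mul (by positivity), ← ENNReal.ofReal_mul (by positivity)]
          refine ENNReal.ofReal_le_ofReal ((hyperbolic_density_le hl le_rfl).trans ?_)
          have h3 : (t ^ (m + 1))⁻¹ * 2 ^ (m + 1) * (((1 - ‖x‖) ^ (m + 1))⁻¹ * k x ^ (m + 1))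
              = (k x / t) ^ (m + 1) * (2 / (1 - ‖x‖)) ^ (m + 1) := by
            rw [div_pow, div_pow]; ring
          rw [h3]
          refine le_mul_of_one_le_left (by positivity) (one_le_pow₀ ?_)
          rwa [one_le_div ht]
      _ ≤ ∫⁻ x in ball 0 1, ENNReal.ofReal ((t ^ (m + 1))⁻¹ * 2 ^ (m + 1)) *
            (ENNReal.ofReal ((1 - ‖x‖) ^ (m + 1))⁻¹ * h x) :=
          lintegral_mono_set fun x hx => hx.1.1
      _ = _ := by
          rw [lintegral_const_mul' _ _ ENNReal.ofReal_ne_top, ENNReal.ofReal_mul (by positivity),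
            mul_assoc]
  · have hWK : ∀ x ∈ outerRegion Q, ‖fderiv ℝ W x‖ ≤ K / (1 - ‖x‖) := by
      intro x hx
      have h1 : 0 < 1 - ‖x‖ := by linarith [hx.1]
      refine (hWk x hx).trans ?_
      have := hkK x hx.1
      gcongr
    calc ∫⁻ x in ⋃ q ∈ Q, A ∩ closedBall q.1 q.2, ENNReal.ofReal ((2 / (1 - ‖x‖ ^ 2)) ^ (m + 1))
        ≤ ∑ q ∈ Q, ∫⁻ x in A ∩ closedBall q.1 q.2,
            ENNReal.ofReal ((2 / (1 - ‖x‖ ^ 2)) ^ (m + 1)) := by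
          have h1 := lintegral_iUnion_le (μ := volume) (fun q : Q => A ∩ closedBall q.1.1 q.1.2)
            fun x => ENNReal.ofReal ((2 / (1 - ‖x‖ ^ 2)) ^ (m + 1))
          rwa [iUnion_subtype, Finset.tsum_subtype Q fun q => ∫⁻ x in A ∩ closedBall q.1 q.2,
            ENNReal.ofReal ((2 / (1 - ‖x‖ ^ 2)) ^ (m + 1))] at h1
      _ ≤ ∑ _q ∈ Q, ENNReal.ofReal (t ^ (m + 1))⁻¹ *
            (ENNReal.ofReal ((8 * K * M ^ 2) ^ (m + 1)) * volume (ball (0 : Euc (m + 1)) 1)) :=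
          Finset.sum_le_sum fun q hq => hQ.setLIntegral_ball_le hW hK hWK hq (hM q hq) ht
      _ = _ := by
          rw [Finset.sum_const, nsmul_eq_mul]
          ring

end WeakType

section Trace

variable {m ν : ℕ}

theorem norm_sub_le_of_retraction {V : Type*} [NormedAddCommGroup V] [NormedSpace ℝ V]
    {N : Set V} {ρ L D : ℝ} (hρ : 0 < ρ) {retr : V → V}
    (hdiff : ∀ y, infDist y N < ρ → DifferentiableAt ℝ retr y)
    (hL : ∀ y, infDist y N < ρ → ‖fderiv ℝ retr y‖ ≤ L)
    (hmaps : ∀ y, infDist y N < ρ → retr y ∈ N) (hid : ∀ y ∈ N, retr y = y)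
    (hD : ∀ y ∈ N, ∀ z ∈ N, ‖y - z‖ ≤ D) {v a : V} (hv : infDist v N < ρ) (ha : a ∈ N) :
    ‖retr v - a‖ ≤ (L + D / ρ) * ‖v - a‖ := by
  have hL0 : 0 ≤ L := (norm_nonneg _).trans (hL v hv)
  have hD0 : 0 ≤ D := (norm_nonneg _).trans (hD a ha a ha)
  rcases lt_or_ge ‖v - a‖ ρ with h | h
  · have hb : ∀ y ∈ ball a ρ, infDist y N < ρ := fun y hy =>
      (infDist_le_dist_of_mem ha).trans_lt hy
    have h1 := (convex_ball a ρ).norm_image_sub_le_of_norm_fderiv_le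
      (fun y hy => hdiff y (hb y hy)) (fun y hy => hL y (hb y hy)) (mem_ball_self hρ)
      (show v ∈ ball a ρ by rwa [mem_ball, dist_eq_norm])
    rw [hid a ha] at h1
    refine h1.trans ?_
    have : 0 ≤ D / ρ := by positivity
    gcongr
    linarith
  · have h1 := hD _ (hmaps v hv) a ha
    calc ‖retr v - a‖ ≤ D / ρ * ρ := by rwa [div_mul_cancel₀ _ hρ.ne']
      _ ≤ (L + D / ρ) * ‖v - a‖ := by
        gcongr
        linarith

theorem le_add_inv_mul_pow {a η : ℝ} (ha : 0 ≤ a) (hη : 0 < η) (m : ℕ) :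
    a ≤ η + (η ^ m)⁻¹ * a ^ (m + 1) := by
  rcases le_total a η with h | h
  · have : 0 ≤ (η ^ m)⁻¹ * a ^ (m + 1) := by positivity
    linarith
  · have : η ^ m ≤ a ^ m := by gcongr
    have h1 : a ≤ (η ^ m)⁻¹ * a ^ (m + 1) := by
      rw [inv_mul_eq_div, le_div_iff₀ (by positivity), pow_succ, mul_comm]
      gcongr
    linarith

theorem bdPoisson_le_of_norm_eq_one {x y : Euc (m + 1)} (hx : ‖x‖ < 1) (hx0 : x ≠ 0)
    (hy : ‖y‖ = 1) (hxy : ‖x‖⁻¹ • x ≠ y) :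
    bdPoisson m x y ≤ 4 ^ m * (1 - ‖x‖) ^ m * (dist (‖x‖⁻¹ • x) y ^ (2 * m))⁻¹ := by
  have h1 : 1 - ‖x‖ ≤ ‖x - y‖ := one_sub_norm_le_norm_sub hy
  have h0 : 0 < 1 - ‖x‖ := by linarith
  have h2 : dist (‖x‖⁻¹ • x) y ≤ 2 * ‖x - y‖ := by
    have h3 := norm_normalize_sub hx0 hx.le
    have h4 := dist_triangle (‖x‖⁻¹ • x) x y
    rw [dist_eq_norm _ x, dist_eq_norm x y, h3] at h4
    linarith
  have hd : 0 < dist (‖x‖⁻¹ • x) y := dist_pos.2 hxy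
  have hn : 0 < ‖x - y‖ := h0.trans_le h1
  unfold bdPoisson bdKernel
  rw [← div_eq_mul_inv, ← div_eq_mul_inv, div_le_div_iff₀ (by positivity) (by positivity)]
  calc (1 - ‖x‖) ^ (3 * m) * dist (‖x‖⁻¹ • x) y ^ (2 * m)
      = (1 - ‖x‖) ^ m * (1 - ‖x‖) ^ (2 * m) * dist (‖x‖⁻¹ • x) y ^ (2 * m) := by ring
    _ ≤ (1 - ‖x‖) ^ m * ‖x - y‖ ^ (2 * m) * (2 * ‖x - y‖) ^ (2 * m) := by gcongr
    _ = 4 ^ m * (1 - ‖x‖) ^ m * ‖x - y‖ ^ (4 * m) := by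
      rw [mul_pow, pow_mul 2 2 m]; ring

theorem exists_norm_bdExt_sub_trace_le (m ν : ℕ) : ∃ C : ℝ, 0 < C ∧
    ∀ (u : Euc (m + 1) → Euc ν) (D : ℝ), Measurable u → (∀ y z, ‖u y - u z‖ ≤ D) →
      ∀ x : Euc (m + 1), ‖x‖ < 1 → x ≠ 0 → ∀ η : ℝ, 0 < η →
        ENNReal.ofReal ‖bdExt u x - u (‖x‖⁻¹ • x)‖ ≤ ENNReal.ofReal η +
          ENNReal.ofReal (C * ((1 - ‖x‖) / η) ^ m) *
            ∫⁻ y, ENNReal.ofReal (dist (u (‖x‖⁻¹ • x)) (u y) ^ (m + 1)) /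
              ENNReal.ofReal (dist (‖x‖⁻¹ • x) y ^ (2 * m)) ∂(sphMeasure m) := by
  obtain ⟨C, hC, h⟩ := exists_lintegral_bdProb_le m
  refine ⟨C * 4 ^ m, by positivity, fun u D hu hD x hx hx0 η hη => ?_⟩
  have := isProbabilityMeasure_bdProb hx
  set z := ‖x‖⁻¹ • x with hz
  have h0 : 0 < 1 - ‖x‖ := by linarith
  have hInt : Integrable (fun y => ‖u y - u z‖) (bdProb m x) :=
    ((integrable_of_osc hu hD).sub (integrable_const _)).norm
  calc ENNReal.ofReal ‖bdExt u x - u z‖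
      ≤ ENNReal.ofReal (∫ y, ‖u y - u z‖ ∂(bdProb m x)) :=
        ENNReal.ofReal_le_ofReal (norm_bdExt_sub_le hu hD hx _)
    _ = ∫⁻ y, ENNReal.ofReal ‖u y - u z‖ ∂(bdProb m x) :=
        ofReal_integral_eq_lintegral_ofReal hInt (Eventually.of_forall fun y => norm_nonneg _)
    _ ≤ ∫⁻ y, (ENNReal.ofReal η + ENNReal.ofReal (η ^ m)⁻¹ *
          ENNReal.ofReal (‖u y - u z‖ ^ (m + 1))) ∂(bdProb m x) := by
        refine lintegral_mono fun y => ?_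
        rw [← ENNReal.ofReal_mul (by positivity), ← ENNReal.ofReal_add hη.le (by positivity)]
        exact ENNReal.ofReal_le_ofReal (le_add_inv_mul_pow (norm_nonneg _) hη m)
    _ = ENNReal.ofReal η + ENNReal.ofReal (η ^ m)⁻¹ *
          ∫⁻ y, ENNReal.ofReal (‖u y - u z‖ ^ (m + 1)) ∂(bdProb m x) := by
        rw [lintegral_add_left measurable_const, lintegral_const, measure_univ, mul_one,
          lintegral_const_mul' _ _ ENNReal.ofReal_ne_top]
    _ ≤ ENNReal.ofReal η + ENNReal.ofReal (η ^ m)⁻¹ *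
          ∫⁻ y, ENNReal.ofReal (‖u y - u z‖ ^ (m + 1)) *
            ENNReal.ofReal (C * bdPoisson m x y) ∂(sphMeasure m) := by
        exact add_le_add le_rfl (mul_le_mul_right (h x hx
          (fun y => ENNReal.ofReal (‖u y - u z‖ ^ (m + 1))) (by fun_prop)) _)
    _ ≤ ENNReal.ofReal η + ENNReal.ofReal (η ^ m)⁻¹ *
          ∫⁻ y, ENNReal.ofReal (C * 4 ^ m * (1 - ‖x‖) ^ m) *
            (ENNReal.ofReal (dist (u z) (u y) ^ (m + 1)) /
              ENNReal.ofReal (dist z y ^ (2 * m))) ∂(sphMeasure m) := by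
        refine add_le_add le_rfl (mul_le_mul_right (lintegral_mono_ae ?_) _)
        filter_upwards [ae_sphMeasure_norm m] with y hy
        by_cases hzy : z = y
        · simp [hzy]
        · rw [← dist_eq_norm, dist_comm (u y), ← ENNReal.ofReal_div_of_pos
              (pow_pos (dist_pos.2 hzy) _), ← ENNReal.ofReal_mul (by positivity),
            ← ENNReal.ofReal_mul (by positivity)]
          refine ENNReal.ofReal_le_ofReal ?_
          calc dist (u z) (u y) ^ (m + 1) * (C * bdPoisson m x y)
              ≤ dist (u z) (u y) ^ (m + 1) *
                (C * (4 ^ m * (1 - ‖x‖) ^ m * (dist z y ^ (2 * m))⁻¹)) := by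
                gcongr
                exact bdPoisson_le_of_norm_eq_one hx hx0 hy hzy
            _ = _ := by rw [div_eq_mul_inv]; ring
    _ = _ := by
        rw [lintegral_const_mul' _ _ ENNReal.ofReal_ne_top, ← mul_assoc,
          ← ENNReal.ofReal_mul (by positivity)]
        congr 3
        rw [div_pow]
        ring

theorem tendsto_trace {u : Euc (m + 1) → Euc ν} (hm : 1 ≤ m) {D : ℝ} (hu : Measurable u)
    (hD : ∀ y z, ‖u y - u z‖ ≤ D) (hE : sphEnergy u ≠ ⊤) {U : Euc (m + 1) → Euc ν} {K r : ℝ}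
    (hr : r < 1)
    (hU : ∀ x : Euc (m + 1), r < ‖x‖ → ‖x‖ < 1 →
      ‖U x - u (‖x‖⁻¹ • x)‖ ≤ K * ‖bdExt u x - u (‖x‖⁻¹ • x)‖) :
    Tendsto (fun ε : ℝ => ENNReal.ofReal ε⁻¹ *
      ∫⁻ x in {x : Euc (m + 1) | 1 - ε < ‖x‖ ∧ ‖x‖ < 1},
        ENNReal.ofReal ‖U x - u (‖x‖⁻¹ • x)‖) (nhdsWithin 0 (Ioi 0)) (nhds 0) := by
  obtain ⟨C, hC, h⟩ := exists_norm_bdExt_sub_trace_le m ν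
  set Φ : Euc (m + 1) → ℝ≥0∞ := fun z => ∫⁻ y, ENNReal.ofReal (dist (u z) (u y) ^ (m + 1)) /
    ENNReal.ofReal (dist z y ^ (2 * m)) ∂(sphMeasure m) with hΦ
  have hΦm : Measurable Φ := by
    refine Measurable.lintegral_prod_right' (f := fun p : Euc (m + 1) × Euc (m + 1) =>
      ENNReal.ofReal (dist (u p.1) (u p.2) ^ (m + 1)) /
        ENNReal.ofReal (dist p.1 p.2 ^ (2 * m))) ?_
    fun_prop
  set B : ℝ≥0∞ := ENNReal.ofReal K * (sphMeasure m univ + ENNReal.ofReal C * sphEnergy u) with hB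
  have hBt : B ≠ ⊤ := ENNReal.mul_ne_top ENNReal.ofReal_ne_top (ENNReal.add_ne_top.2
    ⟨measure_ne_top _ _, ENNReal.mul_ne_top ENNReal.ofReal_ne_top hE⟩)
  have hlim : Tendsto (fun ε : ℝ => ENNReal.ofReal (√ε) * B) (nhdsWithin 0 (Ioi 0)) (nhds 0) := by
    have h1 : Tendsto (fun ε : ℝ => ENNReal.ofReal (√ε)) (nhdsWithin 0 (Ioi 0)) (nhds 0) := by
      have : Continuous fun ε : ℝ => ENNReal.ofReal (√ε) :=
        ENNReal.continuous_ofReal.comp Real.continuous_sqrt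
      have h2 := this.tendsto 0
      simp only [Real.sqrt_zero, ENNReal.ofReal_zero] at h2
      exact h2.mono_left nhdsWithin_le_nhds
    simpa using ENNReal.Tendsto.mul_const h1 (Or.inr hBt)
  refine tendsto_of_tendsto_of_tendsto_of_le_of_le' tendsto_const_nhds hlim
    (Eventually.of_forall fun _ => bot_le) ?_
  have hs : 0 < min (1 / 2) (1 - r) := lt_min (by norm_num) (by linarith)
  filter_upwards [Ioo_mem_nhdsGT hs] with ε hε
  have hε0 : 0 < ε := hε.1
  have hε1 : ε < 1 / 2 := hε.2.trans_le (min_le_left _ _)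
  have hεr : ε < 1 - r := hε.2.trans_le (min_le_right _ _)
  have hη : 0 < √ε := Real.sqrt_pos.2 hε0
  have hη1 : √ε ≤ 1 := Real.sqrt_le_one.2 (by linarith)
  have hg : Measurable fun z => ENNReal.ofReal K * (ENNReal.ofReal (√ε) +
      ENNReal.ofReal (√ε * C) * Φ z) := by fun_prop
  have hle : ∀ x ∈ {x : Euc (m + 1) | 1 - ε < ‖x‖ ∧ ‖x‖ < 1},
      ENNReal.ofReal ‖U x - u (‖x‖⁻¹ • x)‖ ≤ ENNReal.ofReal K * (ENNReal.ofReal (√ε) +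
        ENNReal.ofReal (√ε * C) * Φ (‖x‖⁻¹ • x)) := by
    rintro x ⟨hx1, hx2⟩
    have hx0 : x ≠ 0 := by
      rintro rfl
      rw [norm_zero] at hx1
      linarith
    refine (ENNReal.ofReal_le_ofReal (hU x (by linarith) hx2)).trans ?_
    rw [ENNReal.ofReal_mul' (norm_nonneg _)]
    gcongr
    refine (h u D hu hD x hx2 hx0 (√ε) hη).trans ?_
    gcongr _ + ENNReal.ofReal ?_ * _
    rw [mul_comm]
    gcongr
    have h3 : (1 - ‖x‖) / √ε ≤ √ε := by
      rw [div_le_iff₀ hη, Real.mul_self_sqrt hε0.le]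
      linarith
    have h4 : 0 ≤ (1 - ‖x‖) / √ε := div_nonneg (by linarith) hη.le
    calc ((1 - ‖x‖) / √ε) ^ m ≤ √ε ^ m := by gcongr
      _ ≤ √ε := pow_le_of_le_one hη.le hη1 (by omega)
  calc ENNReal.ofReal ε⁻¹ * ∫⁻ x in {x : Euc (m + 1) | 1 - ε < ‖x‖ ∧ ‖x‖ < 1},
        ENNReal.ofReal ‖U x - u (‖x‖⁻¹ • x)‖
      ≤ ENNReal.ofReal ε⁻¹ * (ENNReal.ofReal ε * ∫⁻ z, ENNReal.ofReal K * (ENNReal.ofReal (√ε) +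
          ENNReal.ofReal (√ε * C) * Φ z) ∂(sphMeasure m)) := by
        gcongr
        refine le_trans ?_ (exists_shell_lintegral_le m (by linarith) hg)
        refine setLIntegral_mono' ?_ hle
        exact (measurableSet_lt measurable_const measurable_norm).inter
          (measurableSet_lt measurable_norm measurable_const)
    _ = ∫⁻ z, ENNReal.ofReal K * (ENNReal.ofReal (√ε) +
          ENNReal.ofReal (√ε * C) * Φ z) ∂(sphMeasure m) := by
        rw [← mul_assoc, ← ENNReal.ofReal_mul (by positivity), inv_mul_cancel₀ hε0.ne',
          ENNReal.ofReal_one, one_mul]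
    _ = ENNReal.ofReal (√ε) * B := by
        rw [lintegral_const_mul' _ _ ENNReal.ofReal_ne_top, lintegral_add_left measurable_const,
          lintegral_const_mul' _ _ ENNReal.ofReal_ne_top, lintegral_const, hB,
          ENNReal.ofReal_mul hη.le]
        change _ * (_ + _ * sphEnergy u) = _
        ring

end Trace

section Construction

variable {m ν : ℕ}

open Classical in
/-- The composition of the retraction with the averaged extension of `u`, with the value `n₀` at
the points where the latter is far away from the target. -/
def retractedExt (N : Set (Euc ν)) (ρ : ℝ) (retr : Euc ν → Euc ν) (n₀ : Euc ν)
    (u : Euc (m + 1) → Euc ν) (x : Euc (m + 1)) : Euc ν :=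
  if infDist (bdExt u x) N < ρ then retr (bdExt u x) else n₀

variable {N : Set (Euc ν)} {ρ L D : ℝ} {retr : Euc ν → Euc ν} {n₀ : Euc ν}
  {u : Euc (m + 1) → Euc ν} {x : Euc (m + 1)}

theorem retractedExt_mem (hmaps : ∀ y, infDist y N < ρ → retr y ∈ N) (hn₀ : n₀ ∈ N) :
    retractedExt N ρ retr n₀ u x ∈ N := by
  unfold retractedExt
  split_ifs with h
  exacts [hmaps _ h, hn₀]

theorem hasFDerivAt_retractedExt (hdiff : ∀ y, infDist y N < ρ → DifferentiableAt ℝ retr y)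
    (hu : Measurable u) (hD : ∀ y z, ‖u y - u z‖ ≤ D) (hx : ‖x‖ < 1)
    (hxN : infDist (bdExt u x) N < ρ) :
    HasFDerivAt (retractedExt N ρ retr n₀ u)
      ((fderiv ℝ retr (bdExt u x)).comp (fderiv ℝ (bdExt u) x)) x := by
  have hV := differentiableAt_bdExt hu hD hx
  refine ((hdiff _ hxN).hasFDerivAt.comp x hV.hasFDerivAt).congr_of_eventuallyEq ?_
  have h1 : ∀ᶠ y in 𝓝 x, infDist (bdExt u y) N < ρ :=
    ((continuous_infDist_pt N).continuousAt.comp hV.continuousAt).eventually_lt_const hxN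
  filter_upwards [h1] with y hy
  rw [retractedExt, if_pos hy, Function.comp_apply]

theorem norm_fderiv_retractedExt_le
    (hdiff : ∀ y, infDist y N < ρ → DifferentiableAt ℝ retr y)
    (hL : ∀ y, infDist y N < ρ → ‖fderiv ℝ retr y‖ ≤ L) (hu : Measurable u)
    (hD : ∀ y z, ‖u y - u z‖ ≤ D) (hx : ‖x‖ < 1) (hxN : infDist (bdExt u x) N < ρ) :
    ‖fderiv ℝ (retractedExt N ρ retr n₀ u) x‖ ≤
      L * (4 * m * 2 ^ (8 * m) * 2) * bdOsc u x / (1 - ‖x‖) := by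
  rw [(hasFDerivAt_retractedExt hdiff hu hD hx hxN).fderiv]
  refine (ContinuousLinearMap.opNorm_comp_le _ _).trans ?_
  calc _ ≤ L * (4 * m * 2 ^ (8 * m) * 2 * bdOsc u x / (1 - ‖x‖)) :=
        mul_le_mul (hL _ hxN) (norm_fderiv_bdExt_le hu hD hx) (norm_nonneg _)
          ((norm_nonneg _).trans (hL _ hxN))
    _ = _ := by ring

theorem DisjointBalls.exists_forall_notMem {E : Type*} [NormedAddCommGroup E]
    {Q : Finset (E × ℝ)} (hQ : DisjointBalls Q) :
    ∃ r < 1, ∀ x : E, r < ‖x‖ → ∀ q ∈ Q, x ∉ closedBall q.1 q.2 := by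
  have h1 : ∀ᶠ r in 𝓝[<] (1 : ℝ), ∀ q ∈ Q, ‖q.1‖ + q.2 < r := by
    rw [Filter.eventually_all_finset]
    intro q hq
    have : ‖q.1‖ + q.2 < 1 := by linarith [hQ.lt q hq]
    filter_upwards [Ioo_mem_nhdsLT this] with r hr using hr.1
  obtain ⟨r, hr, hr1⟩ := (h1.and self_mem_nhdsWithin).exists
  refine ⟨r, hr1, fun x hx q hq hxq => ?_⟩
  rw [mem_closedBall, dist_eq_norm] at hxq
  have := norm_add_le (x - q.1) q.1
  rw [sub_add_cancel] at this
  linarith [hr q hq]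

theorem exists_singular_extension (hm : 1 ≤ m) (hNcomp : IsCompact N) (hρ : 0 < ρ)
    (hn₀ : n₀ ∈ N) (hdiff : ∀ y, infDist y N < ρ → DifferentiableAt ℝ retr y)
    (hL : ∀ y, infDist y N < ρ → ‖fderiv ℝ retr y‖ ≤ L)
    (hmaps : ∀ y, infDist y N < ρ → retr y ∈ N) (hid : ∀ y ∈ N, retr y = y) :
    ∃ A B : ℝ, 0 < A ∧ 0 < B ∧ ∀ u : Euc (m + 1) → Euc ν, Measurable u → (∀ y, u y ∈ N) →
      sphEnergy u ≠ ⊤ → ∃ (S : Set (Euc (m + 1))) (U : Euc (m + 1) → Euc ν),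
        S.Finite ∧ S ⊆ ball 0 1 ∧
        (S.ncard : ℝ≥0∞) ≤
          ENNReal.ofReal (A * Real.exp (B * (sphGap (ρ / 4) u).toReal)) * sphEnergy u ∧
        (∀ x ∈ ball (0 : Euc (m + 1)) 1, U x ∈ N) ∧
        ContinuousOn U (ball 0 1 \ S) ∧
        (∀ᵐ x ∂(volume.restrict (ball 0 1)), DifferentiableAt ℝ U x) ∧
        (∀ t : ℝ, 0 < t →
          (∫⁻ x in {x | x ∈ ball (0 : Euc (m + 1)) 1 ∧ DifferentiableAt ℝ U x ∧
              t ≤ (1 - ‖x‖ ^ 2) / 2 * ‖fderiv ℝ U x‖},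
            ENNReal.ofReal ((2 / (1 - ‖x‖ ^ 2)) ^ (m + 1))) ≤
          ENNReal.ofReal (t ^ (m + 1))⁻¹ *
            (ENNReal.ofReal (A * Real.exp (B * (sphGap (ρ / 4) u).toReal)) * sphEnergy u)) ∧
        Tendsto (fun ε : ℝ => ENNReal.ofReal ε⁻¹ *
            ∫⁻ x in {x : Euc (m + 1) | 1 - ε < ‖x‖ ∧ ‖x‖ < 1},
              ENNReal.ofReal ‖U x - u (‖x‖⁻¹ • x)‖) (nhdsWithin 0 (Ioi 0)) (nhds 0) := by
  set D : ℝ := diam N + 1 with hDdef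
  have hD0 : 0 < D := by positivity
  have hDN : ∀ y ∈ N, ∀ z ∈ N, ‖y - z‖ ≤ D := by
    intro y hy z hz
    rw [← dist_eq_norm]
    exact (dist_le_diam_of_mem hNcomp.isBounded hy hz).trans (by linarith)
  have hL0 : 0 ≤ L := (norm_nonneg _).trans (hL n₀ (by rwa [infDist_zero_of_mem hn₀]))
  obtain ⟨C₁, hC₁, h₁⟩ := exists_bdOsc_pow_le m ν
  obtain ⟨C₂, hC₂, h₂⟩ := exists_lintegral_doubleAverage_le (m := m) hm
  obtain ⟨C₃, hC₃, h₃⟩ := exists_bad_centers hm ν hD0 hρ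
  set c : ℝ := L * (4 * m * 2 ^ (8 * m) * 2) with hc
  have hc0 : 0 ≤ c := by positivity
  set v : ℝ := (volume (ball (0 : Euc (m + 1)) 1)).toReal with hv
  have hvE : volume (ball (0 : Euc (m + 1)) 1) = ENNReal.ofReal v :=
    (ENNReal.ofReal_toReal measure_ball_lt_top.ne).symm
  set C₄ : ℝ := C₃ * ((ρ / 4) ^ (m + 1))⁻¹ with hC₄
  have hC₄0 : 0 < C₄ := by positivity
  set A₁ : ℝ := 2 ^ (m + 1) * (c ^ (m + 1) * C₁ * C₂) with hA₁
  set A₂ : ℝ := C₄ * ((8 * (c * D)) ^ (m + 1) * v) with hA₂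
  have hv0 : 0 ≤ v := ENNReal.toReal_nonneg
  have hA₁0 : 0 ≤ A₁ := by positivity
  have hA₂0 : 0 ≤ A₂ := by positivity
  refine ⟨A₁ + A₂ + C₄, 8 * (m + 1) * C₃, by positivity, by positivity, fun u hu huN hE => ?_⟩
  have hD : ∀ y z, ‖u y - u z‖ ≤ D := fun y z => hDN _ (huN y) _ (huN z)
  have hgap := sphGap_le_sphEnergy (δ := ρ / 4) (by positivity) hu
  have hgapt : sphGap (ρ / 4) u ≠ ⊤ :=
    ne_top_of_le_ne_top (ENNReal.mul_ne_top ENNReal.ofReal_ne_top hE) hgap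
  obtain ⟨F, hF, hFc, hFbad⟩ := h₃ u N hu hD huN hgapt
  obtain ⟨Q, hQ, hQF, hQM, hQcov⟩ := exists_disjointBalls F hF
  have hgood : ∀ x ∈ outerRegion Q, infDist (bdExt u x) N < ρ := by
    intro x hx
    by_contra! hbad
    obtain ⟨q, hq, hxq⟩ := hQcov x hx.1 (hFbad x hx.1 (by linarith))
    exact hx.2 q hq hxq
  set W := retractedExt N ρ retr n₀ u with hWdef
  have hW : ∀ x ∈ outerRegion Q, DifferentiableAt ℝ W x := fun x hx =>
    (hasFDerivAt_retractedExt hdiff hu hD hx.1 (hgood x hx)).differentiableAt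
  set g : ℝ := (sphGap (ρ / 4) u).toReal with hg
  have hg0 : 0 ≤ g := ENNReal.toReal_nonneg
  have hFg : (F.card : ℝ) ≤ C₃ * g := by
    have := ENNReal.toReal_mono (ENNReal.mul_ne_top ENNReal.ofReal_ne_top hgapt) hFc
    rwa [ENNReal.toReal_natCast, ENNReal.toReal_mul, ENNReal.toReal_ofReal hC₃.le] at this
  have hQE : (Q.card : ℝ≥0∞) ≤ ENNReal.ofReal C₄ * sphEnergy u := by
    calc (Q.card : ℝ≥0∞) ≤ F.card := by exact_mod_cast hQF
      _ ≤ ENNReal.ofReal C₃ * (ENNReal.ofReal ((ρ / 4) ^ (m + 1))⁻¹ * sphEnergy u) :=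
        hFc.trans (mul_le_mul_right hgap _)
      _ = _ := by rw [← mul_assoc, ← ENNReal.ofReal_mul hC₃.le]
  have hexp1 : 1 ≤ Real.exp (8 * (m + 1) * C₃ * g) := Real.one_le_exp (by positivity)
  refine ⟨Prod.fst '' (Q : Set (Euc (m + 1) × ℝ)), W ∘ pushOut Q, Q.finite_toSet.image _, ?_, ?_,
    fun x _ => retractedExt_mem hmaps hn₀, hQ.continuousOn_comp_pushOut hW,
    hQ.ae_differentiableAt_comp_pushOut hW, fun t ht => ?_, ?_⟩
  · rintro _ ⟨q, hq, rfl⟩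
    rw [mem_ball_zero_iff]
    linarith [hQ.lt q hq, hQ.pos q hq]
  · have h5 : (Prod.fst '' (Q : Set (Euc (m + 1) × ℝ))).ncard ≤ Q.card := by
      simpa using Set.ncard_image_le (f := Prod.fst) Q.finite_toSet
    refine le_trans (by exact_mod_cast h5) (hQE.trans ?_)
    gcongr
    calc C₄ ≤ (A₁ + A₂ + C₄) * 1 := by linarith
      _ ≤ _ := by gcongr
  · have hf : Measurable fun p : Euc (m + 1) × Euc (m + 1) =>
        ENNReal.ofReal (dist (u p.1) (u p.2) ^ (m + 1)) := by fun_prop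
    set h : Euc (m + 1) → ℝ≥0∞ := fun x => ENNReal.ofReal (c ^ (m + 1) * C₁) *
      doubleAverage m (fun p => ENNReal.ofReal (dist (u p.1) (u p.2) ^ (m + 1))) x with hh
    have hhm : Measurable h := (measurable_doubleAverage hf).const_mul _
    have hkh : ∀ x : Euc (m + 1), ‖x‖ < 1 →
        ENNReal.ofReal ((c * bdOsc u x) ^ (m + 1)) ≤ h x := by
      intro x hx
      rw [mul_pow, ENNReal.ofReal_mul (by positivity), hh]
      simp only
      rw [ENNReal.ofReal_mul (by positivity), mul_assoc]
      exact mul_le_mul_right (h₁ u D hu hD x hx) _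
    have hInt : ∫⁻ x in ball (0 : Euc (m + 1)) 1,
        ENNReal.ofReal ((1 - ‖x‖) ^ (m + 1))⁻¹ * h x ≤
        ENNReal.ofReal (c ^ (m + 1) * C₁ * C₂) * sphEnergy u := by
      have h6 : ∀ x : Euc (m + 1), ENNReal.ofReal ((1 - ‖x‖) ^ (m + 1))⁻¹ * h x =
          ENNReal.ofReal (c ^ (m + 1) * C₁) * (ENNReal.ofReal ((1 - ‖x‖) ^ (m + 1))⁻¹ *
            doubleAverage m (fun p => ENNReal.ofReal (dist (u p.1) (u p.2) ^ (m + 1))) x) :=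
        fun x => mul_left_comm _ _ _
      rw [lintegral_congr h6, lintegral_const_mul' _ _ ENNReal.ofReal_ne_top,
        ENNReal.ofReal_mul (p := c ^ (m + 1) * C₁) (by positivity), mul_assoc]
      exact mul_le_mul_right (h₂ _ hf fun y => by rw [dist_self, zero_pow m.succ_ne_zero,
        ENNReal.ofReal_zero]) _
    have hweak := hQ.weakType_le hW (K := c * D) (by positivity) (k := fun x => c * bdOsc u x)
      (fun x hx => mul_le_mul_of_nonneg_left (bdOsc_le hu hD hx) hc0)
      (fun x hx => norm_fderiv_retractedExt_le hdiff hL hu hD hx.1 (hgood x hx))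
      hhm hkh hQM ht
    refine hweak.trans (mul_le_mul_right ?_ _)
    have hM : (8 * (c * D) * Real.exp (4 * F.card) ^ 2) ^ (m + 1) ≤
        (8 * (c * D)) ^ (m + 1) * Real.exp (8 * (m + 1) * C₃ * g) := by
      rw [mul_pow, ← pow_mul, ← Real.exp_nat_mul]
      refine mul_le_mul_of_nonneg_left (Real.exp_le_exp.2 ?_) (by positivity)
      rw [Nat.cast_mul, Nat.cast_ofNat, Nat.cast_succ]
      calc 2 * ((m : ℝ) + 1) * (4 * F.card) = 8 * (m + 1) * F.card := by ring
        _ ≤ 8 * (m + 1) * (C₃ * g) := by gcongr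
        _ = _ := by ring
    calc _ ≤ ENNReal.ofReal (2 ^ (m + 1)) *
            (ENNReal.ofReal (c ^ (m + 1) * C₁ * C₂) * sphEnergy u) +
          ENNReal.ofReal C₄ * sphEnergy u *
            (ENNReal.ofReal ((8 * (c * D)) ^ (m + 1) * Real.exp (8 * (m + 1) * C₃ * g)) *
              ENNReal.ofReal v) := by
          rw [hvE]
          gcongr
      _ = ENNReal.ofReal (A₁ + A₂ * Real.exp (8 * (m + 1) * C₃ * g)) * sphEnergy u := by
          rw [ENNReal.ofReal_add hA₁0 (by positivity), add_mul, ← mul_assoc,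
            ← ENNReal.ofReal_mul (by positivity), mul_right_comm (ENNReal.ofReal C₄),
            ← ENNReal.ofReal_mul (by positivity), ← ENNReal.ofReal_mul (by positivity)]
          congr 3
          ring
      _ ≤ _ := by
          gcongr
          rw [add_mul, add_mul]
          have h6 : A₁ * 1 ≤ A₁ * Real.exp (8 * (m + 1) * C₃ * g) := by gcongr
          have h7 : 0 ≤ C₄ * Real.exp (8 * (m + 1) * C₃ * g) := by positivity
          linarith
  · obtain ⟨r, hr, hrQ⟩ := hQ.exists_forall_notMem
    refine tendsto_trace hm hu hD hE hr (K := L + D / ρ) fun x hx hx1 => ?_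
    have hxQ := hrQ x hx
    have hxN : infDist (bdExt u x) N < ρ :=
      hgood x ⟨hx1, fun q hq hxq => hxQ q hq (ball_subset_closedBall hxq)⟩
    rw [Function.comp_apply, pushOut_of_forall_notMem hxQ, hWdef, retractedExt, if_pos hxN]
    exact norm_sub_le_of_retraction hρ hdiff hL hmaps hid hDN hxN (huN _)

end Construction

section Comparison

variable {m ν : ℕ} {u v : Euc (m + 1) → Euc ν} {C δ : ℝ}

theorem lintegral_lintegral_le_of_le_smul {X : Type*} [MeasurableSpace X] {σ μ : Measure X}
    {c : ℝ≥0∞} (hc : c ≠ ⊤) (h : σ ≤ c • μ) (f : X → X → ℝ≥0∞) :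
    ∫⁻ y, (∫⁻ z, f y z ∂σ) ∂σ ≤ c * c * ∫⁻ y, (∫⁻ z, f y z ∂μ) ∂μ := by
  have h1 : ∀ g : X → ℝ≥0∞, ∫⁻ y, g y ∂σ ≤ c * ∫⁻ y, g y ∂μ := fun g =>
    (lintegral_mono' h le_rfl).trans_eq (by rw [lintegral_smul_measure, smul_eq_mul])
  calc ∫⁻ y, (∫⁻ z, f y z ∂σ) ∂σ ≤ ∫⁻ y, c * (∫⁻ z, f y z ∂μ) ∂σ :=
        lintegral_mono fun y => h1 _
    _ = c * ∫⁻ y, (∫⁻ z, f y z ∂μ) ∂σ := lintegral_const_mul' _ _ hc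
    _ ≤ c * (c * ∫⁻ y, (∫⁻ z, f y z ∂μ) ∂μ) := mul_le_mul_right (h1 _) _
    _ = _ := (mul_assoc _ _ _).symm

theorem gagliardoEnergySphere_congr_ae
    (h : v =ᵐ[μH[(m : ℝ)].restrict (sphere (0 : Euc (m + 1)) 1)] u) :
    gagliardoEnergySphere m ν v = gagliardoEnergySphere m ν u := by
  refine lintegral_congr_ae ?_
  filter_upwards [h] with y hy
  refine lintegral_congr_ae ?_
  filter_upwards [h] with z hz
  rw [hy, hz]

theorem gapPotentialSphere_congr_ae
    (h : v =ᵐ[μH[(m : ℝ)].restrict (sphere (0 : Euc (m + 1)) 1)] u) :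
    gapPotentialSphere m ν δ v = gapPotentialSphere m ν δ u := by
  refine lintegral_congr_ae ?_
  filter_upwards [h] with y hy
  refine lintegral_congr_ae ?_
  filter_upwards [h] with z hz
  rw [hy, hz]

theorem sphEnergy_le_gagliardoEnergySphere (hC : sphMeasure m ≤ ENNReal.ofReal C •
      (μH[(m : ℝ)].restrict (sphere (0 : Euc (m + 1)) 1))) :
    sphEnergy u ≤ ENNReal.ofReal C * ENNReal.ofReal C * gagliardoEnergySphere m ν u :=
  lintegral_lintegral_le_of_le_smul ENNReal.ofReal_ne_top hC _

theorem sphGap_le_gapPotentialSphere (hC : sphMeasure m ≤ ENNReal.ofReal C •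
      (μH[(m : ℝ)].restrict (sphere (0 : Euc (m + 1)) 1))) :
    sphGap δ u ≤ ENNReal.ofReal C * ENNReal.ofReal C * gapPotentialSphere m ν δ u := by
  refine (lintegral_lintegral_le_of_le_smul ENNReal.ofReal_ne_top hC _).trans_eq ?_
  congr 1
  refine lintegral_congr fun y => lintegral_congr fun z => ?_
  split_ifs
  · rw [one_div]
  · rw [ENNReal.zero_div]

theorem gapPotentialSphere_le (hδ : 0 < δ) :
    gapPotentialSphere m ν δ u ≤
      ENNReal.ofReal (δ ^ (m + 1))⁻¹ * gagliardoEnergySphere m ν u := by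
  unfold gapPotentialSphere gagliardoEnergySphere
  rw [← lintegral_const_mul' _ _ ENNReal.ofReal_ne_top]
  refine lintegral_mono fun y => ?_
  rw [← lintegral_const_mul' _ _ ENNReal.ofReal_ne_top]
  refine lintegral_mono fun z => ?_
  split_ifs with h
  · rw [← mul_div_assoc, ← ENNReal.ofReal_mul (by positivity), ← one_div]
    refine ENNReal.div_le_div_right (ENNReal.one_le_ofReal.2 ?_) _
    rw [inv_mul_eq_div, one_le_div (by positivity)]
    gcongr
  · exact bot_le

theorem gapBoundSphere_ge {A B : ℝ} (hA : 0 < A) (hB : 0 < B) (hC0 : 0 < C) (hδ : 0 < δ)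
    (hC : sphMeasure m ≤ ENNReal.ofReal C •
      (μH[(m : ℝ)].restrict (sphere (0 : Euc (m + 1)) 1)))
    (h : v =ᵐ[μH[(m : ℝ)].restrict (sphere (0 : Euc (m + 1)) 1)] u)
    (hE : gagliardoEnergySphere m ν u ≠ ⊤) :
    ENNReal.ofReal (A * Real.exp (B * (sphGap δ v).toReal)) * sphEnergy v ≤
      gapBoundSphere m ν (A * (C * C)) (B * (C * C)) δ u := by
  have h1 := sphEnergy_le_gagliardoEnergySphere (u := v) hC
  have h2 := sphGap_le_gapPotentialSphere (u := v) (δ := δ) hC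
  rw [gagliardoEnergySphere_congr_ae h, ← ENNReal.ofReal_mul hC0.le] at h1
  rw [gapPotentialSphere_congr_ae h, ← ENNReal.ofReal_mul hC0.le] at h2
  have hG : gapPotentialSphere m ν δ u ≠ ⊤ :=
    ne_top_of_le_ne_top (ENNReal.mul_ne_top ENNReal.ofReal_ne_top hE) (gapPotentialSphere_le hδ)
  have h3 := ENNReal.toReal_mono (ENNReal.mul_ne_top ENNReal.ofReal_ne_top hG) h2
  rw [ENNReal.toReal_mul, ENNReal.toReal_ofReal (by positivity)] at h3
  unfold gapBoundSphere
  calc _ ≤ ENNReal.ofReal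
          (A * Real.exp (B * (C * C * (gapPotentialSphere m ν δ u).toReal))) *
          (ENNReal.ofReal (C * C) * gagliardoEnergySphere m ν u) := by gcongr
    _ = _ := by
        rw [← mul_assoc, ← ENNReal.ofReal_mul (by positivity)]
        congr 2
        ring_nf

theorem tendsto_trace_congr_ae (hu : Measurable u) (hv : Measurable v)
    (h : v =ᵐ[sphMeasure m] u) {U : Euc (m + 1) → Euc ν}
    (hU : Tendsto (fun ε : ℝ => ENNReal.ofReal ε⁻¹ *
      ∫⁻ x in {x : Euc (m + 1) | 1 - ε < ‖x‖ ∧ ‖x‖ < 1},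
        ENNReal.ofReal ‖U x - v (‖x‖⁻¹ • x)‖) (nhdsWithin 0 (Ioi 0)) (nhds 0)) :
    Tendsto (fun ε : ℝ => ENNReal.ofReal ε⁻¹ *
      ∫⁻ x in {x : Euc (m + 1) | 1 - ε < ‖x‖ ∧ ‖x‖ < 1},
        ENNReal.ofReal ‖U x - u (‖x‖⁻¹ • x)‖) (nhdsWithin 0 (Ioi 0)) (nhds 0) := by
  refine tendsto_of_tendsto_of_tendsto_of_le_of_le' tendsto_const_nhds hU
    (Eventually.of_forall fun _ => bot_le) ?_
  filter_upwards [Ioo_mem_nhdsGT one_pos] with ε hε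
  refine mul_le_mul_right ?_ _
  have hg : Measurable fun z => ENNReal.ofReal ‖v z - u z‖ := by fun_prop
  have h0 : ∫⁻ x in {x : Euc (m + 1) | 1 - ε < ‖x‖ ∧ ‖x‖ < 1},
      ENNReal.ofReal ‖v (‖x‖⁻¹ • x) - u (‖x‖⁻¹ • x)‖ = 0 := by
    refine le_antisymm ((exists_shell_lintegral_le m hε.2.le hg).trans_eq ?_) bot_le
    have h2 : ∫⁻ z, ENNReal.ofReal ‖v z - u z‖ ∂(sphMeasure m) = 0 := by
      rw [lintegral_eq_zero_iff hg]
      filter_upwards [h] with z hz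
      simp [hz]
    rw [h2, mul_zero]
  calc _ ≤ ∫⁻ x in {x : Euc (m + 1) | 1 - ε < ‖x‖ ∧ ‖x‖ < 1},
        (ENNReal.ofReal ‖U x - v (‖x‖⁻¹ • x)‖ +
          ENNReal.ofReal ‖v (‖x‖⁻¹ • x) - u (‖x‖⁻¹ • x)‖) := by
        refine lintegral_mono fun x => ?_
        rw [← ENNReal.ofReal_add (norm_nonneg _) (norm_nonneg _)]
        exact ENNReal.ofReal_le_ofReal (norm_sub_le_norm_sub_add_norm_sub _ _ _)
    _ = _ := by
        rw [lintegral_add_right _ (by fun_prop), h0, add_zero]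

end Comparison

/-- Theorem 3: controlled singular extension to the hyperbolic space (Poincaré
ball model) with an exponential weak-type Sobolev estimate for the hyperbolic
energy density and volume. -/
theorem singular_extension_hyperbolic (m ν : ℕ) (hm : 1 ≤ m) (hν : 1 ≤ ν)
    (N : Set (Euc ν)) (hNne : N.Nonempty) (hNcomp : IsCompact N)
    (ρN : ℝ) (hρN : 0 < ρN) (retr : Euc ν → Euc ν)
    (hretrC1 : ContDiffOn ℝ 1 retr {y | Metric.infDist y N < ρN})
    (hretrbd : ∃ L : ℝ, ∀ y ∈ {y : Euc ν | Metric.infDist y N < ρN},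
      ‖fderiv ℝ retr y‖ ≤ L)
    (hretrmaps : ∀ y ∈ {y : Euc ν | Metric.infDist y N < ρN}, retr y ∈ N)
    (hretrid : ∀ y ∈ N, retr y = y) :
    ∃ A B δ : ℝ, 0 < A ∧ 0 < B ∧ 0 < δ ∧
      ∀ u : Euc (m + 1) → Euc ν, Measurable u →
        (∀ᵐ x ∂(μH[(m : ℝ)].restrict (sphere (0 : Euc (m + 1)) 1)), u x ∈ N) →
        gagliardoEnergySphere m ν u ≠ ⊤ →
        ∃ (S : Set (Euc (m + 1))) (U : Euc (m + 1) → Euc ν),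
          S.Finite ∧ S ⊆ ball (0 : Euc (m + 1)) 1 ∧
          (S.ncard : ℝ≥0∞) ≤ gapBoundSphere m ν A B δ u ∧
          (∀ x ∈ ball (0 : Euc (m + 1)) 1, U x ∈ N) ∧
          ContinuousOn U (ball (0 : Euc (m + 1)) 1 \ S) ∧
          (∀ᵐ x ∂(volume.restrict (ball (0 : Euc (m + 1)) 1)),
            DifferentiableAt ℝ U x) ∧
          (∀ t : ℝ, 0 < t →
            (∫⁻ x in {x : Euc (m + 1) | x ∈ ball (0 : Euc (m + 1)) 1 ∧
                DifferentiableAt ℝ U x ∧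
                t ≤ (1 - ‖x‖ ^ 2) / 2 * ‖fderiv ℝ U x‖},
              ENNReal.ofReal ((2 / (1 - ‖x‖ ^ 2)) ^ (m + 1)))
              ≤ ENNReal.ofReal (t ^ (m + 1))⁻¹ * gapBoundSphere m ν A B δ u) ∧
          Tendsto (fun ε : ℝ => ENNReal.ofReal ε⁻¹ *
              ∫⁻ x in {x : Euc (m + 1) | 1 - ε < ‖x‖ ∧ ‖x‖ < 1},
                ENNReal.ofReal ‖U x - u (‖x‖⁻¹ • x)‖)
            (nhdsWithin 0 (Ioi 0)) (nhds 0) := by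
  obtain ⟨n₀, hn₀⟩ := hNne
  obtain ⟨L, hL⟩ := hretrbd
  have hopen : IsOpen {y : Euc ν | infDist y N < ρN} :=
    isOpen_lt (continuous_infDist_pt N) continuous_const
  obtain ⟨A, B, hA, hB, h⟩ := exists_singular_extension hm hNcomp hρN hn₀
    (fun y hy => ((hretrC1 y hy).contDiffAt (hopen.mem_nhds hy)).differentiableAt one_ne_zero)
    hL hretrmaps hretrid
  obtain ⟨C, hC0, hC⟩ := exists_sphMeasure_le_hausdorffMeasure m hm
  refine ⟨A * (C * C), B * (C * C), ρN / 4, by positivity, by positivity, by positivity,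
    fun u hu huN hE => ?_⟩
  classical
  set v : Euc (m + 1) → Euc ν := (u ⁻¹' N).piecewise u fun _ => n₀ with hv
  have hvm : Measurable v := hu.piecewise (hu hNcomp.isClosed.measurableSet) measurable_const
  have hvN : ∀ y, v y ∈ N := by
    intro y
    by_cases hy : y ∈ u ⁻¹' N
    · rw [hv, piecewise_eq_of_mem _ _ _ hy]
      exact hy
    · rwa [hv, piecewise_eq_of_notMem _ _ _ hy]
  have hvu : v =ᵐ[μH[(m : ℝ)].restrict (sphere (0 : Euc (m + 1)) 1)] u := by
    filter_upwards [huN] with y hy using piecewise_eq_of_mem _ _ _ hy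
  have hvE : sphEnergy v ≠ ⊤ := by
    refine ne_top_of_le_ne_top ?_ (sphEnergy_le_gagliardoEnergySphere hC)
    rw [gagliardoEnergySphere_congr_ae hvu]
    exact ENNReal.mul_ne_top (ENNReal.mul_ne_top ENNReal.ofReal_ne_top ENNReal.ofReal_ne_top) hE
  obtain ⟨S, U, hS, hSb, hSc, hUN, hUc, hUd, hUw, hUt⟩ := h v hvm hvN hvE
  have hbound := gapBoundSphere_ge hA hB hC0 (δ := ρN / 4) (by positivity) hC hvu hE
  refine ⟨S, U, hS, hSb, hSc.trans hbound, hUN, hUc, hUd,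
    fun t ht => (hUw t ht).trans (mul_le_mul_right hbound _), ?_⟩
  exact tendsto_trace_congr_ae hu hvm
    (hvu.filter_mono ((Measure.absolutelyContinuous_of_le_smul hC).ae_le)) hUt
end
end

section
/- For every integer m ≥ 1 there exists a constant C = C(m) ∈ (0,∞) such that for every p ∈ [1,∞), every compact metric space (N,d), every Borel measurable map u : ℝ^m → N, every λ ∈ [2,∞) and every δ ∈ [0,∞), one has ∫_1^λ Σ_{k∈ℤ} ∫_{[0,1]^m} Σ_{j∈ℤ^m} sup{ MO_{δ,p}u(x', τλ^{−k}/(λ−1)) : x' ∈ τλ^{−k}([0,1]^m + j + h) } dh (dτ/τ) ≤ C · ∬_{ℝ^m×ℝ^m} (d(u(y),u(z)) − δ)_+^p / |y−z|^{2m} dy dz. -/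
open MeasureTheory Metric Set
open scoped ENNReal Topology

noncomputable section

/-- Truncated mean oscillation `MO_{δ,p} u (x', r)` of a map `u : ℝ^m → N`:
the double average over the ball of radius `r` centered at `x'` of
`(d(u y, u z) - δ)₊ ^ p`. -/
def MO {N : Type} [PseudoMetricSpace N] {m : ℕ} (p δ : ℝ) (u : Euc m → N)
    (x' : Euc m) (r : ℝ) : ℝ≥0∞ :=
  (volume (ball x' r))⁻¹ * (volume (ball x' r))⁻¹ *
    ∫⁻ y in ball x' r, ∫⁻ z in ball x' r,
      ENNReal.ofReal (max (dist (u y) (u z) - δ) 0 ^ p)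

/-- Truncated Gagliardo energy `∬ (d(u y, u z) - δ)₊^p / |y-z|^{2m}`. -/
def truncGagliardo {N : Type} [PseudoMetricSpace N] {m : ℕ} (p δ : ℝ)
    (u : Euc m → N) : ℝ≥0∞ :=
  ∫⁻ y, ∫⁻ z, ENNReal.ofReal (max (dist (u y) (u z) - δ) 0 ^ p) /
    ENNReal.ofReal (dist y z ^ (2 * m))

/-- The cube `r·([0,1]^m + c)` of edge length `r` in `ℝ^m`. -/
def cube (m : ℕ) (r : ℝ) (c : Fin m → ℝ) : Set (Euc m) :=
  {x | ∀ i, x i ∈ Icc (r * c i) (r * (c i + 1))}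

theorem lintegral_Ioc_comp_mul_mul_inv (G : ℝ → ℝ≥0∞) {a lam : ℝ} (ha : 0 < a) :
    ∫⁻ τ in Ioc (1 : ℝ) lam, G (τ * a) * ENNReal.ofReal τ⁻¹ =
      ∫⁻ s in Ioc a (lam * a), G s * ENNReal.ofReal s⁻¹ := by
  have himage : (fun τ : ℝ => τ * a) '' Ioc 1 lam = Ioc a (lam * a) := by
    rw [image_mul_right_Ioc _ _ ha, one_mul]
  rw [← himage, lintegral_image_eq_lintegral_abs_deriv_mul (f' := fun _ => a) measurableSet_Ioc
    (fun x _ => by simpa using ((hasDerivAt_id x).mul_const a).hasDerivWithinAt)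
    (fun x _ y _ hxy => mul_right_cancel₀ ha.ne' hxy)]
  refine setLIntegral_congr_fun measurableSet_Ioc fun τ hτ => ?_
  have hτ0 : 0 < τ := one_pos.trans hτ.1
  have hinv : τ⁻¹ = a * (τ * a)⁻¹ := by field_simp
  rw [hinv, abs_of_pos ha, ENNReal.ofReal_mul ha.le]
  ring

theorem lintegral_Ioc_tsum_comp_mul_zpow {G : ℝ → ℝ≥0∞} (hG : Measurable G) {lam : ℝ}
    (hlam : 1 < lam) :
    ∫⁻ τ in Ioc (1 : ℝ) lam, (∑' k : ℤ, G (τ * lam ^ (-k))) * ENNReal.ofReal τ⁻¹ =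
      ∫⁻ s in Ioi (0 : ℝ), G s * ENNReal.ofReal s⁻¹ := by
  have hlam0 : 0 < lam := one_pos.trans hlam
  have hunion : ⋃ k : ℤ, Ioc (lam ^ k) (lam ^ (k + 1)) = Ioi (0 : ℝ) := by
    ext x
    simp only [mem_iUnion, mem_Ioi]
    exact ⟨fun ⟨k, hk⟩ => (zpow_pos hlam0 k).trans hk.1, fun hx => exists_mem_Ioc_zpow hx hlam⟩
  have hdisj : Pairwise (Function.onFun Disjoint fun k : ℤ => Ioc (lam ^ k) (lam ^ (k + 1))) := by
    simpa only [Order.succ_eq_add_one] using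
      (zpow_right_mono₀ hlam.le).pairwise_disjoint_on_Ioc_succ
  simp_rw [← ENNReal.tsum_mul_right]
  rw [lintegral_tsum fun k => by fun_prop, ← hunion,
    lintegral_iUnion (fun _ => measurableSet_Ioc) hdisj,
    ← (Equiv.neg ℤ).tsum_eq]
  refine tsum_congr fun k => ?_
  rw [Equiv.neg_apply, neg_neg, lintegral_Ioc_comp_mul_mul_inv G (zpow_pos hlam0 k),
    zpow_add_one₀ hlam0.ne', mul_comm lam]

/-- The weight `r⁻ⁿ`, `r = s / b`, restricted to distances `D < 2 r`. -/
def scaleWeight (n : ℕ) (b s D : ℝ) : ℝ≥0∞ :=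
  {q : ℝ × ℝ | q.2 < 2 * (q.1 / b)}.indicator
    (fun q => (ENNReal.ofReal ((q.1 / b) ^ n))⁻¹) (s, D)

theorem measurable_scaleWeight (n : ℕ) (b : ℝ) :
    Measurable fun q : ℝ × ℝ => scaleWeight n b q.1 q.2 := by
  unfold scaleWeight
  exact Measurable.indicator (by fun_prop) (measurableSet_lt (by fun_prop) (by fun_prop))

theorem lintegral_scaleWeight {n : ℕ} (hn : 1 ≤ n) {b D : ℝ} (hb : 0 < b) (hD : 0 < D) :
    ∫⁻ s in Ioi (0 : ℝ), scaleWeight n b s D * ENNReal.ofReal s⁻¹ =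
      ENNReal.ofReal (2 ^ n / n) * (ENNReal.ofReal (D ^ n))⁻¹ := by
  have hn0 : (0 : ℝ) < n := by exact_mod_cast hn
  set c : ℝ := D * b / 2 with hc
  have hc0 : 0 < c := by positivity
  have ha : -((n : ℝ) + 1) < -1 := by linarith
  have hpoint : ∀ s ∈ Ioi (0 : ℝ), scaleWeight n b s D * ENNReal.ofReal s⁻¹ =
      (Ioi c).indicator (fun s => ENNReal.ofReal (b ^ n * s ^ (-((n : ℝ) + 1)))) s := by
    intro s hs
    have hs : 0 < s := hs
    by_cases h : c < s
    · have h' : D < 2 * (s / b) := by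
        rw [hc] at h
        rw [← mul_div_assoc, lt_div_iff₀ hb]; linarith
      rw [scaleWeight, indicator_of_mem (by simpa using h'), indicator_of_mem (by simpa using h),
        ← ENNReal.ofReal_inv_of_pos (by positivity), ← ENNReal.ofReal_mul (by positivity)]
      congr 1
      rw [Real.rpow_neg hs.le, Real.rpow_add_one hs.ne', Real.rpow_natCast, div_pow]
      field_simp
    · have h' : ¬ D < 2 * (s / b) := by
        rw [hc] at h
        rw [← mul_div_assoc, lt_div_iff₀ hb]; linarith
      rw [scaleWeight, indicator_of_notMem (by simpa using h'),
        indicator_of_notMem (by simpa using h), zero_mul]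
  rw [setLIntegral_congr_fun measurableSet_Ioi hpoint, lintegral_indicator measurableSet_Ioi,
    Measure.restrict_restrict measurableSet_Ioi,
    inter_eq_left.2 (Ioi_subset_Ioi hc0.le),
    ← ofReal_integral_eq_lintegral_ofReal ((integrableOn_Ioi_rpow_of_lt ha hc0).const_mul _)
      ((ae_restrict_iff' measurableSet_Ioi).2 (.of_forall fun s hs => by
        have : 0 < s := hc0.trans hs
        simp only [Pi.zero_apply]; positivity)),
    integral_const_mul, integral_Ioi_rpow_of_lt ha hc0,
    ← ENNReal.ofReal_inv_of_pos (by positivity), ← ENNReal.ofReal_mul (by positivity)]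
  congr 1
  have hexp : -((n : ℝ) + 1) + 1 = -n := by ring
  rw [hexp, Real.rpow_neg hc0.le, Real.rpow_natCast, hc, div_pow, mul_pow]
  field_simp

theorem lintegral_prod_scaleWeight_mul {m : ℕ} {f : Euc m → Euc m → ℝ≥0∞}
    (hf : Measurable (Function.uncurry f)) (n : ℕ) {b s : ℝ} (hb : 0 < b) (hs : 0 < s) :
    ∫⁻ q : Euc m × Euc m, scaleWeight n b s (dist q.1 q.2) * f q.1 q.2 =
      (ENNReal.ofReal ((s / b) ^ n))⁻¹ * ∫⁻ y, ∫⁻ z in ball y (2 * (s / b)), f y z := by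
  have hW : Measurable fun q : Euc m × Euc m =>
      scaleWeight n b s (dist q.1 q.2) * f q.1 q.2 :=
    ((measurable_scaleWeight n b).comp (by fun_prop :
      Measurable fun q : Euc m × Euc m => (s, dist q.1 q.2))).mul hf
  have htop : (ENNReal.ofReal ((s / b) ^ n))⁻¹ ≠ ⊤ :=
    ENNReal.inv_ne_top.2 (ENNReal.ofReal_pos.2 (by positivity)).ne'
  rw [Measure.volume_eq_prod, lintegral_prod _ hW.aemeasurable, ← lintegral_const_mul' _ _ htop]
  refine lintegral_congr fun y => ?_
  rw [← lintegral_const_mul' _ _ htop, ← lintegral_indicator measurableSet_ball]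
  refine lintegral_congr fun z => ?_
  by_cases hyz : dist y z < 2 * (s / b)
  · rw [indicator_of_mem (by rwa [mem_ball']), scaleWeight, indicator_of_mem (by simpa using hyz)]
  · rw [indicator_of_notMem (by rwa [mem_ball']), scaleWeight,
      indicator_of_notMem (by simpa using hyz), zero_mul]

theorem tsum_pi_Icc_indicator_le {m : ℕ} (a : Fin m → ℝ) (c : ℝ≥0∞) :
    ∑' j : Fin m → ℤ, {j : Fin m → ℤ | ∀ i, (j i : ℝ) ∈ Icc (a i) (a i + 3)}.indicator
      (fun _ => c) j ≤ 4 ^ m * c := by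
  set s : Finset (Fin m → ℤ) := Fintype.piFinset fun i => Finset.Icc ⌈a i⌉ ⌊a i + 3⌋ with hs
  have hcard : s.card ≤ 4 ^ m := by
    rw [hs, Fintype.card_piFinset]
    refine (Finset.prod_le_pow_card _ _ 4 fun i _ => ?_).trans (by simp)
    have h1 : (⌊a i + 3⌋ : ℝ) ≤ a i + 3 := Int.floor_le _
    have h2 : a i ≤ (⌈a i⌉ : ℝ) := Int.le_ceil _
    have h3 : ⌊a i + 3⌋ ≤ ⌈a i⌉ + 3 := by
      have : (⌊a i + 3⌋ : ℝ) ≤ ((⌈a i⌉ + 3 : ℤ) : ℝ) := by push_cast; linarith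
      exact_mod_cast this
    rw [Int.card_Icc]
    omega
  rw [tsum_eq_sum (s := s)]
  · calc _ ≤ ∑ _j ∈ s, c := Finset.sum_le_sum fun j _ => indicator_le_self _ _ j
      _ = s.card * c := by simp
      _ ≤ 4 ^ m * c := by gcongr; exact_mod_cast hcard
  · intro j hj
    refine indicator_of_notMem (fun hmem => hj ?_) _
    rw [hs, Fintype.mem_piFinset]
    exact fun i => Finset.mem_Icc.2 ⟨Int.ceil_le.2 (hmem i).1, Int.le_floor.2 (hmem i).2⟩

theorem tsum_iSup_cube_le {m : ℕ} {f : Euc m → Euc m → ℝ≥0∞}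
    (hf : Measurable (Function.uncurry f)) {r l : ℝ} (hr : 0 < r) (hrl : r ≤ l)
    (h : Fin m → ℝ) :
    ∑' j : Fin m → ℤ, ⨆ x' ∈ cube m l (fun i => (j i : ℝ) + h i),
        ∫⁻ y in ball x' r, ∫⁻ z in ball x' r, f y z ≤
      4 ^ m * ∫⁻ y, ∫⁻ z in ball y (2 * r), f y z := by
  have hl : 0 < l := hr.trans_le hrl
  set E : (Fin m → ℤ) → Set (Euc m) := fun j =>
    {y | ∀ i, (j i : ℝ) ∈ Icc (y i / l - h i - 2) (y i / l - h i - 2 + 3)} with hE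
  have hEmeas : ∀ j, MeasurableSet (E j) := fun j => by
    simp only [hE, mem_Icc, Set.ofPred_forall, Set.ofPred_and]
    exact .iInter fun i => (measurableSet_le (by fun_prop) (by fun_prop)).inter
      (measurableSet_le (by fun_prop) (by fun_prop))
  have hGmeas : Measurable fun y => ∫⁻ z in ball y (2 * r), f y z := by
    have heq : ∀ y, ∫⁻ z in ball y (2 * r), f y z =
        ∫⁻ z, {q : Euc m × Euc m | dist q.2 q.1 < 2 * r}.indicator (Function.uncurry f) (y, z) := by
      intro y
      rw [← lintegral_indicator measurableSet_ball]
      rfl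
    simp_rw [heq]
    exact (hf.indicator (measurableSet_lt (by fun_prop) (by fun_prop))).lintegral_prod_right'
  calc
    _ ≤ ∑' j, ∫⁻ y, (E j).indicator (fun y => ∫⁻ z in ball y (2 * r), f y z) y := by
      refine ENNReal.tsum_le_tsum fun j => iSup₂_le fun x hx => ?_
      rw [lintegral_indicator (hEmeas j)]
      refine (lintegral_mono_set ?_).trans' (setLIntegral_mono' measurableSet_ball fun y hy =>
        lintegral_mono_set fun z hz => ?_)
      · intro y hy i
        have hxi := hx i
        have hd : |y i - x i| < r := by
          have h1 : ‖(y - x) i‖ ≤ ‖y - x‖ := PiLp.norm_apply_le (y - x) i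
          rw [← dist_eq_norm] at h1
          exact h1.trans_lt hy
        rw [abs_lt] at hd
        have h1 : y i / l ≤ (j i : ℝ) + h i + 2 := by
          rw [div_le_iff₀ hl]; nlinarith [hxi.1, hxi.2]
        have h2 : (j i : ℝ) + h i - 1 ≤ y i / l := by
          rw [le_div_iff₀ hl]; nlinarith [hxi.1, hxi.2]
        constructor <;> linarith
      · have h1 : dist y x < r := hy
        have h2 : dist z x < r := hz
        rw [mem_ball]
        linarith [dist_triangle_right z y x]
    _ = ∫⁻ y, ∑' j, (E j).indicator (fun y => ∫⁻ z in ball y (2 * r), f y z) y :=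
      (lintegral_tsum fun j => (hGmeas.indicator (hEmeas j)).aemeasurable).symm
    _ ≤ ∫⁻ y, 4 ^ m * ∫⁻ z in ball y (2 * r), f y z :=
      lintegral_mono fun y =>
        tsum_pi_Icc_indicator_le (fun i => y i / l - h i - 2) (∫⁻ z in ball y (2 * r), f y z)
    _ = _ := lintegral_const_mul _ hGmeas

/-- Proposition 2.1 (longitudinal estimate). -/
theorem longitudinal_estimate (m : ℕ) (hm : 1 ≤ m) :
    ∃ C : ℝ, 0 < C ∧
      ∀ (p : ℝ), 1 ≤ p →
      ∀ (N : Type) [MetricSpace N] [CompactSpace N]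
        [MeasurableSpace N] [BorelSpace N],
      ∀ (u : Euc m → N), Measurable u →
      ∀ (lam : ℝ), 2 ≤ lam →
      ∀ (δ : ℝ), 0 ≤ δ →
      (∫⁻ τ in Ioc (1 : ℝ) lam,
        (∑' k : ℤ, ∫⁻ h in Icc (0 : Fin m → ℝ) 1,
          ∑' j : Fin m → ℤ,
            ⨆ x' ∈ cube m (τ * lam ^ (-k)) (fun i => (j i : ℝ) + h i),
              MO p δ u x' (τ * lam ^ (-k) / (lam - 1)))
          * ENNReal.ofReal τ⁻¹)
      ≤ ENNReal.ofReal C * truncGagliardo p δ u := by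
  set V : ℝ≥0∞ := volume (ball (0 : Euc m) 1) with hV
  have hV0 : V ≠ 0 := (measure_ball_pos _ _ one_pos).ne'
  have hVtop : V ≠ ⊤ := measure_ball_lt_top.ne
  set K : ℝ≥0∞ := V⁻¹ * V⁻¹ * 4 ^ m with hK
  have hK0 : K ≠ 0 := by simp [hK, hVtop]
  have hKtop : K ≠ ⊤ := by
    simp only [hK]
    finiteness
  have hc : (0 : ℝ) < 2 ^ (2 * m) / (2 * m : ℕ) := by
    have : (0 : ℝ) < (2 * m : ℕ) := by exact_mod_cast (by omega : 0 < 2 * m)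
    positivity
  refine ⟨K.toReal * (2 ^ (2 * m) / (2 * m : ℕ)),
    mul_pos (ENNReal.toReal_pos hK0 hKtop) hc, ?_⟩
  intro p hp N _ _ _ _ u hu lam hlam δ hδ
  set b : ℝ := lam - 1 with hb_def
  have hb : 0 < b := by linarith
  set f : Euc m → Euc m → ℝ≥0∞ := fun y z =>
    ENNReal.ofReal (max (dist (u y) (u z) - δ) 0 ^ p) with hf_def
  have hf : Measurable (Function.uncurry f) := by
    simp only [hf_def, Function.uncurry_def]
    fun_prop
  have hW : Measurable fun q : ℝ × Euc m × Euc m =>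
      scaleWeight (2 * m) b q.1 (dist q.2.1 q.2.2) * f q.2.1 q.2.2 :=
    ((measurable_scaleWeight (2 * m) b).comp (by fun_prop :
      Measurable fun q : ℝ × Euc m × Euc m => (q.1, dist q.2.1 q.2.2))).mul
      (hf.comp measurable_snd)
  set P : ℝ → ℝ≥0∞ := fun s => ∫⁻ q : Euc m × Euc m,
    scaleWeight (2 * m) b s (dist q.1 q.2) * f q.1 q.2 with hP_def
  have hP : Measurable P := hW.lintegral_prod_right'
  have hscale : ∀ s : ℝ, 0 < s → ∀ h : Fin m → ℝ,
      ∑' j : Fin m → ℤ, ⨆ x' ∈ cube m s (fun i => (j i : ℝ) + h i), MO p δ u x' (s / b) ≤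
        K * P s := by
    intro s hs h
    have hr : 0 < s / b := by positivity
    have hMO : ∀ x', MO p δ u x' (s / b) = V⁻¹ * V⁻¹ * (ENNReal.ofReal ((s / b) ^ (2 * m)))⁻¹ *
        ∫⁻ y in ball x' (s / b), ∫⁻ z in ball x' (s / b), f y z := by
      intro x'
      have hball : (volume (ball x' (s / b)))⁻¹ = (ENNReal.ofReal ((s / b) ^ m))⁻¹ * V⁻¹ := by
        rw [Measure.addHaar_ball_of_pos _ _ hr, finrank_euclideanSpace_fin,
          ENNReal.mul_inv (Or.inr hVtop) (Or.inr hV0)]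
      have hpow : (ENNReal.ofReal ((s / b) ^ (2 * m)))⁻¹ =
          (ENNReal.ofReal ((s / b) ^ m))⁻¹ * (ENNReal.ofReal ((s / b) ^ m))⁻¹ := by
        rw [two_mul, pow_add, ENNReal.ofReal_mul (by positivity),
          ENNReal.mul_inv (Or.inr ENNReal.ofReal_ne_top) (Or.inl ENNReal.ofReal_ne_top)]
      rw [MO, hball, hpow]
      ring
    have hPs := lintegral_prod_scaleWeight_mul hf (2 * m) hb hs
    simp_rw [hMO, ← ENNReal.mul_iSup, ENNReal.tsum_mul_left]
    refine (mul_le_mul_right (tsum_iSup_cube_le hf hr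
      (div_le_self hs.le (by linarith)) h) _).trans_eq ?_
    refine Eq.trans ?_ (congrArg (K * ·) hPs.symm)
    simp only [hK]
    ring
  have hinner : ∀ q : Euc m × Euc m,
      ∫⁻ s in Ioi (0 : ℝ), scaleWeight (2 * m) b s (dist q.1 q.2) * f q.1 q.2 *
        ENNReal.ofReal s⁻¹ ≤ ENNReal.ofReal (2 ^ (2 * m) / (2 * m : ℕ)) *
          (f q.1 q.2 / ENNReal.ofReal (dist q.1 q.2 ^ (2 * m))) := by
    rintro ⟨y, z⟩
    rcases eq_or_ne y z with rfl | hyz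
    · have hf0 : f y y = 0 := by
        simp [hf_def, max_eq_right (neg_nonpos.2 hδ), Real.zero_rpow (by linarith : p ≠ 0)]
      simp [hf0]
    · have hftop : f y z ≠ ⊤ := ENNReal.ofReal_ne_top
      have := lintegral_scaleWeight (n := 2 * m) (by omega) hb (dist_pos.2 hyz)
      simp_rw [mul_right_comm]
      rw [lintegral_mul_const' _ _ hftop, this, mul_assoc, ← ENNReal.div_eq_inv_mul]
  calc
    _ ≤ ∫⁻ τ in Ioc (1 : ℝ) lam, K * ((∑' k : ℤ, P (τ * lam ^ (-k))) * ENNReal.ofReal τ⁻¹) := by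
      refine setLIntegral_mono' measurableSet_Ioc fun τ hτ => ?_
      rw [← mul_assoc, ← ENNReal.tsum_mul_left]
      gcongr with k
      refine (lintegral_mono (hscale _ (mul_pos (one_pos.trans hτ.1)
        (zpow_pos (by linarith) _)))).trans_eq ?_
      simp [Real.volume_Icc_pi]
    _ = K * ∫⁻ s in Ioi (0 : ℝ), P s * ENNReal.ofReal s⁻¹ := by
      rw [lintegral_const_mul' _ _ hKtop, lintegral_Ioc_tsum_comp_mul_zpow hP (by linarith)]
    _ = K * ∫⁻ q : Euc m × Euc m, ∫⁻ s in Ioi (0 : ℝ),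
        scaleWeight (2 * m) b s (dist q.1 q.2) * f q.1 q.2 * ENNReal.ofReal s⁻¹ := by
      rw [← lintegral_lintegral_swap]
      · simp_rw [hP_def, lintegral_mul_const' _ _ ENNReal.ofReal_ne_top]
      · exact (hW.mul (by fun_prop)).aemeasurable
    _ ≤ K * ∫⁻ q : Euc m × Euc m, ENNReal.ofReal (2 ^ (2 * m) / (2 * m : ℕ)) *
          (f q.1 q.2 / ENNReal.ofReal (dist q.1 q.2 ^ (2 * m))) := by
      gcongr with q
      exact hinner q
    _ = _ := by
      rw [lintegral_const_mul' _ _ ENNReal.ofReal_ne_top, ENNReal.ofReal_mul ENNReal.toReal_nonneg,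
        ENNReal.ofReal_toReal hKtop, mul_assoc K, Measure.volume_eq_prod, lintegral_prod]
      · rfl
      · exact (Measurable.div hf (by fun_prop)).aemeasurable
end
end
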